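/- arXiv:2302.12754 — 2 statements merged into one kernel-verified Lean document; each statement's English description precedes it below -/
import Mathlib

section
/- Call a Hausdorff topological space a Souslin space if it is the image of a complete separable metric space under a continuous mapping. A Borel probability measure $\mu$ on a topological space $X$ is called Radon if for every Borel set $B\subset X$ and every $\varepsilon>0$ there is a compact set $K\subset B$ with $\mu(B\setminus K)<\varepsilon$; let $\mathcal P_r(X)$ be the set of Radon probability measures on $X$, whose weak topology is the one generated by integration against bounded continuous functions. For Borel probability measures $\mu$ on $X$ and $\nu$ on $Y$, let $\Pi(\mu,\nu)$ be the set of Borel probability measures on $X\times Y$ with projections $\mu$ and $\nu$ on $X$ and $Y$, and for a nonnegative Borel function $h$ on $X\times Y$ let $K_h(\mu,\nu)=\inf\{\int h\,d\sigma:\sigma\in\Pi(\mu,\nu)\}$. A Borel mapping $S\colon X\to Y$ with $\mu\circ S^{-1}=\nu$ is called an $\varepsilon$-optimal Monge mapping for the cost function $h$ and the measures $\mu,\nu$ if $\int_X h(x,S(x))\,\mu(dx)\le K_h(\mu,\nu)+\varepsilon$. Let $X$ be a Souslin space, $Y$ a complete metric space and $T$ a metric space. Suppose that the mapping $t\mapsto\nu_t$,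 $T\to\mathcal P_r(Y)$, is continuous in the weak topology, that the mapping $t\mapsto\mu_t$, $T\to\mathcal P_r(X)$, is continuous in the total variation norm, and that the measures $\mu_t$ are non-atomic for all $t\in T$. Let $h\colon X\times Y\times T\to[0,\infty)$ be a continuous function such that $h(x,y,t)\le a_t(x)+b_t(y)$, where $a_t\in L^1(\mu_t)$ and $b_t\in L^1(\nu_t)$ are nonnegative Borel functions with $$\lim_{R\to+\infty}\ \sup_{t\in T}\Bigl(\int_{\{a_t\ge R\}}a_t\,d\mu_t+\int_{\{b_t\ge R\}}b_t\,d\nu_t\Bigr)=0.$$ Then for every $\varepsilon>0$ one can select mappings $T_t^\varepsilon\colon X\to Y$, $t\in T$, such that for every $t\in T$ the mapping $T_t^\varepsilon$ is an $\varepsilon$-optimal Monge mapping for the cost function $h_t=h(\cdot,\cdot,t)$ and the measures $\mu_t,\nu_t$ (in particular $\mu_t\circ(T_t^\varepsilon)^{-1}=\nu_t$), and such that $T_t^\varepsilon$ is continuous in $t$ in the sense of convergence $\mu_t$-a.e.: if $t_n\to t$ as $n\to\infty$, then $T_{t_n}^\varepsilon(x)\to T_t^\varepsilon(x)$ for $\mu_t$-a.e.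 $x\in X$. -/
open MeasureTheory Filter Topology

noncomputable section

/-- `σ ∈ Π(μ, ν)`: a measure on the Borel `σ`-algebra of the product space `X × Y` (which may be
larger than the product of the Borel `σ`-algebras) with projections `μ` and `ν`, that is,
`σ (A × Y) = μ A` and `σ (X × B) = ν B` for all Borel sets `A`, `B`.
If `μ` is a probability measure, so is `σ`. -/
def IsCoupling {X Y : Type*} [TopologicalSpace X] [TopologicalSpace Y]
    [MeasurableSpace X] [MeasurableSpace Y]
    (σ : @Measure (X × Y) (borel (X × Y))) (μ : Measure X) (ν : Measure Y) : Prop :=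
  (∀ A : Set X, MeasurableSet A → σ (A ×ˢ Set.univ) = μ A) ∧
    (∀ B : Set Y, MeasurableSet B → σ (Set.univ ×ˢ B) = ν B)

/-- The Kantorovich cost `K_h(μ, ν) = inf {∫ h dσ : σ ∈ Π(μ, ν)}` of a nonnegative
cost function `h`. -/
def kantorovichCost {X Y : Type*} [TopologicalSpace X] [TopologicalSpace Y]
    [MeasurableSpace X] [MeasurableSpace Y]
    (h : X → Y → ℝ) (μ : Measure X) (ν : Measure Y) : ENNReal :=
  ⨅ (σ : @Measure (X × Y) (borel (X × Y))) (_ : IsCoupling σ μ ν),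
    ∫⁻ p, ENNReal.ofReal (h p.1 p.2) ∂σ

/-- `S` is an `ε`-optimal Monge mapping for the cost function `h` and the measures `μ`, `ν`. -/
def IsEpsOptimalMonge {X Y : Type*} [TopologicalSpace X] [TopologicalSpace Y]
    [MeasurableSpace X] [MeasurableSpace Y]
    (ε : ℝ) (h : X → Y → ℝ) (μ : Measure X) (ν : Measure Y) (S : X → Y) : Prop :=
  Measurable S ∧ μ.map S = ν ∧
    ∫⁻ x, ENNReal.ofReal (h x (S x)) ∂μ ≤ kantorovichCost h μ ν + ENNReal.ofReal ε

/-- `μ` is non-atomic: it has no atoms, that is, every measurable set of positive measure has a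
measurable subset of strictly smaller positive measure. -/
def IsNonatomic {X : Type*} [MeasurableSpace X] (μ : Measure X) : Prop :=
  ∀ s : Set X, MeasurableSet s → 0 < μ s → ∃ t ⊆ s, MeasurableSet t ∧ 0 < μ t ∧ μ t < μ s

/-- The distance `sup_B |μ(B) − ν(B)|` over measurable sets `B`; for probability measures it is
half of the total variation norm of `μ − ν`. One of the two truncated differences is zero. -/
def tvDist {X : Type*} [MeasurableSpace X] (μ ν : Measure X) : ENNReal :=
  ⨆ (s : Set X) (_ : MeasurableSet s), ((μ s - ν s) + (ν s - μ s))

/-- The family `t ↦ μ t` is continuous in the total variation norm. -/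
def TVContinuousFamily {T X : Type*} [TopologicalSpace T] [MeasurableSpace X]
    (μ : T → Measure X) : Prop :=
  ∀ t₀ : T, Tendsto (fun t => tvDist (μ t) (μ t₀)) (𝓝 t₀) (𝓝 0)

end

open scoped BoundedContinuousFunction NNReal ENNReal

/-- A Hausdorff space that is a continuous image of a complete separable metric space carries a
measurable injection into the Cantor space that induces its Borel sets. -/
theorem exists_encoding {X Z : Type*} [TopologicalSpace X] [T2Space X]
    [MetricSpace Z] [CompleteSpace Z] [TopologicalSpace.SeparableSpace Z]
    [MeasurableSpace X] [BorelSpace X]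
    {f : Z → X} (hf : Continuous f) (hfsurj : Function.Surjective f) :
    ∃ e : X → ℕ → Bool, Measurable e ∧ Function.Injective e ∧
      ∀ A : Set X, MeasurableSet A → ∃ B, MeasurableSet B ∧ e ⁻¹' B = A := by
  have : SecondCountableTopology Z := UniformSpace.secondCountable_of_separable Z
  let ι := {UV : Set X × Set X // IsOpen UV.1 ∧ IsOpen UV.2 ∧ Disjoint UV.1 UV.2}
  obtain ⟨C, hC, hCU⟩ := TopologicalSpace.isOpen_iUnion_countable
    (fun UV : ι => (f ⁻¹' UV.1.1) ×ˢ (f ⁻¹' UV.1.2))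
    (fun UV => (UV.2.1.preimage hf).prod (UV.2.2.1.preimage hf))
  let S : Set (Set X) := (fun UV : ι => UV.1.1) '' C
  have hS : S.Countable := hC.image _
  have hSsep : ∀ x y : X, x ≠ y → ∃ s ∈ S, x ∈ s ∧ y ∉ s := by
    intro x y hxy
    obtain ⟨U, V, hU, hV, hxU, hyV, hUV⟩ := t2_separation hxy
    obtain ⟨z, rfl⟩ := hfsurj x
    obtain ⟨w, rfl⟩ := hfsurj y
    have hm : (z, w) ∈ ⋃ UV : ι, (f ⁻¹' UV.1.1) ×ˢ (f ⁻¹' UV.1.2) :=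
      Set.mem_iUnion.2 ⟨⟨(U, V), hU, hV, hUV⟩, hxU, hyV⟩
    rw [← hCU] at hm
    obtain ⟨UV, hUVC, h1, h2⟩ := Set.mem_iUnion₂.1 hm
    exact ⟨UV.1.1, ⟨UV, hUVC, rfl⟩, h1, fun h3 => Set.disjoint_left.1 UV.2.2.2 h3 h2⟩
  have hle : MeasurableSpace.generateFrom S ≤ (inferInstance : MeasurableSpace X) := by
    refine MeasurableSpace.generateFrom_le ?_
    rintro s ⟨UV, -, rfl⟩
    exact UV.2.1.measurableSet
  borelize Z
  have hfm : Measurable f := hf.measurable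
  have hsep : @MeasurableSpace.SeparatesPoints X (MeasurableSpace.generateFrom S) := by
    refine @MeasurableSpace.SeparatesPoints.mk X (MeasurableSpace.generateFrom S) fun x y hxy => ?_
    by_contra hne
    obtain ⟨s, hs, hx, hy⟩ := hSsep x y hne
    exact hy (hxy s (MeasurableSpace.measurableSet_generateFrom hs) hx)
  have hcg : @MeasurableSpace.CountablyGenerated X (MeasurableSpace.generateFrom S) :=
    @MeasurableSpace.CountablyGenerated.mk X (MeasurableSpace.generateFrom S) ⟨S, hS, rfl⟩
  have hcs : @MeasurableSpace.CountablySeparated X (MeasurableSpace.generateFrom S) :=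
    @MeasurableSpace.countablySeparated_of_separatesPoints X
      (MeasurableSpace.generateFrom S) hcg hsep
  have heq : MeasurableSpace.generateFrom S = (inferInstance : MeasurableSpace X) := by
    refine le_antisymm hle fun A hA => ?_
    have h1 : MeasurableSet (f ⁻¹' A) := hfm hA
    have hfm' : @Measurable Z X _ (MeasurableSpace.generateFrom S) f := hfm.mono le_rfl hle
    exact (@Measurable.measurableSet_preimage_iff_of_surjective Z X _ _
      (MeasurableSpace.generateFrom S) hcs f hfm' hfsurj A).1 h1
  rw [heq] at hsep hcg
  obtain ⟨s, ⟨E⟩⟩ := MeasurableSpace.measurableEquiv_nat_bool_of_countablyGenerated X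
  refine ⟨fun x => (E x : ℕ → Bool), measurable_subtype_coe.comp E.measurable,
    Subtype.val_injective.comp E.injective, fun A hA => ?_⟩
  obtain ⟨B, hB, hBA⟩ := E.symm.measurable hA
  refine ⟨B, hB, ?_⟩
  ext x
  have : E x ∈ (Subtype.val ⁻¹' B : Set s) ↔ E x ∈ E.symm ⁻¹' A := by rw [hBA]
  simpa using this

theorem measure_singleton_eq_zero_of_isNonatomic {X : Type*} [MeasurableSpace X]
    [MeasurableSingletonClass X] {μ : Measure X} (hμ : IsNonatomic μ) (x : X) : μ {x} = 0 := by
  by_contra hne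
  obtain ⟨t, hts, -, ht0, htlt⟩ := hμ {x} (measurableSet_singleton x) (pos_iff_ne_zero.2 hne)
  rcases Set.subset_singleton_iff_eq.1 hts with rfl | rfl
  · simp at ht0
  · exact lt_irrefl _ htlt

theorem continuous_measureReal_Iic (η : Measure ℝ) [IsFiniteMeasure η] [NullSingletonClass η] :
    Continuous fun s => η.real (Set.Iic s) := by
  rw [continuous_iff_continuousAt]
  intro s
  refine (ENNReal.tendsto_toReal (measure_ne_top η _)).comp ?_
  refine tendsto_measure_of_ae_tendsto_indicator_of_isFiniteMeasure (𝓝 s) measurableSet_Iic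
    (fun _ => measurableSet_Iic) ?_
  have : ∀ᵐ y ∂η, y ≠ s := by
    rw [ae_iff]; simp
  filter_upwards [this] with y hy
  rcases lt_or_gt_of_ne hy with hlt | hgt
  · filter_upwards [eventually_gt_nhds hlt] with r hr
    simp [hr.le, hlt.le]
  · filter_upwards [eventually_lt_nhds hgt] with r hr
    simp [hr.not_ge, hgt.not_ge]

/-- The probability integral transform for a finite atomless measure on the real line. -/
theorem map_measureReal_Iic (η : Measure ℝ) [IsFiniteMeasure η] [NullSingletonClass η] :
    η.map (fun s => η.real (Set.Iic s)) = volume.restrict (Set.Ioo 0 (η.real Set.univ)) := by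
  set G : ℝ → ℝ := fun s => η.real (Set.Iic s) with hG
  have hGc : Continuous G := continuous_measureReal_Iic η
  have hGm : Monotone G := fun s t hst => measureReal_mono (Set.Iic_subset_Iic.2 hst)
  have h0 : ∀ s, 0 ≤ G s := fun s => measureReal_nonneg
  have h1 : ∀ s, G s ≤ η.real Set.univ := fun s => measureReal_mono (Set.subset_univ _)
  have hbot : Tendsto G atBot (𝓝 0) := by
    have h2 := tendsto_measure_iInter_atBot (μ := η) (s := fun s : ℝ => Set.Iic s)
      (fun _ => measurableSet_Iic.nullMeasurableSet) (fun _ _ => Set.Iic_subset_Iic.2)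
      ⟨0, measure_ne_top η _⟩
    have h3 : ⋂ s : ℝ, Set.Iic s = ∅ := by
      refine Set.eq_empty_of_forall_notMem fun s hs => ?_
      have : s ≤ s - 1 := Set.mem_iInter.1 hs (s - 1)
      linarith
    rw [h3, measure_empty] at h2
    exact (ENNReal.tendsto_toReal ENNReal.zero_ne_top).comp h2
  have htop : Tendsto G atTop (𝓝 (η.real Set.univ)) :=
    (ENNReal.tendsto_toReal (measure_ne_top η _)).comp (tendsto_measure_Iic_atTop η)
  have : IsFiniteMeasure (η.map G) := Measure.isFiniteMeasure_map η G
  refine Measure.ext_of_Iic _ _ fun a => ?_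
  rw [Measure.map_apply hGc.measurable measurableSet_Iic,
    Measure.restrict_apply measurableSet_Iic]
  rcases lt_or_ge a 0 with ha | ha
  · have e1 : G ⁻¹' Set.Iic a = ∅ := by
      ext s; simpa using ha.trans_le (h0 s)
    have e2 : Set.Iic a ∩ Set.Ioo 0 (η.real Set.univ) = ∅ := by
      ext s; simp; intro h h'; linarith
    simp [e1, e2]
  rcases le_or_gt (η.real Set.univ) a with hm | hm
  · have e1 : G ⁻¹' Set.Iic a = Set.univ := by
      ext s; simpa using (h1 s).trans hm
    have e2 : Set.Iic a ∩ Set.Ioo 0 (η.real Set.univ) = Set.Ioo 0 (η.real Set.univ) := by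
      ext s; simp; intro h h'; linarith
    simp [e1, e2]
  have e2 : Set.Iic a ∩ Set.Ioo 0 (η.real Set.univ) = Set.Ioc 0 a := by
    ext s; simp only [Set.mem_inter_iff, Set.mem_Iic, Set.mem_Ioo, Set.mem_Ioc]
    constructor
    · rintro ⟨h, h', -⟩; exact ⟨h', h⟩
    · rintro ⟨h, h'⟩; exact ⟨h', h, by linarith⟩
  rw [e2, Real.volume_Ioc, sub_zero]
  rcases (G ⁻¹' Set.Iic a).eq_empty_or_nonempty with he | hne
  · rw [he]
    have : a ≤ 0 := ge_of_tendsto hbot (Eventually.of_forall fun s => by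
      by_contra hlt
      exact (Set.eq_empty_iff_forall_notMem.1 he s) (not_le.1 hlt).le)
    simp [this]
  · have hbdd : BddAbove (G ⁻¹' Set.Iic a) := by
      obtain ⟨s, hs⟩ := (htop.eventually (lt_mem_nhds hm)).exists
      refine ⟨s, fun r hr => ?_⟩
      by_contra hlt
      exact absurd (hGm (not_le.1 hlt).le) (not_le.2 (lt_of_le_of_lt hr hs))
    have hcl : IsClosed (G ⁻¹' Set.Iic a) := isClosed_Iic.preimage hGc
    set s := sSup (G ⁻¹' Set.Iic a) with hs
    have hsm : G s ≤ a := hcl.csSup_mem hne hbdd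
    have e1 : G ⁻¹' Set.Iic a = Set.Iic s := by
      ext r
      exact ⟨fun hr => le_csSup hbdd hr, fun hr => (hGm hr).trans hsm⟩
    have hGs : G s = a := by
      refine le_antisymm hsm ?_
      have : Tendsto G (𝓝[>] s) (𝓝 (G s)) := hGc.continuousAt.mono_left nhdsWithin_le_nhds
      refine ge_of_tendsto this ?_
      filter_upwards [self_mem_nhdsWithin] with r hr
      by_contra hlt
      exact absurd (le_csSup hbdd (not_le.1 hlt).le) (not_le.2 hr)
    rw [e1, ← hGs, hG]
    simp [measureReal_def]

/-- The probability integral transform on a space that carries an injective measurable function. -/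
theorem map_measureReal_preimage_Iic {X : Type*} [MeasurableSpace X] (μ : Measure X)
    [IsFiniteMeasure μ] {g : X → ℝ} (hg : Measurable g) (hinj : Function.Injective g)
    (hμ : ∀ x, μ {x} = 0) :
    Measurable (fun x => μ.real {x' | g x' ≤ g x}) ∧
    μ.map (fun x => μ.real {x' | g x' ≤ g x}) =
      volume.restrict (Set.Ioo 0 (μ.real Set.univ)) := by
  have : IsFiniteMeasure (μ.map g) := Measure.isFiniteMeasure_map μ g
  have : NullSingletonClass (μ.map g) := by
    refine ⟨fun s => ?_⟩
    rw [Measure.map_apply hg (measurableSet_singleton s)]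
    by_cases hs : ∃ x, g x = s
    · obtain ⟨x, rfl⟩ := hs
      have : g ⁻¹' {g x} = {x} := by ext y; simpa using hinj.eq_iff
      rw [this, hμ]
    · have : g ⁻¹' {s} = ∅ := by
        ext y; simpa using fun h => hs ⟨y, h⟩
      simp [this]
  have hc := continuous_measureReal_Iic (μ.map g)
  have key := map_measureReal_Iic (μ.map g)
  rw [Measure.map_map hc.measurable hg] at key
  have e1 : (fun s => (μ.map g).real (Set.Iic s)) ∘ g = fun x => μ.real {x' | g x' ≤ g x} := by
    funext x
    simp only [Function.comp, measureReal_def, Measure.map_apply hg measurableSet_Iic]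
    rfl
  have e2 : (μ.map g).real Set.univ = μ.real Set.univ := by
    simp [measureReal_def, Measure.map_apply hg MeasurableSet.univ]
  rw [e1, e2] at key
  exact ⟨e1 ▸ hc.measurable.comp hg, key⟩

namespace PartitionTree

section Weights

variable {ι Y : Type*} [TopologicalSpace Y]

theorem finite_support (f : PartitionOfUnity ι Y Set.univ) (y : Y) :
    (Function.support fun i => f i y).Finite := f.locallyFinite.point_finite y

/-- A function of a partition of unity as a bounded function. -/
noncomputable def weight (f : PartitionOfUnity ι Y Set.univ) (j : ι) : Y →ᵇ ℝ :=
  BoundedContinuousFunction.ofNormedAddCommGroup (fun y => f j y) (f j).continuous 1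
    (fun y => by rw [Real.norm_of_nonneg (f.nonneg j y)]; exact f.le_one j y)

variable [LinearOrder ι]

theorem exists_finset_sum (f : PartitionOfUnity ι Y Set.univ) (y : Y) (j : ι) :
    ∃ s : Finset ι, j ∈ s ∧ ∑ i ∈ s, f i y = 1 ∧
      ∀ k, ∑ᶠ i, (if i < k then f i y else 0) = ∑ i ∈ s, if i < k then f i y else 0 := by
  classical
  refine ⟨insert j (finite_support f y).toFinset, Finset.mem_insert_self _ _, ?_, fun k => ?_⟩
  · rw [← f.sum_eq_one (Set.mem_univ y)]
    refine (finsum_eq_sum_of_support_subset _ fun i hi => ?_).symm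
    simp at hi ⊢
    exact Or.inr hi
  · refine finsum_eq_sum_of_support_subset _ fun i hi => ?_
    simp at hi ⊢
    exact Or.inr hi.2

/-- The sum of the functions of a partition of unity with index below `j`. -/
noncomputable def below (f : PartitionOfUnity ι Y Set.univ) (j : ι) : Y →ᵇ ℝ :=
  BoundedContinuousFunction.ofNormedAddCommGroup
    (fun y => ∑ᶠ i, if i < j then f i y else 0)
    (by
      refine continuous_finsum (fun i => ?_) ?_
      · split_ifs
        · exact (f i).continuous
        · exact continuous_const
      · refine f.locallyFinite.subset fun i y hy => ?_
        simp at hy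
        exact hy.2)
    1
    (fun y => by
      obtain ⟨s, -, h1, h2⟩ := exists_finset_sum f y j
      rw [h2 j, Real.norm_of_nonneg, ← h1]
      · refine Finset.sum_le_sum fun i _ => ?_
        split_ifs
        exacts [le_rfl, f.nonneg i y]
      · refine Finset.sum_nonneg fun i _ => ?_
        split_ifs
        exacts [f.nonneg i y, le_rfl])

theorem below_nonneg (f : PartitionOfUnity ι Y Set.univ) (j : ι) (y : Y) : 0 ≤ below f j y := by
  refine finsum_nonneg fun i => ?_
  split_ifs
  exacts [f.nonneg i y, le_rfl]

theorem below_add_weight_le_one (f : PartitionOfUnity ι Y Set.univ) (j : ι) (y : Y) :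
    below f j y + weight f j y ≤ 1 := by
  obtain ⟨s, hj, h1, h2⟩ := exists_finset_sum f y j
  change (∑ᶠ i, if i < j then f i y else 0) + f j y ≤ 1
  rw [h2 j, ← h1, ← Finset.add_sum_erase _ _ hj, ← Finset.add_sum_erase _ (f · y) hj,
    if_neg (lt_irrefl j), zero_add, add_comm]
  gcongr with i
  split_ifs
  exacts [le_rfl, f.nonneg i y]

theorem below_add_weight_le_below (f : PartitionOfUnity ι Y Set.univ) {j k : ι} (hjk : j < k)
    (y : Y) : below f j y + weight f j y ≤ below f k y := by
  obtain ⟨s, hj, -, h2⟩ := exists_finset_sum f y j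
  change (∑ᶠ i, if i < j then f i y else 0) + f j y ≤ ∑ᶠ i, if i < k then f i y else 0
  rw [h2 j, h2 k, ← Finset.add_sum_erase _ _ hj,
    ← Finset.add_sum_erase _ (fun i => if i < k then f i y else 0) hj,
    if_neg (lt_irrefl j), if_pos hjk, zero_add, add_comm]
  gcongr with i
  split_ifs with h3 h4 h5
  exacts [le_rfl, absurd (h3.trans hjk) h4, f.nonneg i y, le_rfl]

end Weights

section Tree

variable {ι Y : Type*} [TopologicalSpace Y]
  (φ : ℕ → PartitionOfUnity ι Y Set.univ)

/-- The weight of a node, the product of the weights of its entries; the head of the list is the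
deepest entry. -/
noncomputable def nodeWeight : List ι → (Y →ᵇ ℝ)
  | [] => 1
  | j :: l => nodeWeight l * weight (φ l.length) j

theorem nodeWeight_nonneg (l : List ι) (y : Y) : 0 ≤ nodeWeight φ l y := by
  induction l with
  | nil => simp [nodeWeight]
  | cons j l ih => exact mul_nonneg ih ((φ l.length).nonneg j y)

theorem nodeWeight_ne_zero_of_cons {j : ι} {l : List ι} {y : Y}
    (h : nodeWeight φ (j :: l) y ≠ 0) : nodeWeight φ l y ≠ 0 ∧ φ l.length j y ≠ 0 :=
  ⟨left_ne_zero_of_mul h, right_ne_zero_of_mul h⟩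

variable [LinearOrder ι]

/-- The total weight of the nodes to the left of a node. -/
noncomputable def nodeLeft : List ι → (Y →ᵇ ℝ)
  | [] => 0
  | j :: l => nodeLeft l + nodeWeight φ l * below (φ l.length) j

theorem nodeLeft_le_cons (j : ι) (l : List ι) (y : Y) :
    nodeLeft φ l y ≤ nodeLeft φ (j :: l) y :=
  le_add_of_nonneg_right (mul_nonneg (nodeWeight_nonneg φ l y) (below_nonneg _ j y))

theorem nodeRight_cons_le (j : ι) (l : List ι) (y : Y) :
    nodeLeft φ (j :: l) y + nodeWeight φ (j :: l) y ≤ nodeLeft φ l y + nodeWeight φ l y := by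
  have h1 := below_add_weight_le_one (φ l.length) j y
  have h2 := nodeWeight_nonneg φ l y
  change nodeLeft φ l y + nodeWeight φ l y * below (φ l.length) j y
    + nodeWeight φ l y * weight (φ l.length) j y ≤ _
  nlinarith

theorem nodeRight_cons_le_nodeLeft_cons {j k : ι} (hjk : j < k) (l : List ι) (y : Y) :
    nodeLeft φ (j :: l) y + nodeWeight φ (j :: l) y ≤ nodeLeft φ (k :: l) y := by
  have h1 := below_add_weight_le_below (φ l.length) hjk y
  have h2 := nodeWeight_nonneg φ l y
  change nodeLeft φ l y + nodeWeight φ l y * below (φ l.length) j y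
    + nodeWeight φ l y * weight (φ l.length) j y
    ≤ nodeLeft φ l y + nodeWeight φ l y * below (φ l.length) k y
  nlinarith

variable [MeasurableSpace Y]

/-- The interval of length `∫ nodeWeight` that a measure assigns to a node. -/
noncomputable def nodeInterval (ρ : Measure Y) (l : List ι) : Set ℝ :=
  Set.Ioo (∫ y, nodeLeft φ l y ∂ρ) (∫ y, (nodeLeft φ l + nodeWeight φ l) y ∂ρ)

theorem isOpen_nodeInterval (ρ : Measure Y) (l : List ι) : IsOpen (nodeInterval φ ρ l) :=
  isOpen_Ioo

theorem nodeInterval_nil (ρ : Measure Y) :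
    nodeInterval φ ρ [] = Set.Ioo 0 (ρ.real Set.univ) := by
  simp [nodeInterval, nodeLeft, nodeWeight]

theorem exists_nodeWeight_ne_zero (ρ : Measure Y) {l : List ι} {u : ℝ}
    (hu : u ∈ nodeInterval φ ρ l) : ∃ y, nodeWeight φ l y ≠ 0 := by
  by_contra! h
  have h0 : nodeWeight φ l = 0 := by ext y; exact h y
  simp [nodeInterval, h0] at hu

open Classical in
/-- The deepest node of length at most `k` whose interval contains `u`
(the root if there is none). -/
noncomputable def nodeAt (ρ : Measure Y) (u : ℝ) : ℕ → List ι
  | 0 => []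
  | k + 1 =>
    if h : ∃ j, u ∈ nodeInterval φ ρ (j :: nodeAt ρ u k) then h.choose :: nodeAt ρ u k
    else nodeAt ρ u k

theorem nodeAt_length_of_mem (ρ : Measure Y) (u : ℝ) (k : ℕ)
    (h : ∃ j, u ∈ nodeInterval φ ρ (j :: nodeAt φ ρ u k)) : (nodeAt φ ρ u k).length = k := by
  induction k with
  | zero => rfl
  | succ k ih =>
    by_cases hk : ∃ j, u ∈ nodeInterval φ ρ (j :: nodeAt φ ρ u k)
    · rw [nodeAt, dif_pos hk, List.length_cons, ih hk]
    · rw [nodeAt, dif_neg hk] at h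
      exact absurd h hk

variable [OpensMeasurableSpace Y]

theorem nodeInterval_cons_subset (ρ : Measure Y) [IsFiniteMeasure ρ] (j : ι) (l : List ι) :
    nodeInterval φ ρ (j :: l) ⊆ nodeInterval φ ρ l := by
  refine Set.Ioo_subset_Ioo ?_ ?_
  · exact integral_mono (BoundedContinuousFunction.integrable ρ _)
      (BoundedContinuousFunction.integrable ρ _) (nodeLeft_le_cons φ j l)
  · exact integral_mono (BoundedContinuousFunction.integrable ρ _)
      (BoundedContinuousFunction.integrable ρ _) (nodeRight_cons_le φ j l)

theorem nodeInterval_subset_Ioo (ρ : Measure Y) [IsFiniteMeasure ρ] (l : List ι) :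
    nodeInterval φ ρ l ⊆ Set.Ioo 0 (ρ.real Set.univ) := by
  induction l with
  | nil => rw [nodeInterval_nil]
  | cons j l ih => exact (nodeInterval_cons_subset φ ρ j l).trans ih

theorem disjoint_nodeInterval_of_lt (ρ : Measure Y) [IsFiniteMeasure ρ] {j k : ι} (hjk : j < k)
    (l : List ι) : Disjoint (nodeInterval φ ρ (j :: l)) (nodeInterval φ ρ (k :: l)) := by
  rw [Set.disjoint_left]
  intro u hu hu'
  have : ∫ y, (nodeLeft φ (j :: l) + nodeWeight φ (j :: l)) y ∂ρ ≤ ∫ y, nodeLeft φ (k :: l) y ∂ρ :=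
    integral_mono (BoundedContinuousFunction.integrable ρ _)
      (BoundedContinuousFunction.integrable ρ _) (nodeRight_cons_le_nodeLeft_cons φ hjk l)
  exact absurd (hu.2.trans_le this) (not_lt.2 hu'.1.le)

theorem eq_of_mem_nodeInterval (ρ : Measure Y) [IsFiniteMeasure ρ] {l l' : List ι} {u : ℝ}
    (hlen : l.length = l'.length) (hu : u ∈ nodeInterval φ ρ l) (hu' : u ∈ nodeInterval φ ρ l') :
    l = l' := by
  induction l generalizing l' with
  | nil => exact (List.length_eq_zero_iff.1 hlen.symm).symm
  | cons j l ih =>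
    obtain _ | ⟨k, l'⟩ := l'
    · simp at hlen
    obtain rfl := ih (by simpa using hlen) (nodeInterval_cons_subset φ ρ j l hu)
      (nodeInterval_cons_subset φ ρ k l' hu')
    rcases lt_trichotomy j k with h | rfl | h
    · exact absurd hu' (Set.disjoint_left.1 (disjoint_nodeInterval_of_lt φ ρ h l) hu)
    · rfl
    · exact absurd hu (Set.disjoint_left.1 (disjoint_nodeInterval_of_lt φ ρ h l) hu')

theorem volume_nodeInterval (ρ : Measure Y) [IsFiniteMeasure ρ] (l : List ι) :
    volume (nodeInterval φ ρ l) = ∫⁻ y, ENNReal.ofReal (nodeWeight φ l y) ∂ρ := by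
  rw [nodeInterval, Real.volume_Ioo, ← ofReal_integral_eq_lintegral_ofReal
    (BoundedContinuousFunction.integrable ρ _)
    (Eventually.of_forall fun y => nodeWeight_nonneg φ l y)]
  congr 1
  simp only [BoundedContinuousFunction.add_apply]
  rw [integral_add (BoundedContinuousFunction.integrable ρ _)
    (BoundedContinuousFunction.integrable ρ _)]
  ring

theorem nodeAt_eq_of_mem (ρ : Measure Y) [IsFiniteMeasure ρ] {u : ℝ} {l : List ι}
    (hu : u ∈ nodeInterval φ ρ l) : nodeAt φ ρ u l.length = l := by
  induction l with
  | nil => rfl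
  | cons j l ih =>
    have hl := ih (nodeInterval_cons_subset φ ρ j l hu)
    have hex : ∃ j, u ∈ nodeInterval φ ρ (j :: nodeAt φ ρ u l.length) := ⟨j, by rwa [hl]⟩
    rw [List.length_cons, nodeAt, dif_pos hex]
    exact eq_of_mem_nodeInterval φ ρ (by simp [hl]) hex.choose_spec hu

theorem measurableSet_nodeAt (ρ : Measure Y) [IsFiniteMeasure ρ] (k : ℕ) (Q : Set (List ι)) :
    MeasurableSet {u | nodeAt φ ρ u k ∈ Q} := by
  induction k with
  | zero =>
    simp only [nodeAt]
    exact MeasurableSet.const _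
  | succ k ih =>
    have e : {u | nodeAt φ ρ u (k + 1) ∈ Q} =
        (⋃ (l : List ι) (_ : l.length = k + 1 ∧ l ∈ Q), nodeInterval φ ρ l) ∪
        ({u | nodeAt φ ρ u k ∈ Q} \ ⋃ (l : List ι) (_ : l.length = k + 1), nodeInterval φ ρ l) := by
      ext u
      simp only [Set.mem_union, Set.mem_iUnion, Set.mem_sdiff, Set.mem_ofPred_eq, exists_prop]
      by_cases hk : ∃ j, u ∈ nodeInterval φ ρ (j :: nodeAt φ ρ u k)
      · have hlen := nodeAt_length_of_mem φ ρ u k hk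
        have hmem := hk.choose_spec
        rw [nodeAt, dif_pos hk]
        constructor
        · exact fun h => Or.inl ⟨_, ⟨by simp [hlen], h⟩, hmem⟩
        · rintro (⟨l, ⟨hl, hQ⟩, hul⟩ | ⟨-, h⟩)
          · rwa [eq_of_mem_nodeInterval φ ρ (by simp [hlen, hl]) hmem hul]
          · exact absurd ⟨_, by simp [hlen], hmem⟩ h
      · have hno : ∀ l : List ι, l.length = k + 1 → u ∉ nodeInterval φ ρ l := by
          intro l hl hu
          obtain _ | ⟨j, l⟩ := l
          · simp at hl
          have := nodeAt_eq_of_mem φ ρ (nodeInterval_cons_subset φ ρ j l hu)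
          rw [show l.length = k by simpa using hl] at this
          exact hk ⟨j, by rwa [this]⟩
        rw [nodeAt, dif_neg hk]
        constructor
        · exact fun h => Or.inr ⟨h, fun ⟨l, hl, hul⟩ => hno l hl hul⟩
        · rintro (⟨l, ⟨hl, -⟩, hul⟩ | ⟨h, -⟩)
          · exact absurd hul (hno l hl)
          · exact h
    rw [e]
    refine MeasurableSet.union ?_ (ih.diff ?_)
    · exact (isOpen_biUnion fun l _ => isOpen_nodeInterval φ ρ l).measurableSet
    · exact (isOpen_biUnion fun l _ => isOpen_nodeInterval φ ρ l).measurableSet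

end Tree

section Volume

variable {Y : Type*} [MetricSpace Y] {φ : ℕ → PartitionOfUnity Y Y Set.univ} [MeasurableSpace Y]

theorem exists_countable_index (ρ : Measure Y) {D : Set Y} (hD : D.Countable)
    (hρ : ρ (closure D)ᶜ = 0) :
    ∃ J : Set Y, J.Countable ∧ ∀ᵐ y ∂ρ, ∀ k i, φ k i y ≠ 0 → i ∈ J := by
  refine ⟨⋃ k, ⋃ d ∈ D, Function.support fun i => φ k i d, ?_, ?_⟩
  · exact Set.countable_iUnion fun k => hD.biUnion fun d _ => (finite_support (φ k) d).countable
  · have : ∀ᵐ y ∂ρ, y ∈ closure D := by rwa [ae_iff]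
    filter_upwards [this] with y hy k i hi
    obtain ⟨d, hd, hdD⟩ := mem_closure_iff.1 hy {z | φ k i z ≠ 0}
      ((φ k i).continuous.isOpen_preimage _ isOpen_ne) hi
    exact Set.mem_iUnion.2 ⟨k, Set.mem_iUnion₂.2 ⟨d, hdD, hd⟩⟩

variable [LinearOrder Y] [BorelSpace Y]

/-- The intervals of the children of a node fill the interval of the node up to a null set. -/
theorem volume_nodeInterval_diff_iUnion (ρ : Measure Y) [IsFiniteMeasure ρ] (l : List Y)
    {J : Set Y} (hJ : J.Countable)
    (hρ : ∀ᵐ y ∂ρ, ∀ i, φ l.length i y ≠ 0 → i ∈ J) :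
    volume (nodeInterval φ ρ l \ ⋃ j ∈ J, nodeInterval φ ρ (j :: l)) = 0 := by
  have hsub : (⋃ j ∈ J, nodeInterval φ ρ (j :: l)) ⊆ nodeInterval φ ρ l :=
    Set.iUnion₂_subset fun j _ => nodeInterval_cons_subset φ ρ j l
  have hmeas : MeasurableSet (⋃ j ∈ J, nodeInterval φ ρ (j :: l)) :=
    (isOpen_biUnion fun j _ => isOpen_nodeInterval φ ρ _).measurableSet
  have hfin : volume (⋃ j ∈ J, nodeInterval φ ρ (j :: l)) ≠ ⊤ :=
    ne_top_of_le_ne_top (by rw [nodeInterval]; simp) (measure_mono hsub)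
  rw [measure_sdiff hsub hmeas.nullMeasurableSet hfin, tsub_eq_zero_iff_le,
    measure_biUnion hJ (fun j _ k _ hjk => ?_) (fun j _ => (isOpen_nodeInterval φ ρ _).measurableSet)]
  · simp_rw [volume_nodeInterval]
    have := hJ.to_subtype
    rw [← lintegral_tsum fun j => by fun_prop]
    refine lintegral_mono_ae ?_
    filter_upwards [hρ] with y hy
    have hfs := finite_support (φ l.length) y
    have h1 : ∑ i ∈ hfs.toFinset, φ l.length i y = 1 := by
      rw [← (φ l.length).sum_eq_one (Set.mem_univ y)]
      exact (finsum_eq_sum_of_support_subset _ (by simp)).symm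
    have h2 : ∑ i ∈ hfs.toFinset, ENNReal.ofReal (nodeWeight φ (i :: l) y)
        = ENNReal.ofReal (nodeWeight φ l y) := by
      rw [← ENNReal.ofReal_sum_of_nonneg fun i _ => nodeWeight_nonneg φ (i :: l) y]
      congr 1
      change ∑ i ∈ hfs.toFinset, nodeWeight φ l y * φ l.length i y = _
      rw [← Finset.mul_sum, h1, mul_one]
    rw [← h2]
    have h3 : ∀ i ∈ hfs.toFinset, i ∈ J := fun i hi => hy i (by simpa using hi)
    rw [← Finset.sum_attach]
    let s : Finset J := hfs.toFinset.attach.map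
      ⟨fun i => ⟨i.1, h3 i.1 i.2⟩, fun a b hab => Subtype.ext (by simpa using hab)⟩
    calc ∑ i ∈ hfs.toFinset.attach, ENNReal.ofReal (nodeWeight φ (i.1 :: l) y)
        = ∑ i ∈ s, ENNReal.ofReal (nodeWeight φ (i.1 :: l) y) := by
          rw [Finset.sum_map]; rfl
      _ ≤ _ := ENNReal.sum_le_tsum s
  · rcases lt_or_gt_of_ne hjk with h | h
    · exact disjoint_nodeInterval_of_lt φ ρ h l
    · exact (disjoint_nodeInterval_of_lt φ ρ h l).symm

theorem ae_exists_mem_nodeInterval (ρ : Measure Y) [IsFiniteMeasure ρ] {J : Set Y}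
    (hJ : J.Countable) (hρ : ∀ᵐ y ∂ρ, ∀ k i, φ k i y ≠ 0 → i ∈ J) (k : ℕ) :
    ∀ᵐ u ∂(volume.restrict (Set.Ioo 0 (ρ.real Set.univ))),
      ∃ l : List Y, l.length = k ∧ (∀ j ∈ l, j ∈ J) ∧ u ∈ nodeInterval φ ρ l := by
  induction k with
  | zero =>
    filter_upwards [ae_restrict_mem measurableSet_Ioo] with u hu
    exact ⟨[], rfl, by simp, by rwa [nodeInterval_nil]⟩
  | succ k ih =>
    have hL : {l : List Y | ∀ j ∈ l, j ∈ J}.Countable := by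
      have := hJ.to_subtype
      refine (Set.countable_range (fun l : List J => l.map Subtype.val)).mono fun l hl => ?_
      exact ⟨l.attach.map fun x => ⟨x.1, hl x.1 x.2⟩, by simp⟩
    have h0 : ∀ᵐ u ∂(volume.restrict (Set.Ioo 0 (ρ.real Set.univ))),
        ∀ l ∈ {l : List Y | ∀ j ∈ l, j ∈ J},
          u ∉ nodeInterval φ ρ l \ ⋃ j ∈ J, nodeInterval φ ρ (j :: l) := by
      refine (ae_ball_iff hL).2 fun l _ => ae_restrict_of_ae ?_
      exact measure_eq_zero_iff_ae_notMem.1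
        (volume_nodeInterval_diff_iUnion ρ l hJ (hρ.mono fun y hy => hy l.length))
    filter_upwards [ih, h0] with u hu hu0
    obtain ⟨l, hl, hlJ, hul⟩ := hu
    have := hu0 l hlJ
    rw [Set.mem_sdiff, not_and, not_not] at this
    obtain ⟨j, hj, huj⟩ := Set.mem_iUnion₂.1 (this hul)
    refine ⟨j :: l, by simp [hl], ?_, huj⟩
    intro i hi
    rcases List.mem_cons.1 hi with rfl | hi
    exacts [hj, hlJ i hi]

theorem tsum_nodeWeight_le_one {Q : Set (List Y)} (hQ : Q.Countable) {k : ℕ}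
    (hk : ∀ l ∈ Q, l.length = k) (y : Y) :
    ∑' l : Q, ENNReal.ofReal (nodeWeight φ (l : List Y) y) ≤ 1 := by
  have := hQ.to_subtype
  have h1 : ∀ l : Q, ENNReal.ofReal (nodeWeight φ l.1 y)
      = volume (nodeInterval φ (Measure.dirac y) l.1) := by
    intro l
    rw [volume_nodeInterval, lintegral_dirac' _ (by fun_prop)]
  simp_rw [h1]
  rw [← measure_iUnion]
  · refine (measure_mono (Set.iUnion_subset fun l : Q =>
      nodeInterval_subset_Ioo φ (Measure.dirac y) l.1)).trans ?_
    simp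
  · intro l l' hne
    refine Set.disjoint_left.2 fun u hu hu' => hne (Subtype.ext ?_)
    exact eq_of_mem_nodeInterval φ (Measure.dirac y) ((hk _ l.2).trans (hk _ l'.2).symm) hu hu'
  · exact fun l => (isOpen_nodeInterval φ _ _).measurableSet

end Volume

section Limit

variable {Y : Type*} [MetricSpace Y]
  {φ : ℕ → PartitionOfUnity Y Y Set.univ}

theorem dist_le_of_nodeWeight_ne_zero
    (hφ : ∀ k, (φ k).IsSubordinate fun y => Metric.ball y ((1 / 2) ^ k))
    {j : Y} {l : List Y} {y z : Y} (hy : nodeWeight φ (j :: l) y ≠ 0)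
    (hz : nodeWeight φ (j :: l) z ≠ 0) : dist y z ≤ 2 * (1 / 2) ^ l.length := by
  have key : ∀ w, nodeWeight φ (j :: l) w ≠ 0 → dist w j < (1 / 2) ^ l.length := fun w hw =>
    hφ l.length j (subset_tsupport _ (nodeWeight_ne_zero_of_cons φ hw).2)
  have := dist_triangle_right y z j
  linarith [key y hy, key z hz]

variable [Nonempty Y]

variable (φ) in
open Classical in
/-- A point of positive weight of a node. -/
noncomputable def nodePoint (l : List Y) : Y :=
  if h : ∃ y, nodeWeight φ l y ≠ 0 then h.choose else Classical.arbitrary Y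

theorem nodeWeight_nodePoint {l : List Y} (h : ∃ y, nodeWeight φ l y ≠ 0) :
    nodeWeight φ l (nodePoint φ l) ≠ 0 := by
  rw [nodePoint, dif_pos h]; exact h.choose_spec

variable [LinearOrder Y] [MeasurableSpace Y]

variable (φ) in
/-- The point of `Y` reached by following the nodes that contain `u`. -/
noncomputable def limitPoint (ρ : Measure Y) (u : ℝ) : Y :=
  limUnder atTop fun k => nodePoint φ (nodeAt φ ρ u (k + 1))

theorem dist_nodePoint_nodeAt_le
    (hφ : ∀ k, (φ k).IsSubordinate fun y => Metric.ball y ((1 / 2) ^ k))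
    (ρ : Measure Y) (u : ℝ) (k : ℕ) :
    dist (nodePoint φ (nodeAt φ ρ u (k + 1))) (nodePoint φ (nodeAt φ ρ u (k + 1 + 1)))
      ≤ 2 * (1 / 2) ^ k := by
  by_cases h : ∃ j, u ∈ nodeInterval φ ρ (j :: nodeAt φ ρ u (k + 1))
  · have hlen := nodeAt_length_of_mem φ ρ u (k + 1) h
    have hne := exists_nodeWeight_ne_zero φ ρ h.choose_spec
    rw [show nodeAt φ ρ u (k + 1 + 1) = h.choose :: nodeAt φ ρ u (k + 1) by
      rw [nodeAt, dif_pos h]]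
    have h1 := (nodeWeight_ne_zero_of_cons φ (nodeWeight_nodePoint hne)).1
    have h2 := nodeWeight_nodePoint ⟨_, h1⟩
    generalize nodePoint φ (h.choose :: nodeAt φ ρ u (k + 1)) = z at h1 ⊢
    clear hne h
    generalize nodeAt φ ρ u (k + 1) = l at *
    obtain _ | ⟨j, l⟩ := l
    · simp at hlen
    · rw [← show l.length = k by simpa using hlen]
      exact dist_le_of_nodeWeight_ne_zero hφ h2 h1
  · rw [show nodeAt φ ρ u (k + 1 + 1) = nodeAt φ ρ u (k + 1) by rw [nodeAt, dif_neg h], dist_self]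
    positivity

variable [CompleteSpace Y]

theorem tendsto_limitPoint
    (hφ : ∀ k, (φ k).IsSubordinate fun y => Metric.ball y ((1 / 2) ^ k))
    (ρ : Measure Y) (u : ℝ) :
    Tendsto (fun k => nodePoint φ (nodeAt φ ρ u (k + 1))) atTop (𝓝 (limitPoint φ ρ u)) :=
  (cauchySeq_of_le_geometric (1 / 2) 2 (by norm_num)
    (dist_nodePoint_nodeAt_le hφ ρ u)).tendsto_limUnder

variable [BorelSpace Y]

theorem dist_limitPoint_le
    (hφ : ∀ k, (φ k).IsSubordinate fun y => Metric.ball y ((1 / 2) ^ k))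
    (ρ : Measure Y) [IsFiniteMeasure ρ] {u : ℝ} {j : Y} {l : List Y}
    (hu : u ∈ nodeInterval φ ρ (j :: l)) {y : Y} (hy : nodeWeight φ (j :: l) y ≠ 0) :
    dist (limitPoint φ ρ u) y ≤ 6 * (1 / 2) ^ l.length := by
  have h1 := dist_le_of_le_geometric_of_tendsto (1 / 2) 2 (by norm_num)
    (dist_nodePoint_nodeAt_le hφ ρ u) (tendsto_limitPoint hφ ρ u) l.length
  rw [show nodeAt φ ρ u (l.length + 1) = j :: l from nodeAt_eq_of_mem φ ρ hu] at h1
  have h2 := dist_le_of_nodeWeight_ne_zero hφ (nodeWeight_nodePoint ⟨y, hy⟩) hy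
  have h3 := dist_triangle_left (limitPoint φ ρ u) y (nodePoint φ (j :: l))
  rw [show (1 : ℝ) - 1 / 2 = 1 / 2 by norm_num] at h1
  linarith

theorem measurable_limitPoint
    (hφ : ∀ k, (φ k).IsSubordinate fun y => Metric.ball y ((1 / 2) ^ k))
    (ρ : Measure Y) [IsFiniteMeasure ρ] : Measurable (limitPoint φ ρ) := by
  refine measurable_of_tendsto_metrizable (fun k => ?_)
    (tendsto_pi_nhds.2 fun u => tendsto_limitPoint hφ ρ u)
  exact fun s _ => measurableSet_nodeAt φ ρ (k + 1) (Set.preimage (nodePoint φ) s)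

/-- Along a converging sequence of measures, a point that lies in an interval of every level is a
point of joint continuity. -/
theorem tendsto_limitPoint_of_mem
    (hφ : ∀ k, (φ k).IsSubordinate fun y => Metric.ball y ((1 / 2) ^ k))
    {ρ : FiniteMeasure Y} {u : ℝ}
    (hu : ∀ k, ∃ l : List Y, l.length = k ∧ u ∈ nodeInterval φ (ρ : Measure Y) l)
    {ρn : ℕ → FiniteMeasure Y} {un : ℕ → ℝ} (hρ : Tendsto ρn atTop (𝓝 ρ))
    (hun : Tendsto un atTop (𝓝 u)) :
    Tendsto (fun n => limitPoint φ (ρn n : Measure Y) (un n)) atTop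
      (𝓝 (limitPoint φ (ρ : Measure Y) u)) := by
  rw [FiniteMeasure.tendsto_iff_forall_integral_tendsto] at hρ
  rw [Metric.tendsto_atTop']
  intro ε hε
  obtain ⟨k, hk⟩ := exists_pow_lt_of_lt_one (show 0 < ε / 12 by positivity)
    (show (1 / 2 : ℝ) < 1 by norm_num)
  obtain ⟨l, hl, hul⟩ := hu (k + 1)
  obtain _ | ⟨j, l⟩ := l
  · simp at hl
  have hlk : l.length = k := by simpa using hl
  obtain ⟨y, hy⟩ := exists_nodeWeight_ne_zero φ _ hul
  have h1 := dist_limitPoint_le hφ _ hul hy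
  have ev1 := (hρ (nodeLeft φ (j :: l))).eventually_lt hun hul.1
  have ev2 := hun.eventually_lt (hρ (nodeLeft φ (j :: l) + nodeWeight φ (j :: l))) hul.2
  obtain ⟨N, hN⟩ := eventually_atTop.1 (ev1.and ev2)
  refine ⟨N, fun n hn => ?_⟩
  have h2 := dist_limitPoint_le hφ (ρn n : Measure Y) (u := un n) (hN n hn.le) hy
  rw [hlk] at h1 h2
  have h3 := dist_triangle_right (limitPoint φ (ρn n : Measure Y) (un n))
    (limitPoint φ (ρ : Measure Y) u) y
  linarith

end Limit

end PartitionTree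

theorem MeasureTheory.Measure.eq_of_forall_isClosed_le {Y : Type*} [MetricSpace Y]
    [MeasurableSpace Y] [BorelSpace Y] {P ρ : Measure Y} [IsFiniteMeasure P] [IsFiniteMeasure ρ]
    (huniv : P Set.univ = ρ Set.univ) (hle : ∀ C, IsClosed C → P C ≤ ρ C) : P = ρ := by
  refine ext_of_generate_finite {C | IsClosed C} ?_ isPiSystem_isClosed (fun C hC => ?_) huniv
  · rw [BorelSpace.measurable_eq (α := Y), borel_eq_generateFrom_isClosed]
  have hC : IsClosed C := hC
  refine le_antisymm (hle C hC) ?_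
  obtain ⟨F, hF, hFC, hFU, hFm⟩ := hC.isOpen_compl.exists_iUnion_isClosed
  have h1 : P Cᶜ ≤ ρ Cᶜ := by
    rw [← hFU]
    refine le_of_tendsto_of_tendsto (tendsto_measure_iUnion_atTop hFm)
      (tendsto_measure_iUnion_atTop hFm) (Eventually.of_forall fun n => hle _ (hF n))
  rw [measure_compl hC.measurableSet (measure_ne_top _ _),
    measure_compl hC.measurableSet (measure_ne_top _ _), huniv] at h1
  have h2 : ρ C ≤ ρ Set.univ := measure_mono (Set.subset_univ C)
  exact (ENNReal.sub_le_sub_iff_left h2 (measure_ne_top _ _)).1 h1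

namespace PartitionTree

variable {Y : Type*} [MetricSpace Y] {φ : ℕ → PartitionOfUnity Y Y Set.univ} [MeasurableSpace Y]
  [Nonempty Y] [LinearOrder Y] [CompleteSpace Y] [BorelSpace Y]

theorem map_limitPoint
    (hφ : ∀ k, (φ k).IsSubordinate fun y => Metric.ball y ((1 / 2) ^ k))
    (ρ : Measure Y) [IsFiniteMeasure ρ] {J : Set Y}
    (hJ : J.Countable) (hρ : ∀ᵐ y ∂ρ, ∀ k i, φ k i y ≠ 0 → i ∈ J) :
    (volume.restrict (Set.Ioo 0 (ρ.real Set.univ))).map (limitPoint φ ρ) = ρ := by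
  have hm := measurable_limitPoint hφ ρ
  have : IsFiniteMeasure ((volume.restrict (Set.Ioo 0 (ρ.real Set.univ))).map (limitPoint φ ρ)) :=
    Measure.isFiniteMeasure_map _ _
  refine Measure.eq_of_forall_isClosed_le ?_ fun C hC => ?_
  · rw [Measure.map_apply hm MeasurableSet.univ]
    simp [measureReal_def]
  rw [Measure.map_apply hm hC.measurableSet]
  have hlim : Tendsto (fun k : ℕ => ρ (Metric.cthickening (6 * (1 / 2) ^ k) C)) atTop
      (𝓝 (ρ C)) := by
    refine (tendsto_measure_cthickening_of_isClosed ⟨1, one_pos, measure_ne_top _ _⟩ hC).comp ?_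
    simpa using (tendsto_pow_atTop_nhds_zero_of_lt_one (r := (1 / 2 : ℝ))
      (by norm_num) (by norm_num)).const_mul 6
  refine ge_of_tendsto hlim (Eventually.of_forall fun k => ?_)
  let Q : Set (List Y) := {l | l.length = k + 1 ∧ (∀ j ∈ l, j ∈ J) ∧
    ∃ u ∈ nodeInterval φ ρ l, limitPoint φ ρ u ∈ C}
  have hQ : Q.Countable := by
    have := hJ.to_subtype
    refine (Set.countable_range (fun l : List J => l.map Subtype.val)).mono fun l hl => ?_
    exact ⟨l.attach.map fun x => ⟨x.1, hl.2.1 x.1 x.2⟩, by simp⟩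
  have := hQ.to_subtype
  have hcover : volume.restrict (Set.Ioo 0 (ρ.real Set.univ)) (limitPoint φ ρ ⁻¹' C) ≤
      volume (⋃ l : Q, nodeInterval φ ρ (l : List Y)) := by
    refine le_trans (measure_mono_ae ?_) (Measure.restrict_apply_le _ _)
    filter_upwards [ae_exists_mem_nodeInterval ρ hJ hρ (k + 1)] with u hu huC
    obtain ⟨l, hl, hlJ, hul⟩ := hu
    exact Set.mem_iUnion.2 ⟨⟨l, hl, hlJ, u, hul, huC⟩, hul⟩
  refine hcover.trans ((measure_iUnion_le _).trans ?_)
  simp_rw [volume_nodeInterval]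
  rw [← lintegral_tsum fun l => by fun_prop,
    ← lintegral_indicator_one Metric.isClosed_cthickening.measurableSet]
  refine lintegral_mono fun y => ?_
  by_cases hy : y ∈ Metric.cthickening (6 * (1 / 2) ^ k) C
  · rw [Set.indicator_of_mem hy]
    exact tsum_nodeWeight_le_one hQ (fun l hl => hl.1) y
  · rw [Set.indicator_of_notMem hy, nonpos_iff_eq_zero, ENNReal.tsum_eq_zero]
    rintro ⟨l, hl, -, u, hul, huC⟩
    by_contra hne
    apply hy
    obtain _ | ⟨j, l⟩ := l
    · simp at hl
    have hne' : nodeWeight φ (j :: l) y ≠ 0 := fun h0 => hne (by simp [h0])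
    have := dist_limitPoint_le hφ ρ hul hne'
    rw [show l.length = k by simpa using hl, dist_comm] at this
    exact Metric.mem_cthickening_of_dist_le y _ _ C huC this

end PartitionTree

/-- A simultaneous Skorokhod representation of the finite separably supported measures on a complete
metric space, jointly continuous in the measure and in the variable almost everywhere. -/
theorem exists_skorokhod_representation (Y : Type*) [MetricSpace Y] [CompleteSpace Y] [Nonempty Y]
    [MeasurableSpace Y] [BorelSpace Y] :
    ∃ Ψ : FiniteMeasure Y → ℝ → Y, (∀ ρ, Measurable (Ψ ρ)) ∧
      ∀ ρ : FiniteMeasure Y, (∃ D : Set Y, D.Countable ∧ (ρ : Measure Y) (closure D)ᶜ = 0) →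
        (volume.restrict (Set.Ioo 0 ((ρ : Measure Y).real Set.univ))).map (Ψ ρ) = ρ ∧
        ∀ᵐ u ∂(volume.restrict (Set.Ioo 0 ((ρ : Measure Y).real Set.univ))),
          ∀ (ρn : ℕ → FiniteMeasure Y) (un : ℕ → ℝ), Tendsto ρn atTop (𝓝 ρ) →
            Tendsto un atTop (𝓝 u) → Tendsto (fun n => Ψ (ρn n) (un n)) atTop (𝓝 (Ψ ρ u)) := by
  classical
  let _ : LinearOrder Y := linearOrderOfSTO WellOrderingRel
  have hex : ∀ k : ℕ, ∃ f : PartitionOfUnity Y Y Set.univ,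
      f.IsSubordinate fun y => Metric.ball y ((1 / 2) ^ k) := fun k =>
    PartitionOfUnity.exists_isSubordinate isClosed_univ _ (fun _ => Metric.isOpen_ball)
      (fun y _ => Set.mem_iUnion.2 ⟨y, Metric.mem_ball_self (by positivity)⟩)
  choose φ hφ using hex
  refine ⟨fun ρ => PartitionTree.limitPoint φ (ρ : Measure Y),
    fun ρ => PartitionTree.measurable_limitPoint hφ _, fun ρ ⟨D, hD, hρD⟩ => ?_⟩
  obtain ⟨J, hJ, hρJ⟩ := PartitionTree.exists_countable_index (φ := φ) (ρ : Measure Y) hD hρD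
  refine ⟨PartitionTree.map_limitPoint hφ _ hJ hρJ, ?_⟩
  filter_upwards [ae_all_iff.2 fun k =>
    PartitionTree.ae_exists_mem_nodeInterval (φ := φ) (ρ : Measure Y) hJ hρJ k] with u hu ρn un h1 h2
  exact PartitionTree.tendsto_limitPoint_of_mem hφ
    (fun k => (hu k).imp fun l hl => ⟨hl.1, hl.2.2⟩) h1 h2

section Continuity

theorem measure_le_add_tvDist {X : Type*} [MeasurableSpace X] (μ ν : Measure X) {A : Set X}
    (hA : MeasurableSet A) : μ A ≤ ν A + tvDist μ ν := by
  have : μ A - ν A + (ν A - μ A) ≤ tvDist μ ν :=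
    le_iSup₂ (f := fun (s : Set X) (_ : MeasurableSet s) => μ s - ν s + (ν s - μ s)) A hA
  exact tsub_le_iff_left.1 (le_self_add.trans this)

theorem tvDist_comm {X : Type*} [MeasurableSpace X] (μ ν : Measure X) :
    tvDist μ ν = tvDist ν μ := by
  exact iSup_congr fun s => iSup_congr fun _ => add_comm (μ s - ν s) (ν s - μ s)

theorem TVContinuousFamily.tendsto_measure {T X : Type*} [TopologicalSpace T] [MeasurableSpace X]
    {μ : T → Measure X} (hμ : TVContinuousFamily μ) (t₀ : T) [IsFiniteMeasure (μ t₀)] {A : Set X}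
    (hA : MeasurableSet A) : Tendsto (fun t => μ t A) (𝓝 t₀) (𝓝 (μ t₀ A)) := by
  have h1 : Tendsto (fun t => μ t₀ A + tvDist (μ t) (μ t₀)) (𝓝 t₀) (𝓝 (μ t₀ A)) := by
    simpa using (hμ t₀).const_add (μ t₀ A)
  have h2 : Tendsto (fun t => μ t₀ A - tvDist (μ t) (μ t₀)) (𝓝 t₀) (𝓝 (μ t₀ A)) := by
    simpa using ENNReal.Tendsto.sub (tendsto_const_nhds (x := μ t₀ A)) (hμ t₀)
      (Or.inl (measure_ne_top _ _))
  refine tendsto_of_tendsto_of_tendsto_of_le_of_le h2 h1 (fun t => ?_)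
    (fun t => measure_le_add_tvDist _ _ hA)
  rw [tvDist_comm]
  exact tsub_le_iff_right.2 (measure_le_add_tvDist _ _ hA)

theorem tendsto_lintegral_of_continuous {T Y : Type*} [TopologicalSpace T] [TopologicalSpace Y]
    [MeasurableSpace Y] [OpensMeasurableSpace Y] {ν : T → ProbabilityMeasure Y}
    (hν : Continuous ν) (t₀ : T) (F : Y →ᵇ ℝ≥0) :
    Tendsto (fun t => ∫⁻ y, F y ∂(ν t : Measure Y)) (𝓝 t₀)
      (𝓝 (∫⁻ y, F y ∂(ν t₀ : Measure Y))) :=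
  (ProbabilityMeasure.tendsto_iff_forall_lintegral_tendsto.1 (hν.tendsto t₀)) F

end Continuity

section Couples

/-- The law of `(ξ, ζ)` under `σ` has marginals `μ` and `ν`. -/
structure Couples {Ω X Y : Type*} [MeasurableSpace Ω] [MeasurableSpace X] [MeasurableSpace Y]
    (σ : Measure Ω) (ξ : Ω → X) (ζ : Ω → Y) (μ : Measure X) (ν : Measure Y) : Prop where
  measurable_left : Measurable ξ
  measurable_right : Measurable ζ
  map_left : σ.map ξ = μ
  map_right : σ.map ζ = ν

theorem IsCoupling.couples {X Y : Type*} [TopologicalSpace X] [TopologicalSpace Y]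
    [MeasurableSpace X] [MeasurableSpace Y] [BorelSpace X] [BorelSpace Y]
    {σ : @Measure (X × Y) (borel (X × Y))} {μ : Measure X} {ν : Measure Y}
    (h : IsCoupling σ μ ν) :
    @Couples (X × Y) X Y (borel (X × Y)) _ _ σ Prod.fst Prod.snd μ ν := by
  let _ : MeasurableSpace (X × Y) := borel (X × Y)
  have : BorelSpace (X × Y) := ⟨rfl⟩
  have h1 : Measurable (Prod.fst : X × Y → X) := continuous_fst.measurable
  have h2 : Measurable (Prod.snd : X × Y → Y) := continuous_snd.measurable
  refine ⟨h1, h2, ?_, ?_⟩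
  · ext A hA
    rw [Measure.map_apply h1 hA, ← h.1 A hA]
    congr 1
    ext p; simp
  · ext B hB
    rw [Measure.map_apply h2 hB, ← h.2 B hB]
    congr 1
    ext p; simp

/-- A finite grid on `X × Y`, given by disjoint sets in `X` and weights on `Y`, on whose cells the
cost `H` is constant up to `η`. -/
structure IsGrid {X Y ι κ : Type*} [MeasurableSpace X] [TopologicalSpace Y] [Fintype κ]
    (A : ι → Set X) (φ : κ → Y →ᵇ ℝ≥0) (c : ι → κ → ℝ≥0) (η : ℝ≥0) (H : X → Y → ℝ≥0∞) :
    Prop where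
  measurableSet : ∀ i, MeasurableSet (A i)
  disjoint : Pairwise fun i i' => Disjoint (A i) (A i')
  sum_le_one : ∀ y, ∑ j, φ j y ≤ 1
  le_add : ∀ i j, ∀ x ∈ A i, ∀ y, φ j y ≠ 0 → H x y ≤ c i j + η
  le_add' : ∀ i j, ∀ x ∈ A i, ∀ y, φ j y ≠ 0 → c i j ≤ H x y + η

/-- The mass that the law of `(ξ, ζ)` gives to a cell of a grid. -/
noncomputable def cellMass {Ω X Y ι κ : Type*} [MeasurableSpace Ω] [TopologicalSpace Y]
    (A : ι → Set X) (φ : κ → Y →ᵇ ℝ≥0) (σ : Measure Ω) (ξ : Ω → X) (ζ : Ω → Y) (i : ι) (j : κ) :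
    ℝ≥0∞ :=
  ∫⁻ ω in ξ ⁻¹' A i, φ j (ζ ω) ∂σ

variable {Ω X Y ι κ : Type*} [MeasurableSpace X] [TopologicalSpace Y] [Fintype κ]
  {A : ι → Set X} {φ : κ → Y →ᵇ ℝ≥0} {c : ι → κ → ℝ≥0} {η : ℝ≥0} {H : X → Y → ℝ≥0∞}

theorem IsGrid.sum_weight_le_one (hG : IsGrid A φ c η H) (y : Y) :
    ∑ j, (φ j y : ℝ≥0∞) ≤ 1 := by exact_mod_cast hG.sum_le_one y

variable [Fintype ι]

theorem IsGrid.sum_indicator_le_one (hG : IsGrid A φ c η H) (x : X) :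
    ∑ i, (A i).indicator (1 : X → ℝ≥0∞) x ≤ 1 := by
  by_cases hx : ∃ i, x ∈ A i
  · obtain ⟨i, hi⟩ := hx
    rw [Finset.sum_eq_single i]
    · simp [hi]
    · intro k _ hk
      exact Set.indicator_of_notMem (Set.disjoint_left.1 (hG.disjoint hk.symm) hi) _
    · simp
  · rw [Finset.sum_eq_zero fun i _ => Set.indicator_of_notMem (fun h => hx ⟨i, h⟩) _]
    exact zero_le_one

theorem IsGrid.sum_sum_le_one (hG : IsGrid A φ c η H) (x : X) (y : Y) :
    ∑ i, ∑ j, (A i).indicator (1 : X → ℝ≥0∞) x * φ j y ≤ 1 := by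
  simp_rw [← Finset.mul_sum]
  rw [← Finset.sum_mul]
  exact mul_le_one' (hG.sum_indicator_le_one x) (hG.sum_weight_le_one y)

variable [MeasurableSpace Ω] [MeasurableSpace Y] [OpensMeasurableSpace Y]
  {σ : Measure Ω} {ξ : Ω → X} {ζ : Ω → Y} {μ : Measure X} {ν : Measure Y}

theorem lintegral_grid_eq (hσ : Couples σ ξ ζ μ ν) (hA : ∀ i, MeasurableSet (A i))
    (d : ι → κ → ℝ≥0∞) :
    ∑ i, ∑ j, d i j * cellMass A φ σ ξ ζ i j =
      ∫⁻ ω, ∑ i, ∑ j, (A i).indicator 1 (ξ ω) * φ j (ζ ω) * d i j ∂σ := by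
  have hξ := hσ.measurable_left
  have hζ := hσ.measurable_right
  have hφ : ∀ j, Measurable fun ω => (φ j (ζ ω) : ℝ≥0∞) := fun j =>
    ((φ j).continuous.measurable.comp hζ).coe_nnreal_ennreal
  have h1 : ∀ i, Measurable fun ω => (A i).indicator (1 : X → ℝ≥0∞) (ξ ω) := fun i =>
    (measurable_one.indicator (hA i)).comp hξ
  have h2 : ∀ i j, Measurable fun ω => (A i).indicator (1 : X → ℝ≥0∞) (ξ ω) * φ j (ζ ω) :=
    fun i j => (h1 i).mul (hφ j)
  have h3 : ∀ i j, Measurable fun ω =>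
      (A i).indicator (1 : X → ℝ≥0∞) (ξ ω) * φ j (ζ ω) * d i j :=
    fun i j => (h2 i j).mul_const _
  rw [lintegral_finsetSum _ fun i _ => Finset.measurable_fun_sum _ fun j _ => h3 i j]
  refine Finset.sum_congr rfl fun i _ => ?_
  rw [lintegral_finsetSum _ fun j _ => h3 i j]
  refine Finset.sum_congr rfl fun j _ => ?_
  rw [lintegral_mul_const _ (h2 i j), mul_comm, cellMass, ← lintegral_indicator (hξ (hA i))]
  congr 2
  funext ω
  by_cases hω : ξ ω ∈ A i
  · simp [Set.indicator, hω]
  · simp [Set.indicator, hω]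

theorem IsGrid.sum_mul_cellMass_le (hG : IsGrid A φ c η H) (hσ : Couples σ ξ ζ μ ν)
    [IsProbabilityMeasure σ] :
    ∑ i, ∑ j, c i j * cellMass A φ σ ξ ζ i j ≤ ∫⁻ ω, H (ξ ω) (ζ ω) ∂σ + η := by
  rw [lintegral_grid_eq hσ hG.measurableSet]
  calc _ ≤ ∫⁻ ω, (H (ξ ω) (ζ ω) + η) ∂σ := by
        refine lintegral_mono fun ω => ?_
        calc _ ≤ ∑ i, ∑ j, (A i).indicator (1 : X → ℝ≥0∞) (ξ ω) * φ j (ζ ω) *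
              (H (ξ ω) (ζ ω) + η) := by
              refine Finset.sum_le_sum fun i _ => Finset.sum_le_sum fun j _ => ?_
              by_cases h1 : ξ ω ∈ A i
              · by_cases h2 : φ j (ζ ω) = 0
                · simp [h2]
                · gcongr
                  exact hG.le_add' i j _ h1 _ h2
              · simp [h1]
          _ ≤ _ := by
              simp_rw [← Finset.sum_mul]
              exact mul_le_of_le_one_left' (hG.sum_sum_le_one _ _)
    _ = _ := by rw [lintegral_add_right _ measurable_const]; simp

theorem IsGrid.lintegral_le (hG : IsGrid A φ c η H) (hσ : Couples σ ξ ζ μ ν)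
    [IsProbabilityMeasure σ] {δ : ℝ≥0∞}
    (hA : 1 ≤ ∑ i, μ (A i) + δ) (hφ : 1 ≤ ∑ j, ∫⁻ y, φ j y ∂ν + δ) :
    ∃ z : Ω → ℝ≥0∞, Measurable z ∧ (∀ ω, z ω ≤ 1) ∧ ∫⁻ ω, z ω ∂σ ≤ δ + δ ∧
      ∫⁻ ω, H (ξ ω) (ζ ω) ∂σ ≤ ∑ i, ∑ j, c i j * cellMass A φ σ ξ ζ i j + η +
        ∫⁻ ω, z ω * H (ξ ω) (ζ ω) ∂σ := by
  have hξ := hσ.measurable_left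
  have hζ := hσ.measurable_right
  have hφm : ∀ j, Measurable fun ω => (φ j (ζ ω) : ℝ≥0∞) := fun j =>
    ((φ j).continuous.measurable.comp hζ).coe_nnreal_ennreal
  have h1 : ∀ i, Measurable fun ω => (A i).indicator (1 : X → ℝ≥0∞) (ξ ω) := fun i =>
    (measurable_one.indicator (hG.measurableSet i)).comp hξ
  let P : Ω → ℝ≥0∞ := fun ω => ∑ i, (A i).indicator (1 : X → ℝ≥0∞) (ξ ω)
  let Q : Ω → ℝ≥0∞ := fun ω => ∑ j, (φ j (ζ ω) : ℝ≥0∞)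
  have hP : Measurable P := Finset.measurable_fun_sum _ fun i _ => h1 i
  have hQ : Measurable Q := Finset.measurable_fun_sum _ fun j _ => hφm j
  have hP1 : ∀ ω, P ω ≤ 1 := fun ω => hG.sum_indicator_le_one _
  have hQ1 : ∀ ω, Q ω ≤ 1 := fun ω => hG.sum_weight_le_one _
  have hPQ : ∀ ω, ∑ i, ∑ j, (A i).indicator (1 : X → ℝ≥0∞) (ξ ω) * φ j (ζ ω) = P ω * Q ω := by
    intro ω
    simp_rw [← Finset.mul_sum]
    rw [← Finset.sum_mul]
  have key : ∀ R : Ω → ℝ≥0∞, Measurable R → (∀ ω, R ω ≤ 1) → 1 ≤ ∫⁻ ω, R ω ∂σ + δ →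
      ∫⁻ ω, (1 - R ω) ∂σ ≤ δ := by
    intro R hR hR1 hle
    rw [lintegral_sub hR (ne_top_of_le_ne_top ENNReal.one_ne_top
      ((lintegral_mono hR1).trans (by simp))) (Eventually.of_forall hR1)]
    simpa [add_comm δ] using hle
  have hPi : ∫⁻ ω, P ω ∂σ = ∑ i, μ (A i) := by
    rw [lintegral_finsetSum _ fun i _ => h1 i]
    refine Finset.sum_congr rfl fun i _ => ?_
    rw [← hσ.map_left, ← lintegral_indicator_one (hG.measurableSet i),
      lintegral_map (measurable_one.indicator (hG.measurableSet i)) hξ]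
  have hQi : ∫⁻ ω, Q ω ∂σ = ∑ j, ∫⁻ y, φ j y ∂ν := by
    rw [lintegral_finsetSum _ fun j _ => hφm j]
    refine Finset.sum_congr rfl fun j _ => ?_
    rw [← hσ.map_right, lintegral_map (φ j).continuous.measurable.coe_nnreal_ennreal hζ]
  refine ⟨fun ω => 1 - P ω * Q ω, measurable_const.sub (hP.mul hQ), fun ω => tsub_le_self, ?_, ?_⟩
  · calc ∫⁻ ω, (1 - P ω * Q ω) ∂σ ≤ ∫⁻ ω, ((1 - P ω) + (1 - Q ω)) ∂σ := by
          refine lintegral_mono fun ω => ?_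
          rw [tsub_le_iff_left]
          calc (1 : ℝ≥0∞) = P ω * 1 + (1 - P ω) := by rw [mul_one, add_tsub_cancel_of_le (hP1 ω)]
            _ = P ω * (Q ω + (1 - Q ω)) + (1 - P ω) := by rw [add_tsub_cancel_of_le (hQ1 ω)]
            _ = P ω * Q ω + (P ω * (1 - Q ω) + (1 - P ω)) := by ring
            _ ≤ P ω * Q ω + (1 * (1 - Q ω) + (1 - P ω)) := by gcongr; exact hP1 ω
            _ = _ := by ring
      _ = ∫⁻ ω, (1 - P ω) ∂σ + ∫⁻ ω, (1 - Q ω) ∂σ :=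
          lintegral_add_left (measurable_const.sub hP) _
      _ ≤ δ + δ := add_le_add (key P hP hP1 (hPi ▸ hA)) (key Q hQ hQ1 (hQi ▸ hφ))
  · rw [lintegral_grid_eq hσ hG.measurableSet]
    have h2 : Measurable fun ω => ∑ i, ∑ j,
        (A i).indicator (1 : X → ℝ≥0∞) (ξ ω) * φ j (ζ ω) * c i j :=
      Finset.measurable_fun_sum _ fun i _ => Finset.measurable_fun_sum _ fun j _ =>
        ((h1 i).mul (hφm j)).mul_const _
    have h3 : ∫⁻ ω, (∑ i, ∑ j, (A i).indicator (1 : X → ℝ≥0∞) (ξ ω) * φ j (ζ ω) * c i j + η) ∂σ =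
        ∫⁻ ω, ∑ i, ∑ j, (A i).indicator (1 : X → ℝ≥0∞) (ξ ω) * φ j (ζ ω) * c i j ∂σ + η := by
      rw [lintegral_add_left h2]; simp
    rw [← h3, ← lintegral_add_left (h2.add_const _)]
    refine lintegral_mono fun ω => ?_
    calc H (ξ ω) (ζ ω) = (P ω * Q ω + (1 - P ω * Q ω)) * H (ξ ω) (ζ ω) := by
          rw [add_tsub_cancel_of_le (mul_le_one' (hP1 ω) (hQ1 ω)), one_mul]
      _ = ∑ i, ∑ j, (A i).indicator (1 : X → ℝ≥0∞) (ξ ω) * φ j (ζ ω) * H (ξ ω) (ζ ω) +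
          (1 - P ω * Q ω) * H (ξ ω) (ζ ω) := by
          simp_rw [← Finset.sum_mul]
          rw [hPQ, add_mul]
      _ ≤ ∑ i, ∑ j, (A i).indicator (1 : X → ℝ≥0∞) (ξ ω) * φ j (ζ ω) * (c i j + η) +
          (1 - P ω * Q ω) * H (ξ ω) (ζ ω) := by
          refine add_le_add (Finset.sum_le_sum fun i _ => Finset.sum_le_sum fun j _ => ?_) le_rfl
          by_cases h4 : ξ ω ∈ A i
          · by_cases h5 : φ j (ζ ω) = 0
            · simp [h5]
            · gcongr
              exact hG.le_add i j _ h4 _ h5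
          · simp [h4]
      _ ≤ _ := by
          gcongr
          simp_rw [mul_add, Finset.sum_add_distrib, ← Finset.sum_mul]
          rw [hPQ]
          gcongr
          exact mul_le_of_le_one_left' (mul_le_one' (hP1 ω) (hQ1 ω))

end Couples

theorem lintegral_ofReal_le_of_le {X : Type*} [MeasurableSpace X] {α μ : Measure X} (hα : α ≤ μ)
    {a : X → ℝ} (ha : Measurable a) (R : ℝ) :
    ∫⁻ x, ENNReal.ofReal (a x) ∂α ≤
      ENNReal.ofReal R * α Set.univ + ∫⁻ x in {x | R ≤ a x}, ENNReal.ofReal (a x) ∂μ := by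
  have hm : MeasurableSet {x | R ≤ a x} := measurableSet_le measurable_const ha
  calc ∫⁻ x, ENNReal.ofReal (a x) ∂α
      ≤ ∫⁻ x, (ENNReal.ofReal R + {x | R ≤ a x}.indicator (fun x => ENNReal.ofReal (a x)) x) ∂α := by
        refine lintegral_mono fun x => ?_
        by_cases hx : R ≤ a x
        · rw [Set.indicator_of_mem (show x ∈ {x | R ≤ a x} from hx)]
          exact le_add_self
        · exact (ENNReal.ofReal_le_ofReal (not_le.1 hx).le).trans le_self_add
    _ = ENNReal.ofReal R * α Set.univ + ∫⁻ x in {x | R ≤ a x}, ENNReal.ofReal (a x) ∂α := by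
        rw [lintegral_add_left measurable_const, lintegral_const, lintegral_indicator hm]
    _ ≤ _ := by
        gcongr

theorem exists_forall_lintegral_add_le {X Y T : Type*} [MeasurableSpace X] [MeasurableSpace Y]
    {μ : T → Measure X} {ν : T → Measure Y} {a : T → X → ℝ} {b : T → Y → ℝ}
    (hameas : ∀ t, Measurable (a t)) (hbmeas : ∀ t, Measurable (b t))
    (ha0 : ∀ t x, 0 ≤ a t x) (hb0 : ∀ t y, 0 ≤ b t y)
    (haint : ∀ t, Integrable (a t) (μ t)) (hbint : ∀ t, Integrable (b t) (ν t))
    (hunif : ∀ δ > (0 : ℝ), ∃ R₀ : ℝ, ∀ R ≥ R₀, ∀ t : T,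
      (∫ x in {x | R ≤ a t x}, a t x ∂(μ t)) + ∫ y in {y | R ≤ b t y}, b t y ∂(ν t) ≤ δ)
    {δ : ℝ} (hδ : 0 < δ) :
    ∃ κ : ℝ, 0 < κ ∧ ∀ t, ∀ α ≤ μ t, ∀ β ≤ ν t, α Set.univ ≤ ENNReal.ofReal κ →
      β Set.univ ≤ ENNReal.ofReal κ →
      ∫⁻ x, ENNReal.ofReal (a t x) ∂α + ∫⁻ y, ENNReal.ofReal (b t y) ∂β ≤ ENNReal.ofReal δ := by
  obtain ⟨R₀, hR₀⟩ := hunif (δ / 2) (by positivity)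
  set R := max R₀ 1 with hR
  have hR1 : 1 ≤ R := le_max_right _ _
  refine ⟨δ / (4 * R), by positivity, fun t α hα β hβ hα1 hβ1 => ?_⟩
  have h1 := lintegral_ofReal_le_of_le hα (hameas t) R
  have h2 := lintegral_ofReal_le_of_le hβ (hbmeas t) R
  have h3 := hR₀ R (le_max_left _ _) t
  rw [← ofReal_integral_eq_lintegral_ofReal (haint t).integrableOn
    (Eventually.of_forall fun x => ha0 t x)] at h1
  rw [← ofReal_integral_eq_lintegral_ofReal (hbint t).integrableOn
    (Eventually.of_forall fun x => hb0 t x)] at h2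
  have h4 : ∀ m : ℝ≥0∞, m ≤ ENNReal.ofReal (δ / (4 * R)) →
      ENNReal.ofReal R * m ≤ ENNReal.ofReal (δ / 4) := by
    intro m hm
    refine (mul_le_mul_right hm _).trans ?_
    rw [← ENNReal.ofReal_mul (by positivity)]
    refine ENNReal.ofReal_le_ofReal (le_of_eq ?_)
    field_simp
  have h5 := setIntegral_nonneg_of_ae (μ := μ t) (s := {x | R ≤ a t x})
    (Eventually.of_forall fun x => ha0 t x)
  have h6 := setIntegral_nonneg_of_ae (μ := ν t) (s := {x | R ≤ b t x})
    (Eventually.of_forall fun x => hb0 t x)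
  calc _ ≤ _ := add_le_add h1 h2
    _ ≤ (ENNReal.ofReal (δ / 4) + ENNReal.ofReal (∫ x in {x | R ≤ a t x}, a t x ∂(μ t))) +
        (ENNReal.ofReal (δ / 4) + ENNReal.ofReal (∫ x in {x | R ≤ b t x}, b t x ∂(ν t))) := by
        gcongr
        · exact h4 _ hα1
        · exact h4 _ hβ1
    _ ≤ ENNReal.ofReal δ := by
        rw [← ENNReal.ofReal_add (by positivity) h5, ← ENNReal.ofReal_add (by positivity) h6,
          ← ENNReal.ofReal_add (by positivity) (by positivity)]
        exact ENNReal.ofReal_le_ofReal (by linarith)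

/-- A continuous function is almost constant on the products of finite open covers of two compact
sets, locally uniformly in a parameter. -/
theorem exists_finite_product_cover {X Y T : Type*} [TopologicalSpace X] [TopologicalSpace Y]
    [TopologicalSpace T] {h : X → Y → T → ℝ}
    (hcont : Continuous fun p : X × Y × T => h p.1 p.2.1 p.2.2)
    {K : Set X} (hK : IsCompact K) {L : Set Y} (hL : IsCompact L) (t₀ : T) {η : ℝ} (hη : 0 < η) :
    ∃ (m n : ℕ) (U : Fin m → Set X) (V : Fin n → Set Y) (x₀ : Fin m → X) (y₀ : Fin n → Y),
      (∀ i, IsOpen (U i)) ∧ (∀ j, IsOpen (V j)) ∧ K ⊆ ⋃ i, U i ∧ L ⊆ ⋃ j, V j ∧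
      ∀ᶠ t in 𝓝 t₀, ∀ i j, ∀ x ∈ U i, ∀ y ∈ V j, |h x y t - h (x₀ i) (y₀ j) t₀| ≤ η := by
  have h1 : ∀ x : X, ∃ (U : Set X) (O : Set (Y × T)), IsOpen U ∧ IsOpen O ∧ x ∈ U ∧
      L ×ˢ {t₀} ⊆ O ∧ ∀ x' ∈ U, ∀ p ∈ O, |h x' p.1 p.2 - h x p.1 t₀| < η / 2 := by
    intro x
    have ho : IsOpen {q : X × Y × T | |h q.1 q.2.1 q.2.2 - h x q.2.1 t₀| < η / 2} := by
      refine isOpen_lt ?_ continuous_const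
      refine (hcont.sub (hcont.comp
        (g := fun q : X × Y × T => h q.1 q.2.1 q.2.2) (f := fun q : X × Y × T => (x, q.2.1, t₀))
        (by fun_prop))).abs
    obtain ⟨U, O, hU, hO, hxU, hLO, hUO⟩ := generalized_tube_lemma (isCompact_singleton (x := x))
      (hL.prod (isCompact_singleton (x := t₀))) ho (by
        rintro ⟨x', y, t⟩ ⟨hx', hy, ht⟩
        simp only [Set.mem_singleton_iff] at hx' ht
        subst hx' ht
        simpa using hη)
    exact ⟨U, O, hU, hO, hxU rfl, hLO, fun x' hx' p hp => hUO (Set.mk_mem_prod hx' hp)⟩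
  choose U O hU hO hxU hLO hUO using h1
  obtain ⟨s, hs⟩ := hK.elim_finite_subcover U hU (fun x _ => Set.mem_iUnion.2 ⟨x, hxU x⟩)
  obtain ⟨L', W, hL', hW, hLL', htW, hLW⟩ := generalized_tube_lemma hL
    (isCompact_singleton (x := t₀)) (isOpen_biInter_finset fun x (_ : x ∈ s) => hO x)
    (Set.subset_iInter₂ fun x _ => hLO x)
  let V : Y → Set Y := fun y => L' ∩ ⋂ x ∈ s, {y' | |h x y' t₀ - h x y t₀| < η / 2}
  have hV : ∀ y, IsOpen (V y) := by
    intro y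
    refine hL'.inter (isOpen_biInter_finset fun x _ => ?_)
    refine isOpen_lt ?_ continuous_const
    exact ((hcont.comp (g := fun q : X × Y × T => h q.1 q.2.1 q.2.2)
      (f := fun y' : Y => (x, y', t₀)) (by fun_prop)).sub continuous_const).abs
  obtain ⟨r, hr⟩ := hL.elim_nhds_subcover V (fun y hy => (hV y).mem_nhds
    ⟨hLL' hy, Set.mem_iInter₂.2 fun x _ => by simpa using hη⟩)
  refine ⟨s.card, r.card, fun i => U (s.equivFin.symm i), fun j => V (r.equivFin.symm j),
    fun i => s.equivFin.symm i, fun j => r.equivFin.symm j, fun i => hU _, fun j => hV _, ?_, ?_, ?_⟩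
  · intro x hx
    obtain ⟨x', hx', hxx⟩ := Set.mem_iUnion₂.1 (hs hx)
    exact Set.mem_iUnion.2 ⟨s.equivFin ⟨x', hx'⟩, by simpa using hxx⟩
  · intro y hy
    obtain ⟨y', hy', hyy⟩ := Set.mem_iUnion₂.1 (hr.2 hy)
    exact Set.mem_iUnion.2 ⟨r.equivFin ⟨y', hy'⟩, by simpa using hyy⟩
  · filter_upwards [hW.mem_nhds (htW rfl)] with t ht i j x hx y hy
    have hi := (s.equivFin.symm i).2
    have e1 := hUO _ x hx (y, t) (Set.mem_iInter₂.1 (hLW (Set.mk_mem_prod hy.1 ht)) _ hi)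
    have e2 : |h (s.equivFin.symm i) y t₀ - h (s.equivFin.symm i) (r.equivFin.symm j) t₀| < η / 2 :=
      Set.mem_iInter₂.1 hy.2 _ hi
    have e3 := abs_sub_le (h x y t) (h (s.equivFin.symm i) y t₀)
      (h (s.equivFin.symm i) (r.equivFin.symm j) t₀)
    simp only at e1
    linarith

theorem exists_isCompact_lt_measure_add {X : Type*} [TopologicalSpace X] [MeasurableSpace X]
    (μ : Measure X) [IsProbabilityMeasure μ] [μ.InnerRegular] {κ : ℝ≥0∞} (hκ : κ ≠ 0) :
    ∃ K, IsCompact K ∧ 1 < μ K + κ := by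
  rcases le_or_gt κ 1 with h1 | h1
  · have hlt : 1 - κ < μ Set.univ := by
      rw [measure_univ]
      exact ENNReal.sub_lt_self ENNReal.one_ne_top one_ne_zero hκ
    obtain ⟨K, -, hK, hlt⟩ := MeasurableSet.univ.exists_lt_isCompact hlt
    exact ⟨K, hK, by
      rw [ENNReal.sub_lt_iff_lt_right (ne_top_of_le_ne_top ENNReal.one_ne_top h1) h1] at hlt
      exact hlt⟩
  · exact ⟨∅, isCompact_empty, by simpa using h1⟩

theorem sum_subtype_ne_zero {ι M : Type*} [Fintype ι] [AddCommMonoid M] (f : ι → M)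
    [DecidablePred fun i => f i ≠ 0] : ∑ i : {i // f i ≠ 0}, f i = ∑ i, f i :=
  (Finset.sum_subtype (Finset.univ.filter fun i => f i ≠ 0) (by simp) f).symm.trans
    (Finset.sum_filter_ne_zero _)

theorem exists_disjoint_refinement {X : Type*} [TopologicalSpace X] [MeasurableSpace X]
    [OpensMeasurableSpace X] {m : ℕ} {U : Fin m → Set X} (hU : ∀ i, IsOpen (U i)) {K : Set X}
    (hK : MeasurableSet K) (hKU : K ⊆ ⋃ i, U i) :
    ∃ A : Fin m → Set X, (∀ i, MeasurableSet (A i)) ∧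
      (Pairwise fun i i' => Disjoint (A i) (A i')) ∧ (∀ i, A i ⊆ U i) ∧ K ⊆ ⋃ i, A i := by
  refine ⟨fun i => (K ∩ U i) ∩ ⋂ (i') (_ : i' < i), (U i')ᶜ, fun i => ?_, ?_, fun i x hx => hx.1.2,
    fun x hx => ?_⟩
  · exact (hK.inter (hU i).measurableSet).inter
      (MeasurableSet.iInter fun i' => MeasurableSet.iInter fun _ => (hU i').measurableSet.compl)
  · have key : ∀ i i' : Fin m, i < i' → Disjoint ((K ∩ U i) ∩ ⋂ (k) (_ : k < i), (U k)ᶜ)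
        ((K ∩ U i') ∩ ⋂ (k) (_ : k < i'), (U k)ᶜ) := fun i i' hlt =>
      Set.disjoint_left.2 fun x hx hx' => Set.mem_iInter₂.1 hx'.2 i hlt hx.1.2
    intro i i' hne
    rcases lt_or_gt_of_ne hne with hlt | hlt
    exacts [key i i' hlt, (key i' i hlt).symm]
  · have hne : {i | x ∈ U i}.Nonempty := Set.mem_iUnion.1 (hKU hx)
    have hwf : WellFounded ((· < ·) : Fin m → Fin m → Prop) := wellFounded_lt
    refine Set.mem_iUnion.2 ⟨hwf.min _ hne, ⟨hx, hwf.min_mem _ hne⟩, Set.mem_iInter₂.2 ?_⟩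
    exact fun i' hi' hxi => hwf.not_lt_min _ hxi hi'

theorem exists_finite_weights {Y : Type*} [MetricSpace Y] {n : ℕ} {V : Fin n → Set Y}
    (hV : ∀ j, IsOpen (V j)) {L : Set Y} (hL : IsClosed L) (hLV : L ⊆ ⋃ j, V j) :
    ∃ φ : Fin n → Y →ᵇ ℝ≥0, (∀ y, ∑ j, φ j y ≤ 1) ∧ (∀ j y, φ j y ≠ 0 → y ∈ V j) ∧
      ∀ y ∈ L, ∑ j, φ j y = 1 := by
  obtain ⟨f, hf⟩ := PartitionOfUnity.exists_isSubordinate hL V hV hLV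
  have hsum : ∀ y, ∑ j, (f j y).toNNReal = (∑ᶠ j, f j y).toNNReal := by
    intro y
    rw [finsum_eq_sum_of_fintype, Real.toNNReal_sum_of_nonneg fun j _ => f.nonneg j y]
  refine ⟨fun j => BoundedContinuousFunction.nnrealPart
    (BoundedContinuousFunction.ofNormedAddCommGroup (fun y => f j y) (f j).continuous 1
      (fun y => by rw [Real.norm_of_nonneg (f.nonneg j y)]; exact f.le_one j y)),
    fun y => ?_, fun j y hy => ?_, fun y hy => ?_⟩
  · change ∑ j, (f j y).toNNReal ≤ 1
    rw [hsum, Real.toNNReal_le_one]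
    exact f.sum_le_one y
  · have hy : (f j y).toNNReal ≠ 0 := hy
    refine hf j (subset_tsupport _ fun h0 => hy ?_)
    rw [h0, Real.toNNReal_zero]
  · change ∑ j, (f j y).toNNReal = 1
    rw [hsum, f.sum_eq_one hy, Real.toNNReal_one]

open Classical in
theorem exists_grid {X Y T : Type*} [TopologicalSpace X] [T2Space X] [MetricSpace Y]
    [TopologicalSpace T] [MeasurableSpace X] [BorelSpace X] [MeasurableSpace Y] [BorelSpace Y]
    {μ : T → ProbabilityMeasure X} {ν : T → ProbabilityMeasure Y}
    (hμr : ∀ t, (μ t : Measure X).InnerRegular) (hνr : ∀ t, (ν t : Measure Y).InnerRegular)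
    (hμc : TVContinuousFamily fun t => (μ t : Measure X)) (hνc : Continuous ν)
    {h : X → Y → T → ℝ} (hcont : Continuous fun p : X × Y × T => h p.1 p.2.1 p.2.2)
    (hnonneg : ∀ x y t, 0 ≤ h x y t) (t₀ : T) {η : ℝ≥0} (hη : 0 < η) {κ : ℝ≥0∞} (hκ : κ ≠ 0) :
    ∃ (ι ι' : Type) (_ : Fintype ι) (_ : Fintype ι') (A : ι → Set X)
      (φ : ι' → Y →ᵇ ℝ≥0) (c : ι → ι' → ℝ≥0),
      (∀ᶠ t in 𝓝 t₀, IsGrid A φ c η (fun x y => ENNReal.ofReal (h x y t)) ∧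
        1 ≤ ∑ i, (μ t : Measure X) (A i) + κ ∧
        1 ≤ ∑ j, ∫⁻ y, φ j y ∂(ν t : Measure Y) + κ) ∧
      (∀ i, (μ t₀ : Measure X) (A i) ≠ 0) ∧ ∀ j, ∫⁻ y, φ j y ∂(ν t₀ : Measure Y) ≠ 0 := by
  have := hμr t₀
  have := hνr t₀
  obtain ⟨K, hK, hKκ⟩ := exists_isCompact_lt_measure_add (μ t₀ : Measure X) hκ
  obtain ⟨L, hL, hLκ⟩ := exists_isCompact_lt_measure_add (ν t₀ : Measure Y) hκ
  obtain ⟨m, n, U, V, x₀, y₀, hU, hV, hKU, hLV, hev⟩ :=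
    exists_finite_product_cover hcont hK hL t₀ (NNReal.coe_pos.2 hη)
  obtain ⟨A, hAm, hAd, hAU, hKA⟩ := exists_disjoint_refinement hU hK.isClosed.measurableSet hKU
  obtain ⟨φ, hφ1, hφV, hφL⟩ := exists_finite_weights hV hL.isClosed hLV
  have hsA : 1 < ∑ i, (μ t₀ : Measure X) (A i) + κ := by
    refine hKκ.trans_le (add_le_add ?_ le_rfl)
    exact (measure_mono hKA).trans (measure_iUnion_fintype_le _ _)
  have hsφ : 1 < ∑ j, ∫⁻ y, φ j y ∂(ν t₀ : Measure Y) + κ := by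
    refine hLκ.trans_le (add_le_add ?_ le_rfl)
    rw [← lintegral_finsetSum _ fun j _ => (φ j).continuous.measurable.coe_nnreal_ennreal,
      ← lintegral_indicator_one hL.isClosed.measurableSet]
    refine lintegral_mono fun y => ?_
    by_cases hy : y ∈ L
    · rw [Set.indicator_of_mem hy]
      change (1 : ℝ≥0∞) ≤ _
      exact_mod_cast (hφL y hy).ge
    · simp [hy]
  refine ⟨{i // (μ t₀ : Measure X) (A i) ≠ 0}, {j // ∫⁻ y, φ j y ∂(ν t₀ : Measure Y) ≠ 0},
    inferInstance, inferInstance, fun i => A i, fun j => φ j,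
    fun i j => (h (x₀ i) (y₀ j) t₀).toNNReal, ?_, fun i => i.2, fun j => j.2⟩
  rw [← sum_subtype_ne_zero] at hsA hsφ
  have e1 := ((tendsto_finsetSum Finset.univ fun (i : {i // (μ t₀ : Measure X) (A i) ≠ 0}) _ =>
    hμc.tendsto_measure t₀ (hAm i)).add_const κ).eventually_const_lt hsA
  have e2 := ((tendsto_finsetSum Finset.univ
    fun (j : {j // ∫⁻ y, φ j y ∂(ν t₀ : Measure Y) ≠ 0}) _ =>
    tendsto_lintegral_of_continuous hνc t₀ (φ j)).add_const κ).eventually_const_lt hsφ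
  filter_upwards [hev, e1, e2] with t ht h1 h2
  refine ⟨⟨fun i => hAm i, fun i i' hne => hAd (Subtype.coe_injective.ne hne), fun y => ?_, ?_, ?_⟩,
    h1.le, h2.le⟩
  · refine le_trans ?_ (hφ1 y)
    rw [← Finset.sum_subtype (Finset.univ.filter fun j => ∫⁻ y, φ j y ∂(ν t₀ : Measure Y) ≠ 0)
      (by simp) fun j => φ j y]
    exact Finset.sum_le_sum_of_subset (Finset.filter_subset _ _)
  · intro i j x hx y hy
    have := (abs_le.1 (ht i j x (hAU i hx) y (hφV j y hy))).2
    rw [← ENNReal.ofReal_coe_nnreal, ← ENNReal.ofReal_coe_nnreal (p := η),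
      ← ENNReal.ofReal_add (by positivity) (by positivity), Real.coe_toNNReal _ (hnonneg _ _ _)]
    exact ENNReal.ofReal_le_ofReal (by linarith)
  · intro i j x hx y hy
    have := (abs_le.1 (ht i j x (hAU i hx) y (hφV j y hy))).1
    rw [← ENNReal.ofReal_coe_nnreal, ← ENNReal.ofReal_coe_nnreal (p := η),
      ← ENNReal.ofReal_add (hnonneg _ _ _) (by positivity), Real.coe_toNNReal _ (hnonneg _ _ _)]
    exact ENNReal.ofReal_le_ofReal (by linarith)

/-- The integral of `F` over the part of a plan that starts in `E`. -/
noncomputable def pairing {X Y : Type*} [MeasurableSpace X] [MeasurableSpace Y]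
    (σ : Measure (X × Y)) (E : Set X) (F : Y → ℝ≥0∞) : ℝ≥0∞ :=
  ∫⁻ p, E.indicator 1 p.1 * F p.2 ∂σ

section Pairing

variable {X Y : Type*} [MeasurableSpace X] [MeasurableSpace Y]

theorem pairing_prod (α : Measure X) (β : Measure Y) [SFinite β] {E : Set X}
    (hE : MeasurableSet E) {F : Y → ℝ≥0∞} (hF : Measurable F) :
    pairing (α.prod β) E F = α E * ∫⁻ y, F y ∂β := by
  rw [pairing, lintegral_prod_mul (measurable_one.indicator hE).aemeasurable hF.aemeasurable,
    lintegral_indicator_one hE]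

theorem pairing_add (σ τ : Measure (X × Y)) (E : Set X) (F : Y → ℝ≥0∞) :
    pairing (σ + τ) E F = pairing σ E F + pairing τ E F := lintegral_add_measure _ _ _

theorem pairing_smul (r : ℝ≥0∞) (σ : Measure (X × Y)) (E : Set X) (F : Y → ℝ≥0∞) :
    pairing (r • σ) E F = r * pairing σ E F := lintegral_smul_measure _ _

theorem pairing_eq_setLIntegral (σ : Measure (X × Y)) {E : Set X} (hE : MeasurableSet E)
    (F : Y → ℝ≥0∞) : pairing σ E F = ∫⁻ p in Prod.fst ⁻¹' E, F p.2 ∂σ := by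
  rw [pairing, ← lintegral_indicator (measurable_fst hE)]
  refine lintegral_congr fun p => ?_
  by_cases hp : p.1 ∈ E
  · simp [Set.indicator, hp]
  · simp [Set.indicator, hp]

theorem pairing_one (σ : Measure (X × Y)) {E : Set X} (hE : MeasurableSet E) :
    pairing σ E 1 = σ.map Prod.fst E := by
  rw [pairing_eq_setLIntegral σ hE, Measure.map_apply measurable_fst hE]
  simp

theorem pairing_univ (σ : Measure (X × Y)) {F : Y → ℝ≥0∞} (hF : Measurable F) :
    pairing σ Set.univ F = ∫⁻ y, F y ∂(σ.map Prod.snd) := by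
  rw [pairing_eq_setLIntegral σ MeasurableSet.univ, lintegral_map hF measurable_snd]
  simp

end Pairing

section Completion

variable {X Y : Type*} [MeasurableSpace X] [MeasurableSpace Y]

/-- A partial plan completed by a multiple of the product of what is left of the marginals. -/
noncomputable def completePlan (μ : Measure X) (ν : Measure Y) (τ : Measure (X × Y)) :
    Measure (X × Y) :=
  τ + (1 - τ Set.univ)⁻¹ • (μ - τ.map Prod.fst).prod (ν - τ.map Prod.snd)

variable {μ : Measure X} {ν : Measure Y} [IsProbabilityMeasure μ] [IsProbabilityMeasure ν]
  {τ : Measure (X × Y)}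

theorem isFiniteMeasure_of_map_fst_le (h1 : τ.map Prod.fst ≤ μ) : IsFiniteMeasure τ := by
  refine ⟨?_⟩
  have := h1 Set.univ
  rw [Measure.map_apply measurable_fst MeasurableSet.univ, Set.preimage_univ] at this
  exact this.trans_lt (measure_lt_top _ _)

theorem sub_map_fst_univ (h1 : τ.map Prod.fst ≤ μ) :
    (μ - τ.map Prod.fst) Set.univ = 1 - τ Set.univ := by
  have := isFiniteMeasure_of_map_fst_le h1
  have : IsFiniteMeasure (τ.map Prod.fst) := Measure.isFiniteMeasure_map _ _
  rw [Measure.sub_apply MeasurableSet.univ h1, measure_univ,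
    Measure.map_apply measurable_fst MeasurableSet.univ, Set.preimage_univ]

theorem sub_map_snd_univ (hτ : IsFiniteMeasure τ) (h2 : τ.map Prod.snd ≤ ν) :
    (ν - τ.map Prod.snd) Set.univ = 1 - τ Set.univ := by
  have : IsFiniteMeasure (τ.map Prod.snd) := Measure.isFiniteMeasure_map _ _
  rw [Measure.sub_apply MeasurableSet.univ h2, measure_univ,
    Measure.map_apply measurable_snd MeasurableSet.univ, Set.preimage_univ]

theorem couples_completePlan (h1 : τ.map Prod.fst ≤ μ) (h2 : τ.map Prod.snd ≤ ν)
    (hlt : τ Set.univ < 1) : Couples (completePlan μ ν τ) Prod.fst Prod.snd μ ν := by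
  have hτ := isFiniteMeasure_of_map_fst_le h1
  have : IsFiniteMeasure (τ.map Prod.fst) := Measure.isFiniteMeasure_map _ _
  have : IsFiniteMeasure (τ.map Prod.snd) := Measure.isFiniteMeasure_map _ _
  have hne : 1 - τ Set.univ ≠ 0 := (tsub_pos_of_lt hlt).ne'
  have hnt : 1 - τ Set.univ ≠ ⊤ := ENNReal.sub_ne_top ENNReal.one_ne_top
  refine ⟨measurable_fst, measurable_snd, ?_, ?_⟩
  · rw [completePlan, Measure.map_add _ _ measurable_fst, Measure.map_smul, Measure.map_fst_prod,
      sub_map_snd_univ hτ h2, smul_smul, ENNReal.inv_mul_cancel hne hnt, one_smul, add_comm,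
      Measure.sub_add_cancel_of_le h1]
  · rw [completePlan, Measure.map_add _ _ measurable_snd, Measure.map_smul, Measure.map_snd_prod,
      sub_map_fst_univ h1, smul_smul, ENNReal.inv_mul_cancel hne hnt, one_smul, add_comm,
      Measure.sub_add_cancel_of_le h2]

theorem lintegral_completePlan_le (h1 : τ.map Prod.fst ≤ μ) (h2 : τ.map Prod.snd ≤ ν)
    (hlt : τ Set.univ < 1) {H : X × Y → ℝ≥0∞} {a : X → ℝ≥0∞} {b : Y → ℝ≥0∞} (ha : Measurable a)
    (hb : Measurable b) (hH : ∀ p, H p ≤ a p.1 + b p.2) :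
    ∫⁻ p, H p ∂(completePlan μ ν τ) ≤ ∫⁻ p, H p ∂τ +
      (∫⁻ x, a x ∂(μ - τ.map Prod.fst) + ∫⁻ y, b y ∂(ν - τ.map Prod.snd)) := by
  have hτ := isFiniteMeasure_of_map_fst_le h1
  have hne : 1 - τ Set.univ ≠ 0 := (tsub_pos_of_lt hlt).ne'
  have hnt : 1 - τ Set.univ ≠ ⊤ := ENNReal.sub_ne_top ENNReal.one_ne_top
  rw [completePlan, lintegral_add_measure, lintegral_smul_measure]
  gcongr
  calc (1 - τ Set.univ)⁻¹ • ∫⁻ p, H p ∂((μ - τ.map Prod.fst).prod (ν - τ.map Prod.snd))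
      ≤ (1 - τ Set.univ)⁻¹ • ∫⁻ p, (a p.1 + b p.2)
          ∂((μ - τ.map Prod.fst).prod (ν - τ.map Prod.snd)) := by
        simp only [smul_eq_mul]
        gcongr
        exact hH _
    _ = (1 - τ Set.univ)⁻¹ • ((1 - τ Set.univ) * ∫⁻ x, a x ∂(μ - τ.map Prod.fst) +
          (1 - τ Set.univ) * ∫⁻ y, b y ∂(ν - τ.map Prod.snd)) := by
        rw [lintegral_add_left (show Measurable fun p : X × Y => a p.1 from ha.comp measurable_fst),
          ← lintegral_map ha measurable_fst, ← lintegral_map hb measurable_snd,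
          Measure.map_fst_prod, Measure.map_snd_prod, sub_map_snd_univ hτ h2, sub_map_fst_univ h1,
          lintegral_smul_measure, lintegral_smul_measure]
        rfl
    _ = _ := by
        rw [← mul_add, smul_eq_mul, ← mul_assoc, ENNReal.inv_mul_cancel hne hnt, one_mul]

theorem lintegral_measure_sub {α : Type*} [MeasurableSpace α] {μ ν : Measure α}
    [IsFiniteMeasure ν] (h : ν ≤ μ) {F : α → ℝ≥0∞} (hF : ∫⁻ x, F x ∂ν ≠ ⊤) :
    ∫⁻ x, F x ∂(μ - ν) = ∫⁻ x, F x ∂μ - ∫⁻ x, F x ∂ν := by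
  conv_rhs => rw [← Measure.sub_add_cancel_of_le h]
  rw [lintegral_add_measure, ENNReal.add_sub_cancel_right hF]

theorem pairing_completePlan (h1 : τ.map Prod.fst ≤ μ) (h2 : τ.map Prod.snd ≤ ν)
    {E : Set X} (hE : MeasurableSet E) {F : Y → ℝ≥0∞} (hF : Measurable F)
    (hFt : ∫⁻ y, F y ∂ν ≠ ⊤) :
    pairing (completePlan μ ν τ) E F = pairing τ E F + (1 - τ Set.univ)⁻¹ *
      ((μ E - pairing τ E 1) * (∫⁻ y, F y ∂ν - pairing τ Set.univ F)) := by
  have hτ := isFiniteMeasure_of_map_fst_le h1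
  have : IsFiniteMeasure (τ.map Prod.fst) := Measure.isFiniteMeasure_map _ _
  have : IsFiniteMeasure (τ.map Prod.snd) := Measure.isFiniteMeasure_map _ _
  rw [completePlan, pairing_add, pairing_smul, pairing_prod _ _ hE hF, Measure.sub_apply hE h1,
    lintegral_measure_sub h2 (ne_top_of_le_ne_top hFt (lintegral_mono' h2 le_rfl)),
    pairing_one τ hE, pairing_univ τ hF]

end Completion

section GridPlan

variable {X Y ι κ : Type*} [MeasurableSpace X] [TopologicalSpace Y] [MeasurableSpace Y]
  [Fintype ι] [Fintype κ]

/-- The partial plan that gives the masses `c i j` to normalized products on the cells of a grid. -/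
noncomputable def gridPlan (A : ι → Set X) (φ : κ → Y →ᵇ ℝ≥0) (c : ι → κ → ℝ≥0∞)
    (μ : Measure X) (ν : Measure Y) : Measure (X × Y) :=
  ∑ i, ∑ j, (c i j / (μ (A i) * ∫⁻ y, φ j y ∂ν)) •
    (μ.restrict (A i)).prod (ν.withDensity fun y => φ j y)

variable {A : ι → Set X} {φ : κ → Y →ᵇ ℝ≥0} {c : ι → κ → ℝ≥0∞}
  {μ : Measure X} {ν : Measure Y}

theorem lintegral_gridPlan (H : X × Y → ℝ≥0∞) :
    ∫⁻ p, H p ∂(gridPlan A φ c μ ν) = ∑ i, ∑ j, c i j / (μ (A i) * ∫⁻ y, φ j y ∂ν) *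
      ∫⁻ p, H p ∂((μ.restrict (A i)).prod (ν.withDensity fun y => φ j y)) := by
  simp only [gridPlan, lintegral_finsetSum_measure, lintegral_smul_measure, smul_eq_mul]

theorem pairing_gridPlan [OpensMeasurableSpace Y] [SFinite μ] [IsFiniteMeasure ν] {E : Set X} (hE : MeasurableSet E)
    {F : Y → ℝ≥0∞} (hF : Measurable F) :
    pairing (gridPlan A φ c μ ν) E F = ∑ i, ∑ j, c i j / (μ (A i) * ∫⁻ y, φ j y ∂ν) *
      (μ (E ∩ A i) * ∫⁻ y, φ j y * F y ∂ν) := by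
  rw [pairing, lintegral_gridPlan]
  refine Finset.sum_congr rfl fun i _ => Finset.sum_congr rfl fun j _ => ?_
  have := pairing_prod (μ.restrict (A i)) (ν.withDensity fun y => φ j y) hE hF
  rw [pairing] at this
  rw [this, Measure.restrict_apply hE, lintegral_withDensity_eq_lintegral_mul _
    (φ j).continuous.measurable.coe_nnreal_ennreal hF]
  rfl

theorem lintegral_weight_ne_top [IsFiniteMeasure ν] (F : Y →ᵇ ℝ≥0) : ∫⁻ y, F y ∂ν ≠ ⊤ :=
  (BoundedContinuousFunction.lintegral_lt_top_of_nnreal ν F).ne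

theorem ennreal_div_mul_mul_cancel {a p q : ℝ≥0∞} (hp : p ≠ 0) (hp' : p ≠ ⊤) (hq : q ≠ 0)
    (hq' : q ≠ ⊤) (x : ℝ≥0∞) : a / (p * q) * (x * q) = a / p * x := by
  rw [ENNReal.div_eq_inv_mul, ENNReal.div_eq_inv_mul, ENNReal.mul_inv (Or.inl hp) (Or.inl hp')]
  calc p⁻¹ * q⁻¹ * a * (x * q) = p⁻¹ * a * x * (q⁻¹ * q) := by ring
    _ = _ := by rw [ENNReal.inv_mul_cancel hq hq', mul_one]

variable [OpensMeasurableSpace Y] [IsProbabilityMeasure μ] [IsProbabilityMeasure ν]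

theorem map_fst_gridPlan_le (hA : ∀ i, MeasurableSet (A i))
    (hd : Pairwise fun i i' => Disjoint (A i) (A i'))
    (hp : ∀ i, μ (A i) ≠ 0) (hq : ∀ j, ∫⁻ y, φ j y ∂ν ≠ 0)
    (hc : ∀ i, ∑ j, c i j ≤ μ (A i)) : (gridPlan A φ c μ ν).map Prod.fst ≤ μ := by
  refine Measure.le_iff.2 fun E hE => ?_
  rw [← pairing_one _ hE, pairing_gridPlan hE measurable_one]
  calc _ = ∑ i, (∑ j, c i j) / μ (A i) * μ (E ∩ A i) := by
        refine Finset.sum_congr rfl fun i _ => ?_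
        simp only [Pi.one_apply, mul_one]
        simp_rw [ennreal_div_mul_mul_cancel (hp i) (measure_ne_top μ _) (hq _) (lintegral_weight_ne_top _)]
        rw [← Finset.sum_mul, ENNReal.div_eq_inv_mul, Finset.mul_sum]
        simp_rw [ENNReal.div_eq_inv_mul]
    _ ≤ ∑ i, μ (E ∩ A i) := by
        refine Finset.sum_le_sum fun i _ => mul_le_of_le_one_left' ?_
        exact ENNReal.div_le_of_le_mul (by rw [one_mul]; exact hc i)
    _ = μ (⋃ i, E ∩ A i) := by
        rw [measure_iUnion (fun i i' hne => (hd hne).mono Set.inter_subset_right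
          Set.inter_subset_right) (fun i => hE.inter (hA i)), tsum_fintype]
    _ ≤ μ E := measure_mono (Set.iUnion_subset fun i => Set.inter_subset_left)

theorem map_snd_gridPlan_le (hφ : ∀ y, ∑ j, φ j y ≤ 1)
    (hp : ∀ i, μ (A i) ≠ 0) (hq : ∀ j, ∫⁻ y, φ j y ∂ν ≠ 0)
    (hc : ∀ j, ∑ i, c i j ≤ ∫⁻ y, φ j y ∂ν) : (gridPlan A φ c μ ν).map Prod.snd ≤ ν := by
  refine Measure.le_iff.2 fun B hB => ?_
  have hm : ∀ j, Measurable fun y => (φ j y : ℝ≥0∞) := fun j =>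
    (φ j).continuous.measurable.coe_nnreal_ennreal
  rw [← lintegral_indicator_one hB, ← pairing_univ _ (measurable_one.indicator hB),
    pairing_gridPlan MeasurableSet.univ (measurable_one.indicator hB), Finset.sum_comm]
  calc _ = ∑ j, (∑ i, c i j) / (∫⁻ y, φ j y ∂ν) * ∫⁻ y, φ j y * B.indicator 1 y ∂ν := by
        refine Finset.sum_congr rfl fun j _ => ?_
        simp only [Set.univ_inter]
        simp_rw [mul_comm (μ (A _)),
          ennreal_div_mul_mul_cancel (hq j) (lintegral_weight_ne_top _) (hp _) (measure_ne_top μ _)]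
        rw [← Finset.sum_mul, ENNReal.div_eq_inv_mul, Finset.mul_sum]
        simp_rw [ENNReal.div_eq_inv_mul]
    _ ≤ ∑ j, ∫⁻ y, φ j y * B.indicator 1 y ∂ν := by
        refine Finset.sum_le_sum fun j _ => mul_le_of_le_one_left' ?_
        exact ENNReal.div_le_of_le_mul (by rw [one_mul]; exact hc j)
    _ = ∫⁻ y, ∑ j, φ j y * B.indicator 1 y ∂ν :=
        (lintegral_finsetSum _ fun j _ => (hm j).mul (measurable_one.indicator hB)).symm
    _ ≤ ∫⁻ y, B.indicator 1 y ∂ν := by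
        refine lintegral_mono fun y => ?_
        rw [← Finset.sum_mul]
        refine mul_le_of_le_one_left' ?_
        rw [← ENNReal.ofNNReal_finsetSum]
        exact ENNReal.coe_le_one_iff.2 (hφ y)
    _ = _ := by rw [lintegral_indicator_one hB]

theorem gridPlan_univ (hp : ∀ i, μ (A i) ≠ 0) (hq : ∀ j, ∫⁻ y, φ j y ∂ν ≠ 0) :
    gridPlan A φ c μ ν Set.univ = ∑ i, ∑ j, c i j := by
  have h1 := pairing_one (gridPlan A φ c μ ν) MeasurableSet.univ
  rw [Measure.map_apply measurable_fst MeasurableSet.univ, Set.preimage_univ] at h1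
  rw [← h1, pairing_gridPlan MeasurableSet.univ measurable_one]
  refine Finset.sum_congr rfl fun i _ => Finset.sum_congr rfl fun j _ => ?_
  simp only [Pi.one_apply, mul_one, Set.univ_inter]
  rw [ennreal_div_mul_mul_cancel (hp i) (measure_ne_top μ _) (hq j) (lintegral_weight_ne_top _),
    ENNReal.div_mul_cancel (hp i) (measure_ne_top μ _)]

theorem IsGrid.lintegral_gridPlan_le {C : ι → κ → ℝ≥0} {η : ℝ≥0} {H : X → Y → ℝ≥0∞}
    (hG : IsGrid A φ C η H)
    (hp : ∀ i, μ (A i) ≠ 0) (hq : ∀ j, ∫⁻ y, φ j y ∂ν ≠ 0) :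
    ∫⁻ p, H p.1 p.2 ∂(gridPlan A φ c μ ν) ≤ ∑ i, ∑ j, c i j * (C i j + η) := by
  rw [lintegral_gridPlan]
  refine Finset.sum_le_sum fun i _ => Finset.sum_le_sum fun j _ => ?_
  have hm : Measurable fun y => (φ j y : ℝ≥0∞) := (φ j).continuous.measurable.coe_nnreal_ennreal
  calc _ ≤ c i j / (μ (A i) * ∫⁻ y, φ j y ∂ν) * ∫⁻ _, (C i j + η : ℝ≥0∞)
        ∂((μ.restrict (A i)).prod (ν.withDensity fun y => φ j y)) := by
        refine mul_le_mul_right (lintegral_mono_ae ?_) _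
        have e1 : ∀ᵐ p ∂((μ.restrict (A i)).prod (ν.withDensity fun y => φ j y)), p.1 ∈ A i :=
          Measure.quasiMeasurePreserving_fst.ae (ae_restrict_mem (hG.measurableSet i))
        have e2 : ∀ᵐ p ∂((μ.restrict (A i)).prod (ν.withDensity fun y => φ j y)), φ j p.2 ≠ 0 := by
          refine Measure.quasiMeasurePreserving_snd.ae (p := fun y => φ j y ≠ 0) ?_
          rw [ae_withDensity_iff hm]
          exact Eventually.of_forall fun y hy => by simpa using hy
        filter_upwards [e1, e2] with p h1 h2
        exact hG.le_add i j _ h1 _ h2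
    _ = c i j / (μ (A i) * ∫⁻ y, φ j y ∂ν) * ((C i j + η) * μ (A i) * ∫⁻ y, φ j y ∂ν) := by
        rw [lintegral_const, ← Set.univ_prod_univ, Measure.prod_prod,
          Measure.restrict_apply MeasurableSet.univ, Set.univ_inter,
          withDensity_apply _ MeasurableSet.univ, Measure.restrict_univ, mul_assoc]
    _ = _ := by
        rw [ennreal_div_mul_mul_cancel (hp i) (measure_ne_top μ _) (hq j) (lintegral_weight_ne_top _),
          mul_comm (_ + _) (μ (A i)), ← mul_assoc,
          ENNReal.div_mul_cancel (hp i) (measure_ne_top μ _)]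

end GridPlan

section Basic

variable {Ω X Y : Type*} [MeasurableSpace X] [MeasurableSpace Y] [MeasurableSpace Ω]
  {σ : Measure Ω} {ξ : Ω → X} {ζ : Ω → Y} {μ : Measure X} {ν : Measure Y}

theorem couples_prod (μ : Measure X) (ν : Measure Y) [IsProbabilityMeasure μ]
    [IsProbabilityMeasure ν] : Couples (μ.prod ν) Prod.fst Prod.snd μ ν :=
  ⟨measurable_fst, measurable_snd, by simp [Measure.map_fst_prod], by simp [Measure.map_snd_prod]⟩

theorem Couples.isProbabilityMeasure (hσ : Couples σ ξ ζ μ ν) [IsProbabilityMeasure μ] :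
    IsProbabilityMeasure σ := by
  refine ⟨?_⟩
  have : μ Set.univ = 1 := measure_univ
  rwa [← hσ.map_left, Measure.map_apply hσ.measurable_left MeasurableSet.univ] at this

end Basic

section PlanContinuity

variable {X Y T ι κ : Type*} [MeasurableSpace X] [TopologicalSpace Y] [MeasurableSpace Y]
  [OpensMeasurableSpace Y] [Fintype ι] [Fintype κ] [TopologicalSpace T]
  {μ : T → ProbabilityMeasure X} {ν : T → ProbabilityMeasure Y}
  {A : ι → Set X} {φ : κ → Y →ᵇ ℝ≥0} {c : ι → κ → ℝ≥0∞}

theorem tendsto_pairing_gridPlan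
    (hμc : TVContinuousFamily fun t => (μ t : Measure X)) (hνc : Continuous ν)
    (hA : ∀ i, MeasurableSet (A i)) (hc : ∀ i j, c i j ≠ ⊤) {t₀ : T}
    (hp : ∀ i, (μ t₀ : Measure X) (A i) ≠ 0) (hq : ∀ j, ∫⁻ y, φ j y ∂(ν t₀ : Measure Y) ≠ 0)
    {E : Set X} (hE : MeasurableSet E) (F : Y →ᵇ ℝ≥0) :
    Tendsto (fun t => pairing (gridPlan A φ c (μ t) (ν t)) E fun y => F y) (𝓝 t₀)
      (𝓝 (pairing (gridPlan A φ c (μ t₀) (ν t₀)) E fun y => F y)) := by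
  have hF : Measurable fun y => (F y : ℝ≥0∞) := F.continuous.measurable.coe_nnreal_ennreal
  simp_rw [pairing_gridPlan hE hF]
  refine tendsto_finsetSum _ fun i _ => tendsto_finsetSum _ fun j _ => ?_
  have h1 := hμc.tendsto_measure t₀ (hA i)
  have h2 := hμc.tendsto_measure t₀ (hE.inter (hA i))
  have h3 := tendsto_lintegral_of_continuous hνc t₀ (φ j)
  have h4 := tendsto_lintegral_of_continuous hνc t₀ (φ j * F)
  have h5 := lintegral_weight_ne_top (ν := (ν t₀ : Measure Y)) (φ j)
  have h6 := lintegral_weight_ne_top (ν := (ν t₀ : Measure Y)) (φ j * F)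
  have h7 : (μ t₀ : Measure X) (A i) ≠ ⊤ := measure_ne_top _ _
  have h8 : (μ t₀ : Measure X) (E ∩ A i) ≠ ⊤ := measure_ne_top _ _
  simp only [BoundedContinuousFunction.coe_mul, Pi.mul_apply, ENNReal.coe_mul] at h4 h6
  refine ENNReal.Tendsto.mul (ENNReal.Tendsto.const_div
    (ENNReal.Tendsto.mul h1 (Or.inr h5) h3 (Or.inr h7)) (Or.inr (hc i j))) ?_
    (ENNReal.Tendsto.mul h2 (Or.inr h6) h4 (Or.inr h8)) ?_
  · exact Or.inr (ENNReal.mul_ne_top h8 h6)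
  · exact Or.inr (ENNReal.div_ne_top (hc i j) (mul_ne_zero (hp i) (hq j)))

theorem continuousOn_pairing_completePlan
    (hμc : TVContinuousFamily fun t => (μ t : Measure X)) (hνc : Continuous ν)
    (hA : ∀ i, MeasurableSet (A i)) (hd : Pairwise fun i i' => Disjoint (A i) (A i'))
    (hφ : ∀ y, ∑ j, φ j y ≤ 1) {W : Set T}
    (hp : ∀ t ∈ W, ∀ i, (μ t : Measure X) (A i) ≠ 0)
    (hq : ∀ t ∈ W, ∀ j, ∫⁻ y, φ j y ∂(ν t : Measure Y) ≠ 0)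
    (hcp : ∀ t ∈ W, ∀ i, ∑ j, c i j ≤ (μ t : Measure X) (A i))
    (hcq : ∀ t ∈ W, ∀ j, ∑ i, c i j ≤ ∫⁻ y, φ j y ∂(ν t : Measure Y))
    (hlt : ∑ i, ∑ j, c i j < 1)
    {E : Set X} (hE : MeasurableSet E) (F : Y →ᵇ ℝ≥0) :
    ContinuousOn (fun t => pairing (completePlan (μ t : Measure X) (ν t : Measure Y)
      (gridPlan A φ c (μ t) (ν t))) E fun y => F y) W := by
  have hF : Measurable fun y => (F y : ℝ≥0∞) := F.continuous.measurable.coe_nnreal_ennreal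
  have hc : ∀ i j, c i j ≠ ⊤ := by
    intro i j
    refine ne_top_of_le_ne_top ENNReal.one_ne_top (le_trans ?_ hlt.le)
    exact (Finset.single_le_sum_of_canonicallyOrdered (f := c i) (Finset.mem_univ j)).trans
      (Finset.single_le_sum_of_canonicallyOrdered (f := fun i => ∑ j, c i j) (Finset.mem_univ i))
  have hform : ∀ t ∈ W, pairing (completePlan (μ t : Measure X) (ν t : Measure Y)
      (gridPlan A φ c (μ t) (ν t))) E (fun y => F y) =
      pairing (gridPlan A φ c (μ t) (ν t)) E (fun y => F y) + (1 - ∑ i, ∑ j, c i j)⁻¹ *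
      (((μ t : Measure X) E - pairing (gridPlan A φ c (μ t) (ν t)) E
          fun y => ((1 : Y →ᵇ ℝ≥0) y : ℝ≥0∞)) *
        (∫⁻ y, F y ∂(ν t : Measure Y) -
          pairing (gridPlan A φ c (μ t) (ν t)) Set.univ fun y => F y)) := by
    intro t ht
    rw [pairing_completePlan (map_fst_gridPlan_le hA hd (hp t ht) (hq t ht) (hcp t ht))
      (map_snd_gridPlan_le hφ (hp t ht) (hq t ht) (hcq t ht)) hE hF (lintegral_weight_ne_top F),
      gridPlan_univ (hp t ht) (hq t ht)]
    simp only [BoundedContinuousFunction.coe_one, Pi.one_apply, ENNReal.coe_one]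
    rfl
  refine ContinuousOn.congr (fun t ht => ContinuousAt.continuousWithinAt ?_) hform
  have h1 := tendsto_pairing_gridPlan hμc hνc hA hc (hp t ht) (hq t ht) hE F
  have h2 := tendsto_pairing_gridPlan hμc hνc hA hc (hp t ht) (hq t ht) hE (1 : Y →ᵇ ℝ≥0)
  have h3 := tendsto_pairing_gridPlan hμc hνc hA hc (hp t ht) (hq t ht) MeasurableSet.univ F
  have h4 := hμc.tendsto_measure t hE
  have h5 := tendsto_lintegral_of_continuous hνc t F
  have h6 := ENNReal.Tendsto.sub h4 h2 (Or.inl (measure_ne_top _ _))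
  have h7 := ENNReal.Tendsto.sub h5 h3 (Or.inl (lintegral_weight_ne_top F))
  refine h1.add (ENNReal.Tendsto.const_mul (ENNReal.Tendsto.mul h6 (Or.inr ?_) h7 (Or.inr ?_))
    (Or.inr ?_))
  · exact ENNReal.sub_ne_top (lintegral_weight_ne_top F)
  · exact ENNReal.sub_ne_top (measure_ne_top _ _)
  · exact ENNReal.inv_ne_top.2 (tsub_pos_of_lt hlt).ne'

end PlanContinuity

section CellMass

variable {Ω X Y ι κ : Type*} [MeasurableSpace X] [TopologicalSpace Y] [MeasurableSpace Y]
  [OpensMeasurableSpace Y] [Fintype κ] [MeasurableSpace Ω]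
  {A : ι → Set X} {φ : κ → Y →ᵇ ℝ≥0} {C : ι → κ → ℝ≥0} {η : ℝ≥0} {H : X → Y → ℝ≥0∞}
  {σ : Measure Ω} {ξ : Ω → X} {ζ : Ω → Y} {μ : Measure X} {ν : Measure Y}

theorem IsGrid.sum_right_cellMass_le (hG : IsGrid A φ C η H) (hσ : Couples σ ξ ζ μ ν) (i : ι) :
    ∑ j, cellMass A φ σ ξ ζ i j ≤ μ (A i) := by
  have hm : ∀ j, Measurable fun ω => (φ j (ζ ω) : ℝ≥0∞) := fun j =>
    ((φ j).continuous.measurable.comp hσ.measurable_right).coe_nnreal_ennreal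
  simp only [cellMass]
  rw [← lintegral_finsetSum _ fun j _ => hm j, ← hσ.map_left,
    Measure.map_apply hσ.measurable_left (hG.measurableSet i)]
  calc _ ≤ ∫⁻ _ in ξ ⁻¹' A i, 1 ∂σ := lintegral_mono fun ω => hG.sum_weight_le_one _
    _ = _ := by simp

variable [Fintype ι]

theorem IsGrid.sum_left_cellMass_le (hG : IsGrid A φ C η H) (hσ : Couples σ ξ ζ μ ν) (j : κ) :
    ∑ i, cellMass A φ σ ξ ζ i j ≤ ∫⁻ y, φ j y ∂ν := by
  rw [← hσ.map_right, lintegral_map (φ j).continuous.measurable.coe_nnreal_ennreal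
    hσ.measurable_right]
  simp only [cellMass]
  have := lintegral_iUnion (μ := σ) (s := fun i => ξ ⁻¹' A i)
    (fun i => hσ.measurable_left (hG.measurableSet i))
    (fun i i' hne => (hG.disjoint hne).preimage ξ) (fun ω => (φ j (ζ ω) : ℝ≥0∞))
  rw [tsum_fintype] at this
  rw [← this]
  exact setLIntegral_le_lintegral _ _

theorem IsGrid.one_le_sum_cellMass_add (hG : IsGrid A φ C η H) (hσ : Couples σ ξ ζ μ ν)
    [IsProbabilityMeasure σ] {δ : ℝ≥0∞}
    (hA : 1 ≤ ∑ i, μ (A i) + δ) (hφ : 1 ≤ ∑ j, ∫⁻ y, φ j y ∂ν + δ) :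
    1 ≤ ∑ i, ∑ j, cellMass A φ σ ξ ζ i j + (δ + δ) := by
  have hG1 : IsGrid A φ (fun _ _ => 1) 0 (fun _ _ => 1) :=
    ⟨hG.measurableSet, hG.disjoint, hG.sum_le_one, by simp, by simp⟩
  obtain ⟨z, -, -, hz, hle⟩ := hG1.lintegral_le hσ hA hφ
  simp only [lintegral_one, measure_univ, ENNReal.coe_one, one_mul, ENNReal.coe_zero, add_zero,
    mul_one] at hle
  exact hle.trans (add_le_add le_rfl hz)

end CellMass

theorem ennreal_mul_self_mul_le {r p₀ ps pt : ℝ≥0∞} (h1 : r * ps < p₀) (h2 : r * p₀ < pt) :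
    r * r * ps ≤ pt := by
  rw [mul_assoc]
  exact (mul_le_mul_right h1.le r).trans h2.le

theorem eventually_comparable {T : Type*} [TopologicalSpace T] {t₀ : T} {p : T → ℝ≥0∞}
    (hp : Tendsto p (𝓝 t₀) (𝓝 (p t₀))) (h0 : p t₀ ≠ 0) (htop : p t₀ ≠ ⊤) {r : ℝ≥0∞}
    (hr : r < 1) : ∀ᶠ t in 𝓝 t₀, r * p t₀ < p t ∧ r * p t < p t₀ := by
  have hlt : r * p t₀ < p t₀ := by
    calc r * p t₀ < 1 * p t₀ := ENNReal.mul_lt_mul_left h0 htop hr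
      _ = p t₀ := one_mul _
  exact (hp.eventually_const_lt hlt).and
    ((ENNReal.Tendsto.const_mul hp (Or.inr hr.ne_top)).eventually_lt_const hlt)

theorem exists_local_plan {X Y T : Type*} [TopologicalSpace X] [T2Space X] [MetricSpace Y]
    [TopologicalSpace T] [MeasurableSpace X] [BorelSpace X] [MeasurableSpace Y] [BorelSpace Y]
    {μ : T → ProbabilityMeasure X} {ν : T → ProbabilityMeasure Y}
    (hμr : ∀ t, (μ t : Measure X).InnerRegular) (hνr : ∀ t, (ν t : Measure Y).InnerRegular)
    (hμc : TVContinuousFamily fun t => (μ t : Measure X)) (hνc : Continuous ν)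
    {h : X → Y → T → ℝ} (hcont : Continuous fun p : X × Y × T => h p.1 p.2.1 p.2.2)
    (hnonneg : ∀ x y t, 0 ≤ h x y t)
    {a : T → X → ℝ} {b : T → Y → ℝ}
    (hameas : ∀ t, Measurable (a t)) (hbmeas : ∀ t, Measurable (b t))
    (hdom : ∀ t x y, h x y t ≤ a t x + b t y)
    (hUI : ∀ δ > (0 : ℝ), ∃ κ : ℝ, 0 < κ ∧ ∀ t, ∀ α ≤ (μ t : Measure X), ∀ β ≤ (ν t : Measure Y),
      α Set.univ ≤ ENNReal.ofReal κ → β Set.univ ≤ ENNReal.ofReal κ →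
      ∫⁻ x, ENNReal.ofReal (a t x) ∂α + ∫⁻ y, ENNReal.ofReal (b t y) ∂β ≤ ENNReal.ofReal δ)
    {ε : ℝ} (hε : 0 < ε) (t₀ : T) :
    ∃ W ∈ 𝓝 t₀, ∃ σ : T → Measure (X × Y),
      (∀ t ∈ W, Couples (σ t) Prod.fst Prod.snd (μ t : Measure X) (ν t : Measure Y) ∧
        ∫⁻ p, ENNReal.ofReal (h p.1 p.2 t) ∂(σ t) ≤
          kantorovichCost (fun x y => h x y t) (μ t : Measure X) (ν t : Measure Y)
            + ENNReal.ofReal ε) ∧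
      ∀ E, MeasurableSet E → ∀ F : Y →ᵇ ℝ≥0,
        ContinuousOn (fun t => pairing (σ t) E fun y => F y) W := by
  obtain ⟨κ₀, hκ₀, hκ⟩ := hUI (ε / 4) (by positivity)
  set κ₁ := min κ₀ 1 with hκ₁
  have hκ₁0 : 0 < κ₁ := lt_min hκ₀ one_pos
  have hκ₁1 : κ₁ ≤ 1 := min_le_right _ _
  set κ := ENNReal.ofReal (κ₁ / 4) with hκdef
  set r := ENNReal.ofReal (1 - κ₁ / 4) with hrdef
  have hr1 : r < 1 := by
    rw [hrdef, ENNReal.ofReal_lt_one]; linarith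
  set η : ℝ≥0 := (ε / 4).toNNReal with hηdef
  obtain ⟨ι, ι', _, _, A, φ, C, hev, hp0, hq0⟩ := exists_grid hμr hνr hμc hνc hcont hnonneg t₀
    (η := η) (by simpa [hηdef] using hε) (κ := κ) (by simpa [hκdef] using hκ₁0)
  have hA : ∀ i, MeasurableSet (A i) := hev.self_of_nhds.1.measurableSet
  have hd := hev.self_of_nhds.1.disjoint
  have hφ := hev.self_of_nhds.1.sum_le_one
  have hevp := eventually_all.2 fun i => eventually_comparable
    (p := fun t => (μ t : Measure X) (A i)) (hμc.tendsto_measure t₀ (hA i)) (hp0 i)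
    (measure_ne_top _ _) hr1
  have hevq := eventually_all.2 fun j => eventually_comparable
    (p := fun t => ∫⁻ y, φ j y ∂(ν t : Measure Y)) (tendsto_lintegral_of_continuous hνc t₀ (φ j))
    (hq0 j) (lintegral_weight_ne_top _) hr1
  obtain ⟨W, hW, hWP⟩ := (hev.and (hevp.and hevq)).exists_mem
  have ht₀W : t₀ ∈ W := mem_of_mem_nhds hW
  let M : Set (ι → ι' → ℝ≥0∞) := {c | ∃ s ∈ W, (∀ i, ∑ j, c i j ≤ (μ s : Measure X) (A i)) ∧
    (∀ j, ∑ i, c i j ≤ ∫⁻ y, φ j y ∂(ν s : Measure Y)) ∧ 1 ≤ ∑ i, ∑ j, c i j + (κ + κ)}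
  have hmemM : ∀ (Ω : Type _) (_ : MeasurableSpace Ω) (σ : Measure Ω) (ξ : Ω → X) (ζ : Ω → Y),
      ∀ s ∈ W, Couples σ ξ ζ (μ s : Measure X) (ν s : Measure Y) →
      cellMass A φ σ ξ ζ ∈ M := by
    intro Ω _ σ ξ ζ s hs hσ
    have := hσ.isProbabilityMeasure
    obtain ⟨⟨hG, h1, h2⟩, -⟩ := hWP s hs
    exact ⟨s, hs, hG.sum_right_cellMass_le hσ, hG.sum_left_cellMass_le hσ,
      hG.one_le_sum_cellMass_add hσ h1 h2⟩
  have hsum1 : ∀ c ∈ M, ∑ i, ∑ j, c i j ≤ 1 := by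
    rintro c ⟨s, -, h1, -, -⟩
    calc ∑ i, ∑ j, c i j ≤ ∑ i, (μ s : Measure X) (A i) := Finset.sum_le_sum fun i _ => h1 i
      _ = (μ s : Measure X) (⋃ i, A i) := by
          rw [measure_iUnion hd hA, tsum_fintype]
      _ ≤ 1 := prob_le_one
  set v := ⨅ c ∈ M, ∑ i, ∑ j, (C i j : ℝ≥0∞) * c i j with hv
  have hvtop : v ≠ ⊤ := by
    have h1 := hmemM _ _ _ _ _ t₀ ht₀W (couples_prod (μ t₀ : Measure X) (ν t₀ : Measure Y))
    refine ne_top_of_le_ne_top ?_ (iInf₂_le _ h1)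
    refine ENNReal.sum_ne_top.2 fun i _ => ENNReal.sum_ne_top.2 fun j _ =>
      ENNReal.mul_ne_top ENNReal.coe_ne_top ?_
    refine ne_top_of_le_ne_top ENNReal.one_ne_top (le_trans ?_ (hsum1 _ h1))
    exact (Finset.single_le_sum_of_canonicallyOrdered (f := fun j => cellMass A φ _ _ _ i j)
      (Finset.mem_univ j)).trans (Finset.single_le_sum_of_canonicallyOrdered
      (f := fun i => ∑ j, cellMass A φ _ _ _ i j) (Finset.mem_univ i))
  obtain ⟨c, hcM, hcv⟩ : ∃ c ∈ M, ∑ i, ∑ j, (C i j : ℝ≥0∞) * c i j < v + η := by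
    have : v < v + η := ENNReal.lt_add_right hvtop (by simpa [hηdef] using hε)
    simpa only [hv, iInf_lt_iff, exists_prop] using this
  have hc1 := hsum1 c hcM
  obtain ⟨s, hs, hcp, hcq, hcs⟩ := hcM
  let c' : ι → ι' → ℝ≥0∞ := fun i j => r * r * c i j
  have hrow : ∀ t ∈ W, ∀ i, ∑ j, c' i j ≤ (μ t : Measure X) (A i) := by
    intro t ht i
    rw [← Finset.mul_sum]
    exact (mul_le_mul_right (hcp i) _).trans
      (ennreal_mul_self_mul_le ((hWP s hs).2.1 i).2 ((hWP t ht).2.1 i).1)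
  have hcol : ∀ t ∈ W, ∀ j, ∑ i, c' i j ≤ ∫⁻ y, φ j y ∂(ν t : Measure Y) := by
    intro t ht j
    rw [← Finset.mul_sum]
    exact (mul_le_mul_right (hcq j) _).trans
      (ennreal_mul_self_mul_le ((hWP s hs).2.2 j).2 ((hWP t ht).2.2 j).1)
  have hp : ∀ t ∈ W, ∀ i, (μ t : Measure X) (A i) ≠ 0 := fun t ht i =>
    (pos_of_gt ((hWP t ht).2.1 i).1).ne'
  have hq : ∀ t ∈ W, ∀ j, ∫⁻ y, φ j y ∂(ν t : Measure Y) ≠ 0 := fun t ht j =>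
    (pos_of_gt ((hWP t ht).2.2 j).1).ne'
  have hc'sum : ∑ i, ∑ j, c' i j = r * r * ∑ i, ∑ j, c i j := by
    simp only [c', Finset.mul_sum]
  have hlt : ∑ i, ∑ j, c' i j < 1 := by
    rw [hc'sum]
    calc r * r * ∑ i, ∑ j, c i j ≤ r * 1 * 1 := by gcongr
      _ < 1 := by simpa using hr1
  have hmass : 1 - ∑ i, ∑ j, c' i j ≤ ENNReal.ofReal κ₀ := by
    rw [hc'sum, tsub_le_iff_left]
    have e1 : (1 : ℝ≥0∞) ≤ r * r + ENNReal.ofReal (κ₁ / 2) := by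
      rw [hrdef, ← ENNReal.ofReal_mul (by linarith), ← ENNReal.ofReal_add
        (mul_nonneg (by linarith) (by linarith)) (by linarith), ENNReal.one_le_ofReal]
      nlinarith [sq_nonneg κ₁]
    have e2 : r * r ≤ r * r * ∑ i, ∑ j, c i j + (κ + κ) := by
      calc r * r = r * r * 1 := (mul_one _).symm
        _ ≤ r * r * (∑ i, ∑ j, c i j + (κ + κ)) := by gcongr
        _ = r * r * ∑ i, ∑ j, c i j + r * r * (κ + κ) := mul_add _ _ _
        _ ≤ _ := by
            gcongr
            exact mul_le_of_le_one_left' (mul_le_one' hr1.le hr1.le)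
    have e3 : (κ + κ) + ENNReal.ofReal (κ₁ / 2) ≤ ENNReal.ofReal κ₀ := by
      rw [hκdef, ← ENNReal.ofReal_add (by linarith) (by linarith),
        ← ENNReal.ofReal_add (by linarith) (by linarith)]
      exact ENNReal.ofReal_le_ofReal (by linarith [min_le_left κ₀ 1])
    calc (1 : ℝ≥0∞) ≤ r * r * ∑ i, ∑ j, c i j + (κ + κ) + ENNReal.ofReal (κ₁ / 2) :=
          e1.trans (add_le_add e2 le_rfl)
      _ ≤ _ := by rw [add_assoc]; gcongr
  refine ⟨W, hW, fun t => completePlan (μ t : Measure X) (ν t : Measure Y)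
    (gridPlan A φ c' (μ t) (ν t)), fun t ht => ?_, fun E hE F =>
    continuousOn_pairing_completePlan hμc hνc hA hd hφ hp hq hrow hcol hlt hE F⟩
  have hfst := map_fst_gridPlan_le hA hd (hp t ht) (hq t ht) (hrow t ht)
  have hsnd := map_snd_gridPlan_le hφ (hp t ht) (hq t ht) (hcol t ht)
  have huniv := gridPlan_univ (c := c') (hp t ht) (hq t ht)
  have hlt' : gridPlan A φ c' (μ t) (ν t) Set.univ < 1 := by rwa [huniv]
  refine ⟨couples_completePlan hfst hsnd hlt', ?_⟩
  have hvK : v ≤ kantorovichCost (fun x y => h x y t) (μ t : Measure X) (ν t : Measure Y) + η := by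
    rw [kantorovichCost]
    simp only [ENNReal.iInf_add]
    refine le_iInf₂ fun σ hσ => ?_
    have hσ' := hσ.couples
    have := @Couples.isProbabilityMeasure _ _ _ _ _ (borel (X × Y)) _ _ _ _ _ hσ' _
    refine (iInf₂_le _ (hmemM _ (borel (X × Y)) σ _ _ t ht hσ')).trans ?_
    exact @IsGrid.sum_mul_cellMass_le _ _ _ _ _ _ _ _ _ _ _ _ _ _ (borel (X × Y)) _ _ _ _ _ _ _
      (hWP t ht).1.1 hσ' this
  have hfin : IsFiniteMeasure (gridPlan A φ c' (μ t) (ν t)) := isFiniteMeasure_of_map_fst_le hfst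
  calc ∫⁻ p, ENNReal.ofReal (h p.1 p.2 t) ∂(completePlan (μ t : Measure X) (ν t : Measure Y)
        (gridPlan A φ c' (μ t) (ν t)))
      ≤ ∫⁻ p, ENNReal.ofReal (h p.1 p.2 t) ∂(gridPlan A φ c' (μ t) (ν t)) + ENNReal.ofReal (ε / 4) := by
        refine (lintegral_completePlan_le hfst hsnd hlt' (hameas t).ennreal_ofReal
          (hbmeas t).ennreal_ofReal fun p =>
          (ENNReal.ofReal_le_ofReal (hdom t p.1 p.2)).trans ENNReal.ofReal_add_le).trans ?_
        gcongr
        refine hκ t _ Measure.sub_le _ Measure.sub_le ?_ ?_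
        · rwa [sub_map_fst_univ hfst, huniv]
        · rwa [sub_map_snd_univ hfin hsnd, huniv]
    _ ≤ ∑ i, ∑ j, c' i j * (C i j + η) + ENNReal.ofReal (ε / 4) := by
        gcongr
        exact (hWP t ht).1.1.lintegral_gridPlan_le (hp t ht) (hq t ht)
    _ ≤ (∑ i, ∑ j, C i j * c i j + η) + ENNReal.ofReal (ε / 4) := by
        gcongr
        calc ∑ i, ∑ j, c' i j * (C i j + η) ≤ ∑ i, ∑ j, (C i j * c i j + c i j * η) := by
              refine Finset.sum_le_sum fun i _ => Finset.sum_le_sum fun j _ => ?_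
              rw [mul_comm (C i j : ℝ≥0∞), ← mul_add]
              exact mul_le_mul_left (mul_le_of_le_one_left' (mul_le_one' hr1.le hr1.le)) _
          _ = ∑ i, ∑ j, C i j * c i j + (∑ i, ∑ j, c i j) * η := by
              simp_rw [Finset.sum_add_distrib, Finset.sum_mul]
          _ ≤ _ := by
              gcongr
              exact mul_le_of_le_one_left' hc1
    _ ≤ (kantorovichCost (fun x y => h x y t) (μ t : Measure X) (ν t : Measure Y) + η + η + η)
          + ENNReal.ofReal (ε / 4) := by
        gcongr
        exact hcv.le.trans (add_le_add hvK le_rfl)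
    _ = _ := by
        have : (η : ℝ≥0∞) = ENNReal.ofReal (ε / 4) := rfl
        rw [this, add_assoc, add_assoc, add_assoc, ← ENNReal.ofReal_add (by linarith) (by linarith),
          ← ENNReal.ofReal_add (by linarith) (by linarith),
          ← ENNReal.ofReal_add (by linarith) (by linarith)]
        congr 2
        ring

theorem pairing_ne_top {X Y : Type*} [MeasurableSpace X] [TopologicalSpace Y] [MeasurableSpace Y]
    [OpensMeasurableSpace Y] {σ : Measure (X × Y)} {μ : Measure X} {ν : Measure Y}
    [IsFiniteMeasure ν] (hσ : Couples σ Prod.fst Prod.snd μ ν) {E : Set X} (hE : MeasurableSet E)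
    (F : Y →ᵇ ℝ≥0) : pairing σ E (fun y => F y) ≠ ⊤ := by
  have hF : Measurable fun y => (F y : ℝ≥0∞) := F.continuous.measurable.coe_nnreal_ennreal
  refine ne_top_of_le_ne_top (BoundedContinuousFunction.lintegral_lt_top_of_nnreal ν F).ne ?_
  rw [← hσ.map_right, ← pairing_univ σ hF, pairing_eq_setLIntegral σ hE,
    pairing_eq_setLIntegral σ MeasurableSet.univ]
  exact lintegral_mono_set (by simp)

/-- Almost optimal plans can be selected continuously in the parameter. -/
theorem exists_continuous_plan {X Y T : Type*} [TopologicalSpace X] [T2Space X] [MetricSpace Y]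
    [MetricSpace T] [MeasurableSpace X] [BorelSpace X] [MeasurableSpace Y] [BorelSpace Y]
    {μ : T → ProbabilityMeasure X} {ν : T → ProbabilityMeasure Y}
    (hμr : ∀ t, (μ t : Measure X).InnerRegular) (hνr : ∀ t, (ν t : Measure Y).InnerRegular)
    (hμc : TVContinuousFamily fun t => (μ t : Measure X)) (hνc : Continuous ν)
    {h : X → Y → T → ℝ} (hcont : Continuous fun p : X × Y × T => h p.1 p.2.1 p.2.2)
    (hnonneg : ∀ x y t, 0 ≤ h x y t)
    {a : T → X → ℝ} {b : T → Y → ℝ}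
    (hameas : ∀ t, Measurable (a t)) (hbmeas : ∀ t, Measurable (b t))
    (hdom : ∀ t x y, h x y t ≤ a t x + b t y)
    (hUI : ∀ δ > (0 : ℝ), ∃ κ : ℝ, 0 < κ ∧ ∀ t, ∀ α ≤ (μ t : Measure X), ∀ β ≤ (ν t : Measure Y),
      α Set.univ ≤ ENNReal.ofReal κ → β Set.univ ≤ ENNReal.ofReal κ →
      ∫⁻ x, ENNReal.ofReal (a t x) ∂α + ∫⁻ y, ENNReal.ofReal (b t y) ∂β ≤ ENNReal.ofReal δ)
    {ε : ℝ} (hε : 0 < ε) :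
    ∃ σ : T → Measure (X × Y),
      (∀ t, Couples (σ t) Prod.fst Prod.snd (μ t : Measure X) (ν t : Measure Y) ∧
        ∫⁻ p, ENNReal.ofReal (h p.1 p.2 t) ∂(σ t) ≤
          kantorovichCost (fun x y => h x y t) (μ t : Measure X) (ν t : Measure Y)
            + ENNReal.ofReal ε) ∧
      ∀ E, MeasurableSet E → ∀ F : Y →ᵇ ℝ≥0,
        Continuous (fun t => pairing (σ t) E fun y => F y) := by
  let V := {E : Set X // MeasurableSet E} × (Y →ᵇ ℝ≥0) → ℝ
  let S : T → Set V := fun t => {g | ∃ σ : Measure (X × Y),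
    (Couples σ Prod.fst Prod.snd (μ t : Measure X) (ν t : Measure Y) ∧
      ∫⁻ p, ENNReal.ofReal (h p.1 p.2 t) ∂σ ≤
        kantorovichCost (fun x y => h x y t) (μ t : Measure X) (ν t : Measure Y)
          + ENNReal.ofReal ε) ∧
    ∀ e, g e = (pairing σ e.1.1 fun y => e.2 y).toReal}
  have hconv : ∀ t, Convex ℝ (S t) := by
    rintro t g₁ ⟨σ₁, ⟨hσ₁, hcost₁⟩, hg₁⟩ g₂ ⟨σ₂, ⟨hσ₂, hcost₂⟩, hg₂⟩ r s hr hs hrs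
    have hrs' : ENNReal.ofReal r + ENNReal.ofReal s = 1 := by
      rw [← ENNReal.ofReal_add hr hs, hrs, ENNReal.ofReal_one]
    refine ⟨ENNReal.ofReal r • σ₁ + ENNReal.ofReal s • σ₂,
      ⟨⟨measurable_fst, measurable_snd, ?_, ?_⟩, ?_⟩, fun e => ?_⟩
    · rw [Measure.map_add _ _ measurable_fst, Measure.map_smul, Measure.map_smul, hσ₁.map_left,
        hσ₂.map_left, ← add_smul, hrs', one_smul]
    · rw [Measure.map_add _ _ measurable_snd, Measure.map_smul, Measure.map_smul, hσ₁.map_right,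
        hσ₂.map_right, ← add_smul, hrs', one_smul]
    · rw [lintegral_add_measure, lintegral_smul_measure, lintegral_smul_measure, smul_eq_mul,
        smul_eq_mul]
      calc _ ≤ ENNReal.ofReal r * (kantorovichCost (fun x y => h x y t) (μ t : Measure X)
            (ν t : Measure Y) + ENNReal.ofReal ε) + ENNReal.ofReal s *
            (kantorovichCost (fun x y => h x y t) (μ t : Measure X)
            (ν t : Measure Y) + ENNReal.ofReal ε) := by gcongr
        _ = _ := by rw [← add_mul, hrs', one_mul]
    · rw [pairing_add, pairing_smul, pairing_smul, ENNReal.toReal_add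
        (ENNReal.mul_ne_top ENNReal.ofReal_ne_top (pairing_ne_top hσ₁ e.1.2 e.2))
        (ENNReal.mul_ne_top ENNReal.ofReal_ne_top (pairing_ne_top hσ₂ e.1.2 e.2)),
        ENNReal.toReal_mul, ENNReal.toReal_mul, ENNReal.toReal_ofReal hr, ENNReal.toReal_ofReal hs,
        ← hg₁, ← hg₂]
      rfl
  obtain ⟨g, hg⟩ := exists_continuous_forall_mem_convex_of_local hconv (fun t₀ => by
    obtain ⟨W, hW, σ, hσ, hσc⟩ := exists_local_plan hμr hνr hμc hνc hcont hnonneg hameas hbmeas hdom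
      hUI hε t₀
    refine ⟨W, hW, fun t e => (pairing (σ t) e.1.1 fun y => e.2 y).toReal, ?_,
      fun t ht => ⟨σ t, hσ t ht, fun e => rfl⟩⟩
    refine continuousOn_pi.2 fun e t ht => ?_
    exact (ENNReal.tendsto_toReal (pairing_ne_top (hσ t ht).1 e.1.2 e.2)).comp
      (hσc e.1.1 e.1.2 e.2 t ht))
  choose σ hσ hσg using hg
  refine ⟨σ, hσ, fun E hE F => ?_⟩
  have h1 : Continuous fun t => g t (⟨E, hE⟩, F) := (continuous_apply _).comp g.continuous
  have h2 : (fun t => pairing (σ t) E fun y => F y) = fun t => ENNReal.ofReal (g t (⟨E, hE⟩, F)) := by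
    funext t
    rw [hσg, ENNReal.ofReal_toReal (pairing_ne_top (hσ t).1 hE F)]
  rw [h2]
  exact ENNReal.continuous_ofReal.comp h1

/-- Membership in `A` depends only on the first `m` coordinates of the code. -/
def IsLevel {X : Type*} (e : X → ℕ → Bool) (m : ℕ) (A : Set X) : Prop :=
  ∀ x x', (∀ i < m, e x i = e x' i) → (x ∈ A ↔ x' ∈ A)

theorem IsLevel.mono {X : Type*} {e : X → ℕ → Bool} {m n : ℕ} {A : Set X} (h : IsLevel e m A)
    (hmn : m ≤ n) : IsLevel e n A := fun x x' hx => h x x' fun i hi => hx i (hi.trans_le hmn)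

theorem exists_isLevel_approx {X : Type*} [MeasurableSpace X] {e : X → ℕ → Bool}
    (he : Measurable e) (hgen : ∀ A : Set X, MeasurableSet A → ∃ B, MeasurableSet B ∧ e ⁻¹' B = A)
    (μ : Measure X) [IsFiniteMeasure μ] {A : Set X} (hA : MeasurableSet A) {δ : ℝ} (hδ : 0 < δ) :
    ∃ (m : ℕ) (A' : Set X), MeasurableSet A' ∧ IsLevel e m A' ∧
      μ (A \ A') < ENNReal.ofReal δ ∧ μ (A' \ A) < ENNReal.ofReal δ := by
  obtain ⟨B, hB, rfl⟩ := hgen A hA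
  have : IsFiniteMeasure (μ.map e) := Measure.isFiniteMeasure_map _ _
  obtain ⟨C, hC, hlt⟩ := (Measure.MeasureDense.of_generateFrom_isSetAlgebra_finite (μ.map e)
    (isSetAlgebra_measurableCylinders (α := fun _ : ℕ => Bool))
    (generateFrom_measurableCylinders (α := fun _ : ℕ => Bool)).symm).approx B hB
    (measure_ne_top _ _) δ hδ
  have hCm : MeasurableSet C := .of_mem_measurableCylinders hC
  obtain ⟨s, Q, -, rfl⟩ := (mem_measurableCylinders C).1 hC
  rw [Measure.map_apply he (hB.symmDiff hCm)] at hlt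
  refine ⟨s.sup id + 1, e ⁻¹' cylinder s Q, he hCm, ?_,
    (measure_mono ?_).trans_lt hlt, (measure_mono ?_).trans_lt hlt⟩
  · intro x x' hx
    simp only [Set.mem_preimage, mem_cylinder]
    have : s.restrict (e x) = s.restrict (e x') := by
      funext i
      exact hx i (Nat.lt_succ_of_le (Finset.le_sup (f := id) i.2))
    rw [this]
  · exact fun x hx => Or.inl hx
  · exact fun x hx => Or.inr hx

theorem lintegral_mul_le_of_uniformIntegrable {Ω X Y : Type*} [MeasurableSpace Ω]
    [MeasurableSpace X] [MeasurableSpace Y] {σ : Measure Ω} {ξ : Ω → X} {ζ : Ω → Y}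
    {μ : Measure X} {ν : Measure Y} (hσ : Couples σ ξ ζ μ ν) {a : X → ℝ≥0∞} {b : Y → ℝ≥0∞}
    (ha : Measurable a) (hb : Measurable b) {δ κ : ℝ≥0∞}
    (hUI : ∀ α ≤ μ, ∀ β ≤ ν, α Set.univ ≤ κ → β Set.univ ≤ κ →
      ∫⁻ x, a x ∂α + ∫⁻ y, b y ∂β ≤ δ)
    {H : Ω → ℝ≥0∞} (hH : ∀ ω, H ω ≤ a (ξ ω) + b (ζ ω)) {z : Ω → ℝ≥0∞} (hz : Measurable z)
    (hz1 : ∀ ω, z ω ≤ 1) (hzκ : ∫⁻ ω, z ω ∂σ ≤ κ) : ∫⁻ ω, z ω * H ω ∂σ ≤ δ := by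
  have hξ := hσ.measurable_left
  have hζ := hσ.measurable_right
  have hle : σ.withDensity z ≤ σ := by
    conv_rhs => rw [← withDensity_one (μ := σ)]
    exact withDensity_mono (Eventually.of_forall hz1)
  have hmass : σ.withDensity z Set.univ ≤ κ := by
    rwa [withDensity_apply _ MeasurableSet.univ, Measure.restrict_univ]
  have key := hUI ((σ.withDensity z).map ξ) (hσ.map_left ▸ Measure.map_mono hle hξ)
    ((σ.withDensity z).map ζ) (hσ.map_right ▸ Measure.map_mono hle hζ)
    (by rwa [Measure.map_apply hξ MeasurableSet.univ])
    (by rwa [Measure.map_apply hζ MeasurableSet.univ])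
  have haξ : Measurable fun ω => a (ξ ω) := ha.comp hξ
  have hbζ : Measurable fun ω => b (ζ ω) := hb.comp hζ
  have hab : Measurable fun ω => a (ξ ω) + b (ζ ω) := haξ.add hbζ
  rw [lintegral_map ha hξ, lintegral_map hb hζ, ← lintegral_add_left haξ,
    lintegral_withDensity_eq_lintegral_mul _ hz hab] at key
  refine le_trans (lintegral_mono fun ω => ?_) key
  exact mul_le_mul_right (hH ω) _

/-- A coupling that agrees with a plan on sets determined by sufficiently many coordinates has
almost the same cost, locally uniformly in the parameter. -/
theorem exists_level_forall_cost_le {X Y T : Type*} [TopologicalSpace X] [T2Space X] [MetricSpace Y]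
    [TopologicalSpace T] [MeasurableSpace X] [BorelSpace X] [MeasurableSpace Y] [BorelSpace Y]
    {μ : T → ProbabilityMeasure X} {ν : T → ProbabilityMeasure Y}
    (hμr : ∀ t, (μ t : Measure X).InnerRegular) (hνr : ∀ t, (ν t : Measure Y).InnerRegular)
    (hμc : TVContinuousFamily fun t => (μ t : Measure X)) (hνc : Continuous ν)
    {h : X → Y → T → ℝ} (hcont : Continuous fun p : X × Y × T => h p.1 p.2.1 p.2.2)
    (hnonneg : ∀ x y t, 0 ≤ h x y t)
    {a : T → X → ℝ} {b : T → Y → ℝ}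
    (hameas : ∀ t, Measurable (a t)) (hbmeas : ∀ t, Measurable (b t))
    (hdom : ∀ t x y, h x y t ≤ a t x + b t y)
    (hUI : ∀ δ > (0 : ℝ), ∃ κ : ℝ, 0 < κ ∧ ∀ t, ∀ α ≤ (μ t : Measure X), ∀ β ≤ (ν t : Measure Y),
      α Set.univ ≤ ENNReal.ofReal κ → β Set.univ ≤ ENNReal.ofReal κ →
      ∫⁻ x, ENNReal.ofReal (a t x) ∂α + ∫⁻ y, ENNReal.ofReal (b t y) ∂β ≤ ENNReal.ofReal δ)
    {e : X → ℕ → Bool} (he : Measurable e)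
    (hgen : ∀ A : Set X, MeasurableSet A → ∃ B, MeasurableSet B ∧ e ⁻¹' B = A)
    {ε : ℝ} (hε : 0 < ε) (t₀ : T) :
    ∃ m₀ : ℕ, ∀ᶠ t in 𝓝 t₀, ∀ m ≥ m₀, ∀ σ : Measure (X × Y),
      Couples σ Prod.fst Prod.snd (μ t : Measure X) (ν t : Measure Y) → ∀ S : X → Y,
      Couples (μ t : Measure X) id S (μ t : Measure X) (ν t : Measure Y) →
      (∀ A, MeasurableSet A → IsLevel e m A → ∀ B, MeasurableSet B →
        (μ t : Measure X) (A ∩ S ⁻¹' B) = σ (A ×ˢ B)) →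
      ∫⁻ x, ENNReal.ofReal (h x (S x) t) ∂(μ t : Measure X) ≤
        ∫⁻ p, ENNReal.ofReal (h p.1 p.2 t) ∂σ + ENNReal.ofReal ε := by
  obtain ⟨κ₀, hκ₀, hκ⟩ := hUI (ε / 4) (by positivity)
  set η : ℝ≥0 := (ε / 4).toNNReal with hηdef
  obtain ⟨ι, ι', _, _, A, φ, C, hev, -, -⟩ := exists_grid hμr hνr hμc hνc hcont hnonneg t₀
    (η := η) (by simpa [hηdef] using hε) (κ := ENNReal.ofReal (κ₀ / 2)) (by simpa using hκ₀)
  have hA : ∀ i, MeasurableSet (A i) := hev.self_of_nhds.1.measurableSet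
  set Csum : ℝ≥0 := ∑ i, ∑ j, C i j with hCsum
  set δ : ℝ := ε / (8 * (Csum + 1)) with hδdef
  have hδ : 0 < δ := by positivity
  choose m A' hA'm hA'l hAA' hA'A using fun i =>
    exists_isLevel_approx he hgen (μ t₀ : Measure X) (hA i) hδ
  refine ⟨Finset.univ.sup m, ?_⟩
  have ev1 := eventually_all.2 fun i =>
    (hμc.tendsto_measure t₀ ((hA i).diff (hA'm i))).eventually_lt_const (hAA' i)
  have ev2 := eventually_all.2 fun i =>
    (hμc.tendsto_measure t₀ ((hA'm i).diff (hA i))).eventually_lt_const (hA'A i)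
  filter_upwards [hev, ev1, ev2] with t ht h1 h2 n hn σ hσ S hS hagree
  obtain ⟨hG, hsA, hsφ⟩ := ht
  have hprob := hσ.isProbabilityMeasure
  have hcell : ∀ i j, cellMass A φ (μ t : Measure X) id S i j ≤
      cellMass A φ σ Prod.fst Prod.snd i j + (ENNReal.ofReal δ + ENNReal.ofReal δ) := by
    intro i j
    have hφ1 : ∀ y, (φ j y : ℝ≥0∞) ≤ 1 := fun y =>
      (Finset.single_le_sum_of_canonicallyOrdered (f := fun j => (φ j y : ℝ≥0∞))
        (Finset.mem_univ j)).trans (hG.sum_weight_le_one y)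
    have hφm : Measurable fun y => (φ j y : ℝ≥0∞) := (φ j).continuous.measurable.coe_nnreal_ennreal
    have hmap : ((μ t : Measure X).restrict (A' i)).map S =
        (σ.restrict (Prod.fst ⁻¹' A' i)).map Prod.snd := by
      ext B hB
      rw [Measure.map_apply hS.measurable_right hB, Measure.map_apply measurable_snd hB,
        Measure.restrict_apply (hS.measurable_right hB), Measure.restrict_apply (measurable_snd hB),
        Set.inter_comm, hagree (A' i) (hA'm i)
          ((hA'l i).mono ((Finset.le_sup (Finset.mem_univ i)).trans hn)) B hB]
      congr 1
      ext p
      exact and_comm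
    have hmid : ∫⁻ x in A' i, (φ j (S x) : ℝ≥0∞) ∂(μ t : Measure X) =
        ∫⁻ p in Prod.fst ⁻¹' A' i, (φ j p.2 : ℝ≥0∞) ∂σ := by
      rw [← lintegral_map hφm hS.measurable_right, hmap, lintegral_map hφm measurable_snd]
    calc cellMass A φ (μ t : Measure X) id S i j
        ≤ ∫⁻ x in A' i ∪ A i \ A' i, (φ j (S x) : ℝ≥0∞) ∂(μ t : Measure X) := by
          refine lintegral_mono_set ?_
          intro x hx
          by_cases hx' : x ∈ A' i
          · exact Or.inl hx'
          · exact Or.inr ⟨hx, hx'⟩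
      _ ≤ ∫⁻ x in A' i, (φ j (S x) : ℝ≥0∞) ∂(μ t : Measure X) +
          ∫⁻ x in A i \ A' i, (φ j (S x) : ℝ≥0∞) ∂(μ t : Measure X) := lintegral_union_le _ _ _
      _ ≤ ∫⁻ p in Prod.fst ⁻¹' A' i, (φ j p.2 : ℝ≥0∞) ∂σ + ENNReal.ofReal δ := by
          rw [hmid]
          gcongr
          calc _ ≤ ∫⁻ _ in A i \ A' i, 1 ∂(μ t : Measure X) := lintegral_mono fun x => hφ1 _
            _ = (μ t : Measure X) (A i \ A' i) := by simp
            _ ≤ _ := (h1 i).le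
      _ ≤ (cellMass A φ σ Prod.fst Prod.snd i j + ENNReal.ofReal δ) + ENNReal.ofReal δ := by
          gcongr
          calc _ ≤ ∫⁻ p in Prod.fst ⁻¹' A i ∪ Prod.fst ⁻¹' (A' i \ A i), (φ j p.2 : ℝ≥0∞) ∂σ := by
                refine lintegral_mono_set fun p hp => ?_
                by_cases hp' : p.1 ∈ A i
                · exact Or.inl hp'
                · exact Or.inr ⟨hp, hp'⟩
            _ ≤ _ := lintegral_union_le _ _ _
            _ ≤ _ := by
                rw [cellMass]
                gcongr
                calc _ ≤ ∫⁻ _ in Prod.fst ⁻¹' (A' i \ A i), 1 ∂σ := lintegral_mono fun p => hφ1 _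
                  _ = (μ t : Measure X) (A' i \ A i) := by
                      rw [← hσ.map_left, Measure.map_apply measurable_fst ((hA'm i).diff (hA i))]
                      simp
                  _ ≤ _ := (h2 i).le
      _ = _ := add_assoc _ _ _
  obtain ⟨z, hz, hz1, hzκ, hle⟩ := hG.lintegral_le hS hsA hsφ
  have hκκ : ENNReal.ofReal (κ₀ / 2) + ENNReal.ofReal (κ₀ / 2) = ENNReal.ofReal κ₀ := by
    rw [← ENNReal.ofReal_add (by positivity) (by positivity)]
    congr 1
    ring
  have htail := lintegral_mul_le_of_uniformIntegrable hS (hameas t).ennreal_ofReal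
    (hbmeas t).ennreal_ofReal (hκ t) (H := fun x => ENNReal.ofReal (h x (S x) t))
    (fun x => (ENNReal.ofReal_le_ofReal (hdom t x (S x))).trans ENNReal.ofReal_add_le) hz hz1
    (hκκ ▸ hzκ)
  calc ∫⁻ x, ENNReal.ofReal (h x (S x) t) ∂(μ t : Measure X)
      ≤ ∑ i, ∑ j, C i j * cellMass A φ (μ t : Measure X) id S i j + η + ENNReal.ofReal (ε / 4) :=
        hle.trans (add_le_add le_rfl htail)
    _ ≤ ∑ i, ∑ j, C i j * (cellMass A φ σ Prod.fst Prod.snd i j +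
          (ENNReal.ofReal δ + ENNReal.ofReal δ)) + η + ENNReal.ofReal (ε / 4) := by
        gcongr
        exact hcell _ _
    _ = ∑ i, ∑ j, C i j * cellMass A φ σ Prod.fst Prod.snd i j +
          Csum * (ENNReal.ofReal δ + ENNReal.ofReal δ) + η + ENNReal.ofReal (ε / 4) := by
        rw [hCsum]
        simp_rw [mul_add _ (cellMass _ _ _ _ _ _ _), Finset.sum_add_distrib, ← Finset.sum_mul]
        push_cast
        rfl
    _ ≤ ∫⁻ p, ENNReal.ofReal (h p.1 p.2 t) ∂σ + η + ENNReal.ofReal (ε / 4) + η +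
          ENNReal.ofReal (ε / 4) := by
        gcongr
        · exact hG.sum_mul_cellMass_le hσ
        · rw [← ENNReal.ofReal_coe_nnreal, ← ENNReal.ofReal_add hδ.le hδ.le,
            ← ENNReal.ofReal_mul (by positivity)]
          refine ENNReal.ofReal_le_ofReal ?_
          rw [hδdef, mul_add, ← mul_div_assoc, ← add_div, div_le_iff₀ (by positivity)]
          have : (0 : ℝ) ≤ Csum := Csum.2
          nlinarith
    _ = _ := by
        have : (η : ℝ≥0∞) = ENNReal.ofReal (ε / 4) := rfl
        rw [this, add_assoc, add_assoc, add_assoc, ← ENNReal.ofReal_add (by linarith) (by linarith),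
          ← ENNReal.ofReal_add (by linarith) (by linarith),
          ← ENNReal.ofReal_add (by linarith) (by linarith)]
        congr 2
        ring

theorem exists_countable_measure_compl_closure_eq_zero {Y : Type*} [MetricSpace Y]
    [MeasurableSpace Y] [BorelSpace Y] (ν : Measure Y) [IsProbabilityMeasure ν] [ν.InnerRegular] :
    ∃ D : Set Y, D.Countable ∧ ν (closure D)ᶜ = 0 := by
  have h1 : ∀ n : ℕ, ∃ K, IsCompact K ∧ 1 < ν K + (n + 1 : ℝ≥0∞)⁻¹ := fun n =>
    exists_isCompact_lt_measure_add ν (by simp)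
  choose K hK hKlt using h1
  obtain ⟨D, hD, hKD⟩ : TopologicalSpace.IsSeparable (⋃ n, K n) :=
    TopologicalSpace.IsSeparable.iUnion fun n => (hK n).isSeparable
  refine ⟨D, hD, ?_⟩
  rw [prob_compl_eq_zero_iff isClosed_closure.measurableSet]
  refine le_antisymm prob_le_one ?_
  have hlim : Tendsto (fun n : ℕ => ν (closure D) + (n + 1 : ℝ≥0∞)⁻¹) atTop
      (𝓝 (ν (closure D) + 0)) := by
    refine Tendsto.const_add _ ?_
    have := (tendsto_add_atTop_iff_nat 1).2 ENNReal.tendsto_inv_nat_nhds_zero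
    simpa using this
  rw [add_zero] at hlim
  refine ge_of_tendsto hlim (Eventually.of_forall fun n => (hKlt n).le.trans ?_)
  gcongr
  exact (Set.subset_iUnion K n).trans hKD

theorem ennreal_tendsto_of_le_add {α : Type*} {l : Filter α} {u v d : α → ℝ≥0∞} {b : ℝ≥0∞}
    (hb : b ≠ ⊤) (h1 : ∀ n, u n ≤ v n + d n) (h2 : ∀ n, v n ≤ u n + d n)
    (hv : Tendsto v l (𝓝 b)) (hd : Tendsto d l (𝓝 0)) : Tendsto u l (𝓝 b) := by
  have e1 : Tendsto (fun n => v n + d n) l (𝓝 b) := by simpa using hv.add hd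
  have e2 : Tendsto (fun n => v n - d n) l (𝓝 b) := by
    simpa using ENNReal.Tendsto.sub hv hd (Or.inl hb)
  exact tendsto_of_tendsto_of_tendsto_of_le_of_le e2 e1 (fun n => tsub_le_iff_right.2 (h2 n)) h1

theorem eventually_natCeil_eq {α : Type*} {l : Filter α} {u : α → ℝ} {r : ℝ}
    (hr : ∀ k : ℕ, r ≠ k) (hu : Tendsto u l (𝓝 r)) : ∀ᶠ n in l, ⌈u n⌉₊ = ⌈r⌉₊ := by
  have h1 : r < ⌈r⌉₊ := lt_of_le_of_ne (Nat.le_ceil r) (hr _)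
  rcases Nat.eq_zero_or_pos ⌈r⌉₊ with h0 | h0
  · rw [h0] at h1 ⊢
    filter_upwards [hu.eventually_lt_const h1] with n hn
    rw [Nat.ceil_eq_zero]
    simpa using hn.le
  · have h2 : ((⌈r⌉₊ - 1 : ℕ) : ℝ) < r := Nat.lt_ceil.1 (Nat.sub_lt h0 one_pos)
    filter_upwards [hu.eventually_lt_const h1, hu.eventually_const_lt h2] with n hn1 hn2
    exact (Nat.ceil_eq_iff h0.ne').2 ⟨hn2, hn1.le⟩

section Cells

variable {X Y C : Type*} [MeasurableSpace X] [MeasurableSpace Y] [Countable C]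

theorem measurable_of_countable_cells {l : X → C} (hl : ∀ c, MeasurableSet (l ⁻¹' {c}))
    {f : C → X → Y} (hf : ∀ c, Measurable (f c)) : Measurable fun x => f (l x) x := by
  intro B hB
  have : (fun x => f (l x) x) ⁻¹' B = ⋃ c, l ⁻¹' {c} ∩ f c ⁻¹' B := by
    ext x; simp
  rw [this]
  exact MeasurableSet.iUnion fun c => (hl c).inter (hf c hB)

theorem measure_inter_preimage_eq_of_cells {μ : Measure X} {σ : Measure (X × Y)} {l : X → C}
    (hl : ∀ c, MeasurableSet (l ⁻¹' {c})) {S : X → Y} (hS : Measurable S)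
    (hcell : ∀ c B, MeasurableSet B → μ (l ⁻¹' {c} ∩ S ⁻¹' B) = σ ((l ⁻¹' {c}) ×ˢ B))
    {A : Set X} (hA : ∀ x x', l x = l x' → (x ∈ A ↔ x' ∈ A)) {B : Set Y} (hB : MeasurableSet B) :
    μ (A ∩ S ⁻¹' B) = σ (A ×ˢ B) := by
  classical
  let Q : Set C := l '' A
  have hAQ : A = ⋃ c : Q, l ⁻¹' {(c : C)} := by
    ext x
    simp only [Set.mem_iUnion, Set.mem_preimage, Set.mem_singleton_iff]
    constructor
    · exact fun hx => ⟨⟨l x, x, hx, rfl⟩, rfl⟩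
    · rintro ⟨⟨c, x', hx', rfl⟩, hx⟩
      exact (hA x x' hx).2 hx'
  have hdisj : Pairwise fun c c' : Q => Disjoint (l ⁻¹' {(c : C)}) (l ⁻¹' {(c' : C)}) :=
    fun c c' hne => Disjoint.preimage l (by simpa using fun h => hne (Subtype.ext h))
  rw [hAQ, Set.iUnion_inter, Set.iUnion_prod_const,
    measure_iUnion (fun c c' hne => (hdisj hne).mono Set.inter_subset_left Set.inter_subset_left)
      (fun c => (hl c).inter (hS hB)),
    measure_iUnion (fun c c' hne => Set.disjoint_prod.2 (Or.inl (hdisj hne)))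
      (fun c => (hl c).prod hB)]
  exact tsum_congr fun c => hcell c B hB

end Cells

theorem pairing_le_add {X Y : Type*} [MeasurableSpace X] [MeasurableSpace Y]
    {σ : Measure (X × Y)} {E E' : Set X} (hE : MeasurableSet E) (hE' : MeasurableSet E')
    {F : Y → ℝ≥0∞} {M : ℝ≥0∞} (hM : ∀ y, F y ≤ M) :
    pairing σ E F ≤ pairing σ E' F + M * σ.map Prod.fst (symmDiff E E') := by
  have hD : MeasurableSet (symmDiff E E') := hE.symmDiff hE'
  rw [pairing_eq_setLIntegral σ hE, pairing_eq_setLIntegral σ hE',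
    Measure.map_apply measurable_fst hD]
  calc _ ≤ ∫⁻ p in Prod.fst ⁻¹' E' ∪ Prod.fst ⁻¹' symmDiff E E', F p.2 ∂σ := by
        refine lintegral_mono_set fun p hp => ?_
        by_cases hp' : p.1 ∈ E'
        · exact Or.inl hp'
        · exact Or.inr (Or.inl ⟨hp, hp'⟩)
    _ ≤ _ := lintegral_union_le _ _ _
    _ ≤ _ := by
        gcongr
        calc _ ≤ ∫⁻ _ in Prod.fst ⁻¹' symmDiff E E', M ∂σ := lintegral_mono fun p => hM _
          _ = _ := by simp

theorem measure_inter_le_add {X : Type*} [MeasurableSpace X] {μ : Measure X} (E E' G : Set X) :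
    μ (E ∩ G) ≤ μ (E' ∩ G) + μ (symmDiff E E') := by
  refine (measure_mono ?_).trans (measure_union_le _ _)
  intro x hx
  by_cases hmem : x ∈ E'
  · exact Or.inl ⟨hmem, hx.2⟩
  · exact Or.inr (Or.inl ⟨hx.1, hmem⟩)

/-- The part of a plan that starts in `E`, projected to the target. -/
noncomputable def planPart {X Y : Type*} [MeasurableSpace X] [MeasurableSpace Y]
    (σ : Measure (X × Y)) [IsFiniteMeasure σ] (E : Set X) : FiniteMeasure Y :=
  ⟨(σ.restrict (Prod.fst ⁻¹' E)).map Prod.snd, Measure.isFiniteMeasure_map _ _⟩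

theorem lintegral_planPart {X Y : Type*} [MeasurableSpace X] [MeasurableSpace Y]
    (σ : Measure (X × Y)) [IsFiniteMeasure σ] {E : Set X} (hE : MeasurableSet E)
    {F : Y → ℝ≥0∞} (hF : Measurable F) :
    ∫⁻ y, F y ∂(planPart σ E : Measure Y) = pairing σ E F := by
  rw [pairing_eq_setLIntegral σ hE]
  exact lintegral_map hF measurable_snd

theorem planPart_apply {X Y : Type*} [MeasurableSpace X] [MeasurableSpace Y]
    (σ : Measure (X × Y)) [IsFiniteMeasure σ] (E : Set X)
    {B : Set Y} (hB : MeasurableSet B) : (planPart σ E : Measure Y) B = σ (E ×ˢ B) := by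
  change (σ.restrict (Prod.fst ⁻¹' E)).map Prod.snd B = _
  rw [Measure.map_apply measurable_snd hB, Measure.restrict_apply (measurable_snd hB)]
  congr 1
  ext p
  exact and_comm

/-- `Ψ` maps Lebesgue measure to `ρ`, and is almost everywhere jointly continuous at `ρ`. -/
def IsSkorokhodAt {Y : Type*} [TopologicalSpace Y] [MeasurableSpace Y] [OpensMeasurableSpace Y]
    (Ψ : FiniteMeasure Y → ℝ → Y) (ρ : FiniteMeasure Y) : Prop :=
  (volume.restrict (Set.Ioo 0 ((ρ : Measure Y).real Set.univ))).map (Ψ ρ) = ρ ∧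
    ∀ᵐ u ∂(volume.restrict (Set.Ioo 0 ((ρ : Measure Y).real Set.univ))),
      ∀ (ρn : ℕ → FiniteMeasure Y) (un : ℕ → ℝ), Tendsto ρn atTop (𝓝 ρ) →
        Tendsto un atTop (𝓝 u) → Tendsto (fun n => Ψ (ρn n) (un n)) atTop (𝓝 (Ψ ρ u))

/-- The map sending the points with label `c` onto the corresponding part of the plan `σ`: a point
is replaced by its rank within its cell, to which the representation `Ψ` is applied. -/
noncomputable def cellMap {X Y C : Type*} [MeasurableSpace X] [MeasurableSpace Y]
    (Ψ : FiniteMeasure Y → ℝ → Y) (g : X → ℝ) (μ : Measure X) (σ : Measure (X × Y))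
    [IsFiniteMeasure σ] (l : X → C) (c : C) (x : X) : Y :=
  Ψ (planPart σ (l ⁻¹' {c})) ((μ.restrict (l ⁻¹' {c})).real {x' | g x' ≤ g x})

theorem Couples.measureReal_planPart_univ {X Y : Type*} [MeasurableSpace X]
    [MeasurableSpace Y] {μ : Measure X} {ν : Measure Y} {σ : Measure (X × Y)} [IsFiniteMeasure σ]
    (hσ : Couples σ Prod.fst Prod.snd μ ν) {E : Set X} (hE : MeasurableSet E) :
    (planPart σ E : Measure Y).real Set.univ = (μ.restrict E).real Set.univ := by
  rw [measureReal_def, measureReal_def, planPart_apply σ E MeasurableSet.univ,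
    Measure.restrict_apply_univ, Set.prod_univ, ← Measure.map_apply measurable_fst hE, hσ.map_left]

theorem map_rank_restrict {X Y : Type*} [MeasurableSpace X] [MeasurableSpace Y]
    {g : X → ℝ} {μ : Measure X} {ν : Measure Y} {σ : Measure (X × Y)}
    [IsFiniteMeasure μ] [IsFiniteMeasure σ]
    (hσ : Couples σ Prod.fst Prod.snd μ ν) (hg : Measurable g) (hinj : Function.Injective g)
    (hμ : ∀ x, μ {x} = 0) {E : Set X} (hE : MeasurableSet E) :
    Measurable (fun x => (μ.restrict E).real {x' | g x' ≤ g x}) ∧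
    (μ.restrict E).map (fun x => (μ.restrict E).real {x' | g x' ≤ g x}) =
      volume.restrict (Set.Ioo 0 ((planPart σ E : Measure Y).real Set.univ)) := by
  rw [hσ.measureReal_planPart_univ hE]
  exact map_measureReal_preimage_Iic (μ.restrict E) hg hinj fun x =>
    nonpos_iff_eq_zero.1 ((Measure.restrict_apply_le E {x}).trans (hμ x).le)

section CellMap

variable {X Y C : Type*} [MeasurableSpace X] [MeasurableSpace Y]
  {Ψ : FiniteMeasure Y → ℝ → Y} {g : X → ℝ} {μ : Measure X} {ν : Measure Y} {σ : Measure (X × Y)}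
  {l : X → C}

theorem measurable_cellMap [Countable C] [IsFiniteMeasure μ] [IsFiniteMeasure σ]
    (hσ : Couples σ Prod.fst Prod.snd μ ν) (hg : Measurable g) (hinj : Function.Injective g)
    (hμ : ∀ x, μ {x} = 0) (hΨ : ∀ ρ, Measurable (Ψ ρ)) (hl : ∀ c, MeasurableSet (l ⁻¹' {c})) :
    Measurable fun x => cellMap Ψ g μ σ l (l x) x :=
  measurable_of_countable_cells hl fun c =>
    (hΨ _).comp (map_rank_restrict hσ hg hinj hμ (hl c)).1

variable [MetricSpace Y] [BorelSpace Y]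

theorem Couples.exists_countable_planPart_eq_zero [IsFiniteMeasure σ]
    (hσ : Couples σ Prod.fst Prod.snd μ ν) [IsProbabilityMeasure ν] [ν.InnerRegular] (E : Set X) :
    ∃ D : Set Y, D.Countable ∧ (planPart σ E : Measure Y) (closure D)ᶜ = 0 := by
  obtain ⟨D, hD, hν⟩ := exists_countable_measure_compl_closure_eq_zero ν
  refine ⟨D, hD, ?_⟩
  rw [planPart_apply σ E isClosed_closure.measurableSet.compl]
  refine measure_mono_null (t := Prod.snd ⁻¹' (closure D)ᶜ) (fun p hp => hp.2) ?_
  rwa [← Measure.map_apply measurable_snd isClosed_closure.measurableSet.compl, hσ.map_right]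

theorem measure_cell_inter_preimage_cellMap [IsFiniteMeasure μ] [IsFiniteMeasure σ]
    (hσ : Couples σ Prod.fst Prod.snd μ ν) (hg : Measurable g) (hinj : Function.Injective g)
    (hμ : ∀ x, μ {x} = 0) (hΨ : ∀ ρ, Measurable (Ψ ρ)) (hl : ∀ c, MeasurableSet (l ⁻¹' {c}))
    {c : C} (hΨc : IsSkorokhodAt Ψ (planPart σ (l ⁻¹' {c}))) {B : Set Y} (hB : MeasurableSet B) :
    μ (l ⁻¹' {c} ∩ (fun x => cellMap Ψ g μ σ l (l x) x) ⁻¹' B) = σ ((l ⁻¹' {c}) ×ˢ B) := by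
  obtain ⟨hm, hmap⟩ := map_rank_restrict hσ hg hinj hμ (hl c)
  have hset : l ⁻¹' {c} ∩ (fun x => cellMap Ψ g μ σ l (l x) x) ⁻¹' B =
      cellMap Ψ g μ σ l c ⁻¹' B ∩ l ⁻¹' {c} := by
    ext x
    simp only [Set.mem_inter_iff, Set.mem_preimage, Set.mem_singleton_iff]
    constructor
    · rintro ⟨rfl, h⟩
      exact ⟨h, rfl⟩
    · rintro ⟨h, rfl⟩
      exact ⟨rfl, h⟩
  have hcm : Measurable (cellMap Ψ g μ σ l c) := (hΨ _).comp hm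
  rw [hset, ← Measure.restrict_apply (hcm hB), ← Measure.map_apply hcm hB,
    ← planPart_apply σ _ hB, ← hΨc.1, ← hmap, Measure.map_map (hΨ _) hm]
  rfl

/-- If the first marginals converge in total variation, the plans converge weakly on each
rectangle, and labels stabilize almost everywhere, then the cell maps converge almost
everywhere. -/
theorem ae_tendsto_cellMap [Countable C] [IsFiniteMeasure μ] [IsFiniteMeasure σ]
    (hσ : Couples σ Prod.fst Prod.snd μ ν) (hg : Measurable g) (hinj : Function.Injective g)
    (hμ : ∀ x, μ {x} = 0) (hl : ∀ c, MeasurableSet (l ⁻¹' {c}))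
    (hΨc : ∀ c, IsSkorokhodAt Ψ (planPart σ (l ⁻¹' {c})))
    {μn : ℕ → Measure X} {νn : ℕ → Measure Y} {σn : ℕ → Measure (X × Y)}
    [∀ n, IsFiniteMeasure (σn n)] {ln : ℕ → X → C}
    (hσn : ∀ n, Couples (σn n) Prod.fst Prod.snd (μn n) (νn n))
    (hln : ∀ n c, MeasurableSet (ln n ⁻¹' {c}))
    (htv : Tendsto (fun n => tvDist (μn n) μ) atTop (𝓝 0))
    (hpair : ∀ E, MeasurableSet E → ∀ F : Y →ᵇ ℝ≥0,
      Tendsto (fun n => pairing (σn n) E fun y => F y) atTop (𝓝 (pairing σ E fun y => F y)))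
    (hlab : ∀ᵐ x ∂μ, ∀ᶠ n in atTop, ln n x = l x) :
    ∀ᵐ x ∂μ, Tendsto (fun n => cellMap Ψ g (μn n) (σn n) (ln n) (ln n x) x) atTop
      (𝓝 (cellMap Ψ g μ σ l (l x) x)) := by
  have hgood : ∀ᵐ x ∂μ, ∀ c, x ∈ l ⁻¹' {c} →
      ∀ (ρn : ℕ → FiniteMeasure Y) (un : ℕ → ℝ), Tendsto ρn atTop (𝓝 (planPart σ (l ⁻¹' {c}))) →
        Tendsto un atTop (𝓝 ((μ.restrict (l ⁻¹' {c})).real {x' | g x' ≤ g x})) →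
        Tendsto (fun n => Ψ (ρn n) (un n)) atTop (𝓝 (cellMap Ψ g μ σ l c x)) := by
    refine ae_all_iff.2 fun c => (ae_restrict_iff' (hl c)).1 ?_
    obtain ⟨hm, hmap⟩ := map_rank_restrict hσ hg hinj hμ (hl c)
    have := (hΨc c).2
    rw [← hmap] at this
    exact ae_of_ae_map hm.aemeasurable this
  have hsd : ∀ c, Tendsto (fun n => μn n (symmDiff (ln n ⁻¹' {c}) (l ⁻¹' {c}))) atTop (𝓝 0) := by
    intro c
    have h1 : Tendsto (fun n => μ (symmDiff (ln n ⁻¹' {c}) (l ⁻¹' {c}))) atTop (𝓝 (μ ∅)) := by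
      refine tendsto_measure_of_ae_tendsto_indicator_of_isFiniteMeasure atTop MeasurableSet.empty
        (fun n => (hln n c).symmDiff (hl c)) ?_
      filter_upwards [hlab] with x hx
      filter_upwards [hx] with n hn
      simp [Set.mem_symmDiff, hn]
    have h2 := h1.add htv
    rw [measure_empty, add_zero] at h2
    exact tendsto_of_tendsto_of_tendsto_of_le_of_le tendsto_const_nhds h2 (fun n => zero_le)
      fun n => measure_le_add_tvDist _ _ ((hln n c).symmDiff (hl c))
  filter_upwards [hgood, hlab] with x hx hxl
  refine Tendsto.congr' (f₁ := fun n => cellMap Ψ g (μn n) (σn n) (ln n) (l x) x) ?_ ?_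
  · filter_upwards [hxl] with n hn
    rw [hn]
  set c := l x with hc
  refine hx c rfl (fun n => planPart (σn n) (ln n ⁻¹' {c}))
    (fun n => ((μn n).restrict (ln n ⁻¹' {c})).real {x' | g x' ≤ g x}) ?_ ?_
  · rw [FiniteMeasure.tendsto_iff_forall_lintegral_tendsto]
    intro F
    have hF : Measurable fun y => (F y : ℝ≥0∞) :=
      measurable_coe_nnreal_ennreal.comp F.continuous.measurable
    simp only [lintegral_planPart _ (hln _ c) hF, lintegral_planPart _ (hl c) hF]
    obtain ⟨M, hM⟩ : ∃ M : ℝ≥0, ∀ y, F y ≤ M := ⟨_, BoundedContinuousFunction.NNReal.upper_bound F⟩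
    have hM' : ∀ y, (F y : ℝ≥0∞) ≤ M := fun y => by exact_mod_cast hM y
    have hfin : pairing σ (l ⁻¹' {c}) (fun y => (F y : ℝ≥0∞)) ≠ ⊤ := by
      rw [← lintegral_planPart _ (hl c) hF]
      exact (F.lintegral_lt_top_of_nnreal _).ne
    refine ennreal_tendsto_of_le_add hfin
      (d := fun n => M * μn n (symmDiff (ln n ⁻¹' {c}) (l ⁻¹' {c}))) (fun n => ?_) (fun n => ?_)
      (hpair _ (hl c) F) ?_
    · rw [← (hσn n).map_left]
      exact pairing_le_add (hln n c) (hl c) hM'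
    · rw [← (hσn n).map_left, symmDiff_comm]
      exact pairing_le_add (hl c) (hln n c) hM'
    · simpa using ENNReal.Tendsto.const_mul (hsd c) (Or.inr (ENNReal.coe_ne_top (r := M)))
  · have hG : MeasurableSet {x' | g x' ≤ g x} := hg measurableSet_Iic
    simp only [measureReal_def, Measure.restrict_apply hG]
    refine (ENNReal.tendsto_toReal (measure_ne_top _ _)).comp ?_
    simp only [Set.inter_comm {x' | g x' ≤ g x}]
    refine ennreal_tendsto_of_le_add (measure_ne_top _ _)
      (v := fun n => μn n (l ⁻¹' {c} ∩ {x' | g x' ≤ g x}))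
      (d := fun n => μn n (symmDiff (ln n ⁻¹' {c}) (l ⁻¹' {c}))) (fun n => ?_) (fun n => ?_) ?_
      (hsd c)
    · exact measure_inter_le_add _ _ _
    · rw [symmDiff_comm]
      exact measure_inter_le_add _ _ _
    · refine ennreal_tendsto_of_le_add (measure_ne_top _ _)
        (v := fun _ => μ (l ⁻¹' {c} ∩ {x' | g x' ≤ g x})) (d := fun n => tvDist (μn n) μ)
        (fun n => ?_) (fun n => ?_) tendsto_const_nhds htv
      · exact measure_le_add_tvDist _ _ ((hl c).inter hG)
      · rw [tvDist_comm]
        exact measure_le_add_tvDist _ _ ((hl c).inter hG)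

end CellMap

/-- The level of a point, together with its coordinates below the level; the level is `r` minus the
rank of the point, rounded up. -/
noncomputable def levelLabel {X : Type*} [MeasurableSpace X] (e : X → ℕ → Bool) (g : X → ℝ)
    (μ : Measure X) (r : ℝ) (x : X) : Σ n : ℕ, Fin n → Bool :=
  ⟨⌈r - μ.real {x' | g x' ≤ g x}⌉₊, fun i => e x i⟩

section LevelLabel

variable {X : Type*} [MeasurableSpace X] {e : X → ℕ → Bool} {g : X → ℝ} {μ : Measure X}

theorem levelLabel_eq_iff {r : ℝ} {x : X} {c : Σ n : ℕ, Fin n → Bool} :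
    levelLabel e g μ r x = c ↔
      ⌈r - μ.real {x' | g x' ≤ g x}⌉₊ = c.1 ∧ ∀ i : Fin c.1, e x i = c.2 i := by
  obtain ⟨n, v⟩ := c
  constructor
  · intro h
    unfold levelLabel at h
    cases h
    exact ⟨rfl, fun i => rfl⟩
  · rintro ⟨rfl, h⟩
    exact Sigma.ext rfl (heq_of_eq (funext h))

theorem levelLabel_eq_levelLabel {μ' : Measure X} {r r' : ℝ} {x : X}
    (h : ⌈r - μ.real {x' | g x' ≤ g x}⌉₊ = ⌈r' - μ'.real {x' | g x' ≤ g x}⌉₊) :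
    levelLabel e g μ r x = levelLabel e g μ' r' x :=
  levelLabel_eq_iff.2 ⟨h, fun _ => rfl⟩

theorem measurableSet_levelLabel_preimage (he : Measurable e)
    (hrank : Measurable fun x => μ.real {x' | g x' ≤ g x}) (r : ℝ) (c : Σ n : ℕ, Fin n → Bool) :
    MeasurableSet (levelLabel e g μ r ⁻¹' {c}) := by
  have : levelLabel e g μ r ⁻¹' {c} =
      (fun x => ⌈r - μ.real {x' | g x' ≤ g x}⌉₊) ⁻¹' {c.1} ∩
        ⋂ i : Fin c.1, (fun x => e x i) ⁻¹' {c.2 i} := by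
    ext x
    simp [levelLabel_eq_iff]
  rw [this]
  refine (Measurable.nat_ceil (hrank.const_sub r) (measurableSet_singleton _)).inter ?_
  exact MeasurableSet.iInter fun i => (measurable_pi_apply _).comp he (measurableSet_singleton _)

theorem mem_iff_of_levelLabel_eq [IsProbabilityMeasure μ] {r : ℝ} {A : Set X}
    (hA : IsLevel e ⌈r - 1⌉₊ A) {x x' : X}
    (h : levelLabel e g μ r x = levelLabel e g μ r x') : x ∈ A ↔ x' ∈ A := by
  obtain ⟨-, h2⟩ := levelLabel_eq_iff.1 h
  refine hA x x' fun i hi => ?_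
  have hle : ⌈r - 1⌉₊ ≤ ⌈r - μ.real {y | g y ≤ g x'}⌉₊ :=
    Nat.ceil_mono (by linarith [measureReal_le_one (μ := μ) (s := {y | g y ≤ g x'})])
  exact h2 ⟨i, hi.trans_le hle⟩

theorem ae_eventually_levelLabel_eq [IsProbabilityMeasure μ] (hg : Measurable g)
    (hinj : Function.Injective g) (hμ : ∀ x, μ {x} = 0) {μn : ℕ → Measure X}
    (hμn : ∀ A, MeasurableSet A → Tendsto (fun n => μn n A) atTop (𝓝 (μ A)))
    {r : ℝ} {rn : ℕ → ℝ} (hr : Tendsto rn atTop (𝓝 r)) :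
    ∀ᵐ x ∂μ, ∀ᶠ n in atTop, levelLabel e g (μn n) (rn n) x = levelLabel e g μ r x := by
  obtain ⟨hm, hmap⟩ := map_measureReal_preimage_Iic μ hg hinj hμ
  have h1 : ∀ᵐ u ∂(μ.map fun x => μ.real {x' | g x' ≤ g x}), ∀ k : ℕ, r - u ≠ k := by
    rw [hmap]
    refine ae_all_iff.2 fun k => ae_restrict_of_ae ?_
    filter_upwards [Measure.ae_ne volume (r - k)] with u hu h
    exact hu (by linarith)
  filter_upwards [ae_of_ae_map hm.aemeasurable h1] with x hx
  have h2 : Tendsto (fun n => rn n - (μn n).real {x' | g x' ≤ g x}) atTop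
      (𝓝 (r - μ.real {x' | g x' ≤ g x})) :=
    hr.sub ((ENNReal.tendsto_toReal (measure_ne_top _ _)).comp (hμn _ (hg measurableSet_Iic)))
  filter_upwards [eventually_natCeil_eq hx h2] with n hn
  exact levelLabel_eq_levelLabel hn

end LevelLabel

theorem approx_monge_varying_marginals_souslin
    {X Y T Z : Type*}
    -- `X` is a Souslin space: a Hausdorff space that is the image of the complete separable
    -- metric space `Z` under the continuous mapping `f`
    [TopologicalSpace X] [T2Space X]
    [MetricSpace Z] [CompleteSpace Z] [TopologicalSpace.SeparableSpace Z]
    (f : Z → X) (hf : Continuous f) (hfsurj : Function.Surjective f)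
    [MetricSpace Y] [CompleteSpace Y] [MetricSpace T]
    [MeasurableSpace X] [BorelSpace X] [MeasurableSpace Y] [BorelSpace Y]
    (μ : T → ProbabilityMeasure X) (ν : T → ProbabilityMeasure Y)
    -- the measures are Radon
    (hμr : ∀ t, (μ t : Measure X).InnerRegular) (hνr : ∀ t, (ν t : Measure Y).InnerRegular)
    (hμna : ∀ t, IsNonatomic (μ t : Measure X))
    (hμc : TVContinuousFamily fun t => (μ t : Measure X))
    -- continuity in the weak topology
    (hνc : Continuous ν)
    (h : X → Y → T → ℝ)
    (hcont : Continuous fun p : X × Y × T => h p.1 p.2.1 p.2.2)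
    (hnonneg : ∀ x y t, 0 ≤ h x y t)
    (a : T → X → ℝ) (b : T → Y → ℝ)
    (hameas : ∀ t, Measurable (a t)) (hbmeas : ∀ t, Measurable (b t))
    (ha0 : ∀ t x, 0 ≤ a t x) (hb0 : ∀ t y, 0 ≤ b t y)
    (haint : ∀ t, Integrable (a t) (μ t : Measure X))
    (hbint : ∀ t, Integrable (b t) (ν t : Measure Y))
    (hdom : ∀ t x y, h x y t ≤ a t x + b t y)
    (hunif : ∀ δ > (0 : ℝ), ∃ R₀ : ℝ, ∀ R ≥ R₀, ∀ t : T,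
      (∫ x in {x | R ≤ a t x}, a t x ∂(μ t : Measure X)) +
        ∫ y in {y | R ≤ b t y}, b t y ∂(ν t : Measure Y) ≤ δ)
    (ε : ℝ) (hε : 0 < ε) :
    ∃ S : T → X → Y,
      (∀ t, IsEpsOptimalMonge ε (fun x y => h x y t) (μ t : Measure X) (ν t : Measure Y) (S t)) ∧
      (∀ (t : T) (tn : ℕ → T), Tendsto tn atTop (𝓝 t) →
        ∀ᵐ x ∂(μ t : Measure X), Tendsto (fun n => S (tn n) x) atTop (𝓝 (S t x))) := by
  have hUI := fun (δ : ℝ) (hδ : δ > 0) => exists_forall_lintegral_add_le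
    (μ := fun t => (μ t : Measure X)) (ν := fun t => (ν t : Measure Y))
    hameas hbmeas ha0 hb0 haint hbint hunif hδ
  obtain ⟨e, he, heinj, hgen⟩ := exists_encoding hf hfsurj
  have hemb := measurableEmbedding_embeddingReal (ℕ → Bool)
  let g : X → ℝ := fun x => embeddingReal (ℕ → Bool) (e x)
  have hg : Measurable g := hemb.measurable.comp he
  have hginj : Function.Injective g := hemb.injective.comp heinj
  have hμ0 : ∀ t x, (μ t : Measure X) {x} = 0 := fun t =>
    measure_singleton_eq_zero_of_isNonatomic (hμna t)
  rcases isEmpty_or_nonempty T with hT | ⟨⟨t₁⟩⟩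
  · exact ⟨fun t => hT.elim t, fun t => hT.elim t, fun t => hT.elim t⟩
  have : Nonempty Y := (ν t₁ : Measure Y).nonempty_of_neZero
  obtain ⟨Ψ, hΨm, hΨ⟩ := exists_skorokhod_representation Y
  have hε2 : 0 < ε / 2 := half_pos hε
  obtain ⟨σ, hσ, hσc⟩ := exists_continuous_plan hμr hνr hμc hνc hcont hnonneg hameas hbmeas hdom
    hUI hε2
  have : ∀ t, IsProbabilityMeasure (σ t) := fun t => (hσ t).1.isProbabilityMeasure
  let good : T → ℕ → Prop := fun t m => ∀ S : X → Y,
    Couples (μ t : Measure X) id S (μ t : Measure X) (ν t : Measure Y) →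
    (∀ A, MeasurableSet A → IsLevel e m A → ∀ B, MeasurableSet B →
      (μ t : Measure X) (A ∩ S ⁻¹' B) = σ t (A ×ˢ B)) →
    ∫⁻ x, ENNReal.ofReal (h x (S x) t) ∂(μ t : Measure X) ≤
      ∫⁻ p, ENNReal.ofReal (h p.1 p.2 t) ∂(σ t) + ENNReal.ofReal (ε / 2)
  obtain ⟨N, hN⟩ : ∃ N : C(T, ℝ), ∀ t, N t ∈ {r : ℝ | ∀ m : ℕ, r - 1 ≤ m → good t m} := by
    refine exists_continuous_forall_mem_convex_of_local_const (fun t => ?_) fun t₀ => ?_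
    · refine Set.OrdConnected.convex ⟨fun r hr r' _ s hs m hm => hr m ?_⟩
      linarith [hs.1]
    · obtain ⟨m₀, hm₀⟩ := exists_level_forall_cost_le hμr hνr hμc hνc hcont hnonneg hameas hbmeas
        hdom hUI he hgen hε2 t₀
      refine ⟨m₀ + 1, ?_⟩
      filter_upwards [hm₀] with t ht m hm S hS hAB
      refine ht m ?_ (σ t) (hσ t).1 S hS hAB
      rw [add_sub_cancel_right] at hm
      exact_mod_cast hm
  let l : T → X → Σ n : ℕ, Fin n → Bool := fun t => levelLabel e g (μ t : Measure X) (N t)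
  have hl : ∀ t c, MeasurableSet (l t ⁻¹' {c}) := fun t =>
    measurableSet_levelLabel_preimage he
      (map_measureReal_preimage_Iic (μ t : Measure X) hg hginj (hμ0 t)).1 (N t)
  have hΨc : ∀ t c, IsSkorokhodAt Ψ (planPart (σ t) (l t ⁻¹' {c})) := fun t c =>
    hΨ _ ((hσ t).1.exists_countable_planPart_eq_zero _)
  refine ⟨fun t x => cellMap Ψ g (μ t : Measure X) (σ t) (l t) (l t x) x, fun t => ?_,
    fun t tn htn => ?_⟩
  · have hSm := measurable_cellMap (l := l t) (hσ t).1 hg hginj (hμ0 t) hΨm (hl t)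
    have hcell := fun c B (hB : MeasurableSet B) => measure_cell_inter_preimage_cellMap
      (l := l t) (hσ t).1 hg hginj (hμ0 t) hΨm (hl t) (hΨc t c) hB
    have hmap : (μ t : Measure X).map (fun x => cellMap Ψ g (μ t : Measure X) (σ t) (l t) (l t x) x)
        = (ν t : Measure Y) := by
      ext B hB
      have := measure_inter_preimage_eq_of_cells (hl t) hSm hcell (A := Set.univ)
        (fun _ _ _ => Iff.rfl) hB
      rw [Measure.map_apply hSm hB, ← (hσ t).1.map_right, Measure.map_apply measurable_snd hB]
      rwa [Set.univ_inter, Set.univ_prod] at this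
    refine ⟨hSm, hmap, ?_⟩
    refine (hN t ⌈N t - 1⌉₊ (Nat.le_ceil _) _ ⟨measurable_id, hSm, Measure.map_id, hmap⟩
      fun A hA hAl B hB => measure_inter_preimage_eq_of_cells (hl t) hSm hcell
        (fun x x' hx => mem_iff_of_levelLabel_eq hAl hx) hB).trans ?_
    calc _ ≤ _ + ENNReal.ofReal (ε / 2) + ENNReal.ofReal (ε / 2) := by
          gcongr
          exact (hσ t).2
      _ = _ := by
          rw [add_assoc, ← ENNReal.ofReal_add hε2.le hε2.le, add_halves]
  · exact ae_tendsto_cellMap (hσ t).1 hg hginj (hμ0 t) (hl t) (hΨc t) (fun n => (hσ (tn n)).1)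
      (fun n => hl (tn n)) ((hμc t).comp htn) (fun E hE F => ((hσc E hE F).tendsto t).comp htn)
      (ae_eventually_levelLabel_eq hg hginj (hμ0 t)
        (fun A hA => (hμc.tendsto_measure t hA).comp htn) ((N.continuous.tendsto t).comp htn))
end

section
/- Let $X$ be a completely regular Hausdorff topological space and let $\mu$ be a non-atomic Radon probability measure on $X$ that is concentrated on a countable union of metrizable compact sets. (A Radon probability measure is a Borel probability measure such that for every Borel set $B$ and every $\varepsilon>0$ there is a compact set $K\subset B$ with $\mu(B\setminus K)<\varepsilon$; non-atomic means that every point has measure zero.) Let $\lambda$ denote Lebesgue measure. Then for every $\varepsilon>0$ there exist a metrizable compact set $K_1\subset X$, a compact set $S\subset[0,1]$ and a homeomorphism $\varphi\colon S\to K_1$ such that the image under $\varphi$ of $\lambda$ restricted to $S$ equals the restriction of $\mu$ to $K_1$, that is, $\lambda(\varphi^{-1}(B))=\mu(B)$ for every Borel set $B\subset K_1$ (in particular $\lambda(S)=\mu(K_1)$), and $0<\mu(X\setminus K_1)<\varepsilon$. -/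
open MeasureTheory

/-- A countable union of metrizable compact sets admits a Borel function separating its points. -/
theorem exists_measurable_injOn_iUnion_isCompact {X : Type*} [TopologicalSpace X] [T2Space X]
    [MeasurableSpace X] [BorelSpace X] {K : ℕ → Set X} (hK : ∀ n, IsCompact (K n))
    (hm : ∀ n, TopologicalSpace.MetrizableSpace (K n)) :
    ∃ g : X → ℝ, Measurable g ∧ Set.InjOn g (⋃ n, K n) := by
  have hg : ∀ n, ∃ g : X → ℝ, Measurable g ∧ Set.InjOn g (K n) ∧
      (∀ x ∈ K n, 0 < g x) ∧ ∀ x ∉ K n, g x = 0 := by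
    intro n
    have : CompactSpace (K n) := isCompact_iff_compactSpace.mp (hK n)
    have : TopologicalSpace.MetrizableSpace (K n) := hm n
    let := TopologicalSpace.metrizableSpaceMetric (K n)
    have : PolishSpace (K n) := inferInstance
    let e : K n → ℝ := fun x ↦ Real.exp (embeddingReal (K n) x)
    have he : Measurable e :=
      Real.measurable_exp.comp (measurableEmbedding_embeddingReal (K n)).measurable
    have hei : Function.Injective e :=
      Real.exp_injective.comp (measurableEmbedding_embeddingReal (K n)).injective
    have hval : ∀ x (hx : x ∈ K n), Function.extend Subtype.val e 0 x = e ⟨x, hx⟩ :=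
      fun x hx ↦ Subtype.val_injective.extend_apply e 0 ⟨x, hx⟩
    refine ⟨Function.extend Subtype.val e 0,
      (MeasurableEmbedding.subtype_coe (hK n).measurableSet).measurable_extend he
        measurable_const, ?_, ?_, ?_⟩
    · intro x hx y hy hxy
      rw [hval x hx, hval y hy] at hxy
      exact congrArg Subtype.val (hei hxy)
    · intro x hx
      rw [hval x hx]
      exact Real.exp_pos _
    · intro x hx
      rw [Function.extend_apply' _ _ _ (by rintro ⟨y, rfl⟩; exact hx y.2)]
      rfl
  choose g hgm hgi hgpos hgz using hg
  refine ⟨fun x ↦ embeddingReal (ℕ → ℝ) (fun n ↦ g n x),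
    (measurableEmbedding_embeddingReal _).measurable.comp (measurable_pi_lambda _ hgm), ?_⟩
  intro x hx y _ hxy
  have h := (measurableEmbedding_embeddingReal (ℕ → ℝ)).injective hxy
  obtain ⟨n, hn⟩ := Set.mem_iUnion.mp hx
  have hxyn : g n x = g n y := congrFun h n
  refine hgi n hn ?_ hxyn
  by_contra hy
  have := hgpos n x hn
  rw [hxyn, hgz n y hy] at this
  exact this.false

/-- The distribution function of a non-atomic probability measure is continuous. -/
theorem continuous_cdf_of_nullSingletonClass (ν : Measure ℝ) [IsProbabilityMeasure ν]
    [NullSingletonClass ν] : Continuous (ProbabilityTheory.cdf ν) := by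
  refine continuous_iff_continuousAt.mpr fun x ↦ ?_
  rw [(ProbabilityTheory.monotone_cdf ν).continuousAt_iff_leftLim_eq_rightLim,
    StieltjesFunction.rightLim_eq]
  have h := (ProbabilityTheory.cdf ν).measure_singleton x
  rw [ProbabilityTheory.measure_cdf, measure_singleton, eq_comm, ENNReal.ofReal_eq_zero] at h
  exact le_antisymm ((ProbabilityTheory.monotone_cdf ν).leftLim_le le_rfl) (by linarith)

/-- The distribution function of a non-atomic probability measure transports it to Lebesgue measure
on the unit interval. -/
theorem map_cdf_of_nullSingletonClass (ν : Measure ℝ) [IsProbabilityMeasure ν]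
    [NullSingletonClass ν] :
    ν.map (ProbabilityTheory.cdf ν) = volume.restrict (Set.Icc 0 1) := by
  have hc := continuous_cdf_of_nullSingletonClass ν
  have hmono := ProbabilityTheory.monotone_cdf ν
  have hivt : ∀ a ∈ Set.Ioo (0 : ℝ) 1, ∃ t, ProbabilityTheory.cdf ν t = a := fun a ha ↦
    mem_range_of_exists_le_of_exists_ge hc
      (((ProbabilityTheory.tendsto_cdf_atBot ν).eventually_le_const ha.1).exists)
      (((ProbabilityTheory.tendsto_cdf_atTop ν).eventually_const_le ha.2).exists)
  have : IsProbabilityMeasure (ν.map (ProbabilityTheory.cdf ν)) :=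
    Measure.isProbabilityMeasure_map hc.measurable.aemeasurable
  refine Measure.ext_of_Iic _ _ fun a ↦ ?_
  rw [Measure.map_apply hc.measurable measurableSet_Iic, Measure.restrict_apply measurableSet_Iic]
  have hupper : ∀ b ∈ Set.Ioo (0 : ℝ) 1, a < b →
      ν (ProbabilityTheory.cdf ν ⁻¹' Set.Iic a) ≤ ENNReal.ofReal b := by
    intro b hb hab
    obtain ⟨s, hs⟩ := hivt b hb
    rw [← hs, ProbabilityTheory.ofReal_cdf]
    refine measure_mono fun x hx ↦ ?_
    by_contra hxs
    have h1 := hmono (le_of_not_ge hxs)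
    have h2 : ProbabilityTheory.cdf ν x ≤ a := hx
    linarith
  rcases lt_or_ge a 0 with ha | ha
  · have h1 : ProbabilityTheory.cdf ν ⁻¹' Set.Iic a = ∅ :=
      Set.eq_empty_of_forall_notMem fun x hx ↦
        (ha.trans_le (ProbabilityTheory.cdf_nonneg ν x)).not_ge hx
    have h2 : Set.Iic a ∩ Set.Icc 0 1 = ∅ :=
      Set.eq_empty_of_forall_notMem fun x hx ↦ (ha.trans_le hx.2.1).not_ge hx.1
    rw [h1, h2, measure_empty, measure_empty]
  rcases le_or_gt 1 a with ha1 | ha1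
  · have h1 : ProbabilityTheory.cdf ν ⁻¹' Set.Iic a = Set.univ :=
      Set.eq_univ_of_forall fun x ↦ (ProbabilityTheory.cdf_le_one ν x).trans ha1
    have h2 : Set.Iic a ∩ Set.Icc 0 1 = Set.Icc 0 1 :=
      Set.inter_eq_right.mpr fun x hx ↦ hx.2.trans ha1
    rw [h1, h2, measure_univ, Real.volume_Icc]
    simp
  have h2 : Set.Iic a ∩ Set.Icc 0 1 = Set.Icc 0 a := by
    ext x
    simp only [Set.mem_inter_iff, Set.mem_Iic, Set.mem_Icc]
    exact ⟨fun h ↦ ⟨h.2.1, h.1⟩, fun h ↦ ⟨h.2, h.1, h.2.trans ha1.le⟩⟩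
  rw [h2, Real.volume_Icc, sub_zero]
  refine le_antisymm ?_ ?_
  · have hlim : Filter.Tendsto ENNReal.ofReal (nhdsWithin a (Set.Ioi a))
        (nhds (ENNReal.ofReal a)) :=
      (ENNReal.continuous_ofReal.tendsto a).mono_left nhdsWithin_le_nhds
    refine ge_of_tendsto hlim ?_
    filter_upwards [Ioo_mem_nhdsGT ha1] with b hb
    exact hupper b ⟨ha.trans_lt hb.1, hb.2⟩ hb.1
  · rcases ha.eq_or_lt with rfl | ha0
    · simp
    · obtain ⟨t, ht⟩ := hivt a ⟨ha0, ha1⟩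
      conv_lhs => rw [← ht, ProbabilityTheory.ofReal_cdf]
      exact measure_mono fun x hx ↦ (hmono hx).trans ht.le

/-- **Lusin's theorem** for finite inner regular measures: a Borel function is continuous on
compact subsets of almost full measure. -/
theorem Measurable.exists_isCompact_continuousOn {X Y : Type*} [TopologicalSpace X] [T2Space X]
    [MeasurableSpace X] [BorelSpace X] [TopologicalSpace Y] [SecondCountableTopology Y]
    [MeasurableSpace Y] [OpensMeasurableSpace Y] {μ : Measure X} [IsFiniteMeasure μ]
    [μ.InnerRegular] {f : X → Y} (hf : Measurable f) {E : Set X} (hE : MeasurableSet E)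
    {δ : ENNReal} (hδ : δ ≠ 0) :
    ∃ K ⊆ E, IsCompact K ∧ ContinuousOn f K ∧ μ (E \ K) < δ := by
  let B : Set (Set Y) := insert Set.univ (TopologicalSpace.countableBasis Y)
  have hBo : ∀ U : B, IsOpen U.1 := by
    rintro ⟨U, rfl | hU⟩
    · exact isOpen_univ
    · exact TopologicalSpace.isOpen_of_mem_countableBasis hU
  have : Countable B := ((TopologicalSpace.countable_countableBasis Y).insert _).to_subtype
  obtain ⟨r, hr, hrsum⟩ := ENNReal.exists_pos_sum_of_countable' hδ B
  have hr2 : ∀ U, r U / 2 ≠ 0 := fun U ↦ (ENNReal.half_pos (hr U).ne').ne'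
  have hmeas : ∀ U : B, MeasurableSet (f ⁻¹' U.1) := fun U ↦ hf (hBo U).measurableSet
  choose C hCsub hCc hCμ using fun U : B ↦
    (hE.inter (hmeas U)).exists_isCompact_sdiff_lt (measure_ne_top μ _) (hr2 U)
  choose D hDsub hDc hDμ using fun U : B ↦
    (hE.diff (hmeas U)).exists_isCompact_sdiff_lt (measure_ne_top μ _) (hr2 U)
  have hCDc : ∀ U, IsCompact (C U ∪ D U) := fun U ↦ (hCc U).union (hDc U)
  let U₀ : B := ⟨Set.univ, Set.mem_insert _ _⟩
  refine ⟨⋂ U, (C U ∪ D U), ?_, ?_, ?_, ?_⟩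
  · refine (Set.iInter_subset _ U₀).trans (Set.union_subset ?_ ?_)
    · exact (hCsub U₀).trans Set.inter_subset_left
    · exact (hDsub U₀).trans Set.sdiff_subset
  · exact (hCDc U₀).of_isClosed_subset (isClosed_iInter fun U ↦ (hCDc U).isClosed)
      (Set.iInter_subset _ U₀)
  · rw [continuousOn_iff_continuous_domRestrict,
      (TopologicalSpace.isBasis_countableBasis Y).continuous_iff]
    intro U hU
    let V : B := ⟨U, Set.mem_insert_of_mem _ hU⟩
    have hpre : (⋂ U, (C U ∪ D U)).domRestrict f ⁻¹' U = Subtype.val ⁻¹' (D V)ᶜ := by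
      ext ⟨x, hx⟩
      constructor
      · exact fun hxU hxD ↦ (hDsub V hxD).2 hxU
      · exact fun hxD ↦ (hCsub V ((Set.mem_iInter.mp hx V).resolve_right hxD)).2
    rw [hpre]
    exact (hDc V).isClosed.isOpen_compl.preimage continuous_subtype_val
  · refine lt_of_le_of_lt ?_ hrsum
    rw [Set.sdiff_iInter]
    refine (measure_iUnion_le _).trans (ENNReal.tsum_le_tsum fun U ↦ ?_)
    have hsub : E \ (C U ∪ D U) ⊆
        ((E ∩ f ⁻¹' U.1) \ C U) ∪ ((E \ f ⁻¹' U.1) \ D U) := by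
      rintro x ⟨hxE, hx⟩
      by_cases hxU : x ∈ f ⁻¹' U.1
      · exact Or.inl ⟨⟨hxE, hxU⟩, fun h ↦ hx (Or.inl h)⟩
      · exact Or.inr ⟨⟨hxE, hxU⟩, fun h ↦ hx (Or.inr h)⟩
    calc μ (E \ (C U ∪ D U)) ≤ _ := measure_mono hsub
      _ ≤ _ := measure_union_le _ _
      _ ≤ r U / 2 + r U / 2 := add_le_add (hCμ U).le (hDμ U).le
      _ = r U := ENNReal.add_halves _

/-- A non-atomic probability measure concentrated on a Borel set whose points are separated by a
real Borel function is almost isomorphic to Lebesgue measure on the unit interval. -/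
theorem exists_measurable_injOn_map_eq_volume {X : Type*} [MeasurableSpace X] {μ : Measure X}
    [IsProbabilityMeasure μ] [NullSingletonClass μ] {g : X → ℝ} (hg : Measurable g) {Y : Set X}
    (hY : MeasurableSet Y) (hμY : μ Yᶜ = 0) (hgi : Set.InjOn g Y) :
    ∃ (h : X → ℝ) (Z : Set X), Measurable h ∧ (∀ x, h x ∈ Set.Icc 0 1) ∧
      μ.map h = volume.restrict (Set.Icc 0 1) ∧ MeasurableSet Z ∧ μ Zᶜ = 0 ∧ Set.InjOn h Z := by
  let ν := μ.map g
  have : IsProbabilityMeasure ν := Measure.isProbabilityMeasure_map hg.aemeasurable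
  have : NullSingletonClass ν := by
    refine ⟨fun t ↦ ?_⟩
    rw [Measure.map_apply hg (measurableSet_singleton t)]
    refine measure_mono_null (t := (g ⁻¹' {t} ∩ Y) ∪ Yᶜ) ?_ (measure_union_null ?_ hμY)
    · intro x hx
      by_cases hxY : x ∈ Y
      · exact Or.inl ⟨hx, hxY⟩
      · exact Or.inr hxY
    · refine Set.Subsingleton.measure_zero (fun x hx y hy ↦ hgi hx.2 hy.2 ?_) μ
      exact hx.1.trans hy.1.symm
  let F := ProbabilityTheory.cdf ν
  have hF : Measurable F := (continuous_cdf_of_nullSingletonClass ν).measurable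
  have hmap : ν.map F = volume.restrict (Set.Icc 0 1) := map_cdf_of_nullSingletonClass ν
  let N : Set ℝ := ⋃ q : ℚ, F ⁻¹' {F q}
  have hN : MeasurableSet N := MeasurableSet.iUnion fun q ↦ hF (measurableSet_singleton _)
  have hνN : ν N = 0 := by
    refine measure_iUnion_null fun q ↦ ?_
    rw [← Measure.map_apply hF (measurableSet_singleton _), hmap]
    exact measure_singleton _
  have hFN : ∀ s t, s < t → F s = F t → s ∈ N := by
    intro s t hst hF'
    obtain ⟨q, hsq, hqt⟩ := exists_rat_btwn hst
    exact Set.mem_iUnion.mpr ⟨q, le_antisymm (F.mono hsq.le) (hF' ▸ F.mono hqt.le)⟩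
  refine ⟨F ∘ g, Y ∩ g ⁻¹' Nᶜ, hF.comp hg, fun x ↦ ⟨ProbabilityTheory.cdf_nonneg ν _,
    ProbabilityTheory.cdf_le_one ν _⟩, ?_, hY.inter (hg hN.compl), ?_, ?_⟩
  · rw [← Measure.map_map hF hg]
    exact hmap
  · rw [Set.compl_inter]
    refine measure_union_null hμY ?_
    rw [← Set.preimage_compl, compl_compl, ← Measure.map_apply hg hN]
    exact hνN
  · intro x hx y hy hxy
    refine hgi hx.1 hy.1 ?_
    rcases lt_trichotomy (g x) (g y) with hlt | heq | hlt
    · exact absurd (hFN _ _ hlt hxy) hx.2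
    · exact heq
    · exact absurd (hFN _ _ hlt hxy.symm) hy.2

/-- Let `X` be a completely regular Hausdorff space and let `μ` be a non-atomic Radon probability
measure on `X` concentrated on a countable union of metrizable compact sets. Then for every `ε > 0`
there are a metrizable compact set `K₁ ⊆ X`, a compact set `S ⊆ [0,1]` and a homeomorphism
`φ : S → K₁` carrying Lebesgue measure on `S` to the restriction of `μ` to `K₁` (in particular
`λ(S) = μ(K₁)`), with `0 < μ(X ∖ K₁) < ε`. -/
theorem exists_almost_homeomorphic_chart
    {X : Type*} [TopologicalSpace X] [T35Space X]
    [MeasurableSpace X] [BorelSpace X]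
    (μ : Measure X) (hμp : IsProbabilityMeasure μ) (hμna : NullSingletonClass μ)
    (hμr : μ.InnerRegular)
    (hμconc : ∃ K : ℕ → Set X, (∀ n, IsCompact (K n)) ∧
      (∀ n, TopologicalSpace.MetrizableSpace (K n)) ∧ μ (⋃ n, K n) = 1)
    (ε : ℝ) (hε : 0 < ε) :
    ∃ (K₁ : Set X) (S : Set ℝ) (φ : ↥S ≃ₜ ↥K₁),
      IsCompact K₁ ∧ TopologicalSpace.MetrizableSpace K₁ ∧
      IsCompact S ∧ S ⊆ Set.Icc 0 1 ∧
      (((volume : Measure ℝ).comap (Subtype.val : ↥S → ℝ)).map ⇑φ =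
        μ.comap (Subtype.val : ↥K₁ → X)) ∧
      volume S = μ K₁ ∧
      0 < μ K₁ᶜ ∧ μ K₁ᶜ < ENNReal.ofReal ε := by
  obtain ⟨K, hKc, hKm, hKμ⟩ := hμconc
  have hYm : MeasurableSet (⋃ n, K n) := MeasurableSet.iUnion fun n ↦ (hKc n).measurableSet
  obtain ⟨g, hg, hgi⟩ := exists_measurable_injOn_iUnion_isCompact hKc hKm
  obtain ⟨h, Z, hh, hh01, hmap, hZ, hμZ, hhi⟩ := exists_measurable_injOn_map_eq_volume hg hYm
    ((prob_compl_eq_zero_iff hYm).mpr hKμ) hgi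
  have hvol : ∀ D ⊆ Set.Icc (0 : ℝ) 1, MeasurableSet D → volume D = μ (h ⁻¹' D) := by
    intro D hD hDm
    rw [← Measure.map_apply hh hDm, hmap, Measure.restrict_apply hDm,
      Set.inter_eq_left.mpr hD]
  let δ : ℝ := min ε 1 / 2
  have hδ : 0 < δ := half_pos (lt_min hε one_pos)
  have hδε : δ + δ ≤ ε := (add_halves (min ε 1)).trans_le (min_le_left _ _)
  have hδ1 : δ ≤ 1 := (half_le_self (lt_min hε one_pos).le).trans (min_le_right _ _)
  have hμtop : μ (h ⁻¹' Set.Icc (1 - δ) 1) = ENNReal.ofReal δ := by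
    rw [← hvol _ (Set.Icc_subset_Icc_left (by linarith)) measurableSet_Icc, Real.volume_Icc,
      sub_sub_cancel]
  obtain ⟨K₁, hK₁sub, hK₁c, hcont, hK₁μ⟩ := hh.exists_isCompact_continuousOn (μ := μ)
    (hZ.diff (hh (measurableSet_Icc (a := 1 - δ) (b := 1))))
    (ENNReal.ofReal_pos.mpr hδ).ne'
  have hK₁Z : K₁ ⊆ Z := hK₁sub.trans Set.sdiff_subset
  have hSc : IsCompact (h '' K₁) := hK₁c.image_of_continuousOn hcont
  have hS01 : h '' K₁ ⊆ Set.Icc 0 1 := by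
    rintro _ ⟨x, -, rfl⟩
    exact hh01 x
  have : CompactSpace K₁ := isCompact_iff_compactSpace.mp hK₁c
  let e : K₁ ≃ h '' K₁ := Equiv.Set.imageOfInjOn h K₁ (hhi.mono hK₁Z)
  have hec : Continuous e :=
    (continuousOn_iff_continuous_domRestrict.mp hcont).subtype_mk fun x ↦ ⟨x, x.2, rfl⟩
  let φ : h '' K₁ ≃ₜ K₁ := (hec.homeoOfEquivCompactToT2).symm
  have himage : ∀ A ⊆ K₁, MeasurableSet (h '' A) → volume (h '' A) = μ A := by
    intro A hA hAm
    rw [hvol _ ((Set.image_mono hA).trans hS01) hAm]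
    refine le_antisymm ?_ (measure_mono (Set.subset_preimage_image h A))
    have hsub : h ⁻¹' (h '' A) ⊆ A ∪ Zᶜ := by
      rintro x ⟨y, hyA, hyx⟩
      by_cases hxZ : x ∈ Z
      · exact Or.inl (hhi (hK₁Z (hA hyA)) hxZ hyx ▸ hyA)
      · exact Or.inr hxZ
    calc μ (h ⁻¹' (h '' A)) ≤ μ (A ∪ Zᶜ) := measure_mono hsub
      _ ≤ μ A + μ Zᶜ := measure_union_le _ _
      _ = μ A := by rw [hμZ, add_zero]
  refine ⟨K₁, h '' K₁, φ, hK₁c, φ.symm.isEmbedding.metrizableSpace, hSc, hS01, ?_,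
    himage K₁ subset_rfl hSc.measurableSet, ?_, ?_⟩
  · ext B hB
    have hSe := MeasurableEmbedding.subtype_coe hSc.measurableSet
    have hKe := MeasurableEmbedding.subtype_coe hK₁c.measurableSet
    have hpre : Subtype.val '' (φ ⁻¹' B) = h '' (Subtype.val '' B) := by
      rw [show φ ⁻¹' B = φ.symm '' B from (φ.toEquiv.symm.image_eq_preimage_symm B).symm,
        Set.image_image, Set.image_image]
      rfl
    rw [Measure.map_apply φ.continuous.measurable hB, hSe.comap_apply, hKe.comap_apply, hpre]
    refine himage _ (Subtype.coe_image_subset K₁ B) ?_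
    rw [← hpre]
    exact hSe.measurableSet_image.mpr (φ.continuous.measurable hB)
  · refine (ENNReal.ofReal_pos.mpr hδ).trans_le (hμtop ▸ measure_mono ?_)
    exact fun x hx hxK ↦ (hK₁sub hxK).2 hx
  · have hsub : K₁ᶜ ⊆ h ⁻¹' Set.Icc (1 - δ) 1 ∪
        ((Z \ h ⁻¹' Set.Icc (1 - δ) 1) \ K₁ ∪ Zᶜ) := by
      intro x hx
      by_cases hxZ : x ∈ Z
      · by_cases hxh : x ∈ h ⁻¹' Set.Icc (1 - δ) 1
        · exact Or.inl hxh
        · exact Or.inr (Or.inl ⟨⟨hxZ, hxh⟩, hx⟩)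
      · exact Or.inr (Or.inr hxZ)
    calc μ K₁ᶜ ≤ _ := measure_mono hsub
      _ ≤ _ := measure_union_le _ _
      _ ≤ _ := add_le_add_right (measure_union_le _ _) _
      _ < ENNReal.ofReal δ + ENNReal.ofReal δ := by
        rw [hμtop, hμZ, add_zero]
        exact ENNReal.add_lt_add_left ENNReal.ofReal_ne_top hK₁μ
      _ = ENNReal.ofReal (δ + δ) := (ENNReal.ofReal_add hδ.le hδ.le).symm
      _ ≤ ENNReal.ofReal ε := ENNReal.ofReal_le_ofReal hδε
end
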